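/- Let K be a number field of degree at most 2 over ℚ. Then the only triples (t,y,z) ∈ K³ satisfying both y² = t⁶ + 2t⁵ + 5t⁴ + 10t³ + 10t² + 4t + 1 and z² = t⁶ + 2t⁵ + t⁴ + 2t³ + 6t² + 4t + 1 are the eight triples with t ∈ {0, −1}, y ∈ {1, −1}, and z ∈ {1, −1}. -/

import Mathlib

open Polynomial NumberField

lemma irreducible_of_generalizedEisenstein_two (q f d r : ℤ[X])
    (hq : Irreducible (q.map (algebraMap ℤ (ZMod 2)))) (hqm : q.Monic) (hfm : f.Monic)
    (hdeg : 0 < f.natDegree)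
    (hfq : f.map (algebraMap ℤ (ZMod 2)) = q.map (algebraMap ℤ (ZMod 2)) ^ 2)
    (hdiv : r + q * d = f) (hr : r.degree < q.degree) (k : ℕ) (hk : ¬ (4 : ℤ) ∣ r.coeff k) :
    Irreducible (f.map (algebraMap ℤ ℚ)) := by
  rw [algebraMap_int_eq, ← IsPrimitive.Int.irreducible_iff_irreducible_map_cast hfm.isPrimitive]
  refine generalizedEisenstein (K := ZMod 2) (q := q) (p := 2) hq hqm hfm.isPrimitive hdeg
    (by simp [hfm.leadingCoeff]) (by simpa [hfm.leadingCoeff] using hfq) ?_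
  rw [(div_modByMonic_unique d r hqm ⟨hdiv, hr⟩).2]
  intro h
  have h1 := congrArg (fun p => coeff p k) h
  simp only [coeff_map, coeff_zero] at h1
  rw [Ideal.Quotient.eq_zero_iff_mem] at h1
  have hker : RingHom.ker (algebraMap ℤ (ZMod 2)) = Ideal.span {(2 : ℤ)} := by
    have := ZMod.ker_intCastRingHom 2
    simpa using this
  rw [hker, Ideal.span_singleton_pow, Ideal.mem_span_singleton] at h1
  exact hk (by simpa using h1)

lemma irreducible_cubic_zmod_two (q : (ZMod 2)[X]) (hd : q.natDegree = 3)
    (h0 : q.eval 0 ≠ 0) (h1 : q.eval 1 ≠ 0) : Irreducible q := by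
  rw [irreducible_iff_roots_eq_zero_of_degree_le_three (by omega) (by omega)]
  refine Multiset.eq_zero_of_forall_notMem fun a ha => ?_
  have : q.eval a = 0 := by
    have := (mem_roots'.1 ha).2
    exact this
  fin_cases a
  · exact h0 this
  · exact h1 this

/-- Defining polynomial of the sextic field attached to `X₁(13)`. -/
noncomputable def sexticOne : ℤ[X] := X ^ 6 + 2 * X ^ 5 - 2 * X ^ 3 - X ^ 2 + 1

/-- Defining polynomial of the sextic field attached to `X₁(18)`. -/
noncomputable def sexticTwo : ℤ[X] := X ^ 6 + 2 * X ^ 5 + 3 * X ^ 4 + 2 * X ^ 3 + 2 * X ^ 2 + 1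

lemma natDegree_sexticOne : sexticOne.natDegree = 6 := by
  unfold sexticOne; compute_degree!
lemma monic_sexticOne : sexticOne.Monic := by
  unfold sexticOne; monicity!
lemma natDegree_sexticTwo : sexticTwo.natDegree = 6 := by
  unfold sexticTwo; compute_degree!
lemma monic_sexticTwo : sexticTwo.Monic := by
  unfold sexticTwo; monicity!

lemma irreducible_sexticOne : Irreducible (sexticOne.map (algebraMap ℤ ℚ)) := by
  have two : (2 : (ZMod 2)[X]) = 0 := by
    rw [← C_ofNat, show (OfNat.ofNat 2 : ZMod 2) = 0 from rfl, C_0]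
  have hq3 : (X ^ 3 + X + 1 : ℤ[X]).degree = 3 := by compute_degree!
  refine irreducible_of_generalizedEisenstein_two (X ^ 3 + X + 1) sexticOne
    (X ^ 3 + 2 * X ^ 2 - X - 5) (-2 * X ^ 2 + 6 * X + 6) ?_ (by monicity!) monic_sexticOne
    (by rw [natDegree_sexticOne]; norm_num) ?_ (by unfold sexticOne; ring) ?_ 0 ?_
  · simp only [Polynomial.map_add, Polynomial.map_pow, map_X, Polynomial.map_one]
    exact irreducible_cubic_zmod_two _ (by compute_degree!) (by simp) (by simp; decide)
  · simp only [sexticOne, Polynomial.map_add, Polynomial.map_sub, Polynomial.map_mul,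
      Polynomial.map_pow, map_X, Polynomial.map_one, Polynomial.map_ofNat]
    linear_combination (X ^ 5 - X ^ 4 - 2 * X ^ 3 - X ^ 2 - X) * two
  · rw [hq3]; exact lt_of_le_of_lt (b := 2) (by compute_degree) (by norm_num)
  · simp [coeff_X]

lemma irreducible_sexticTwo : Irreducible (sexticTwo.map (algebraMap ℤ ℚ)) := by
  have two : (2 : (ZMod 2)[X]) = 0 := by
    rw [← C_ofNat, show (OfNat.ofNat 2 : ZMod 2) = 0 from rfl, C_0]
  have hq3 : (X ^ 3 + X ^ 2 + 1 : ℤ[X]).degree = 3 := by compute_degree!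
  refine irreducible_of_generalizedEisenstein_two (X ^ 3 + X ^ 2 + 1) sexticTwo
    (X ^ 3 + X ^ 2 + 2 * X - 1) (2 * X ^ 2 - 2 * X + 2) ?_ (by monicity!) monic_sexticTwo
    (by rw [natDegree_sexticTwo]; norm_num) ?_ (by unfold sexticTwo; ring) ?_ 0 ?_
  · simp only [Polynomial.map_add, Polynomial.map_pow, map_X, Polynomial.map_one]
    exact irreducible_cubic_zmod_two _ (by compute_degree!) (by simp) (by simp; decide)
  · simp only [sexticTwo, Polynomial.map_add, Polynomial.map_mul,
      Polynomial.map_pow, map_X, Polynomial.map_one, Polynomial.map_ofNat]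
    linear_combination (X ^ 4) * two
  · rw [hq3]; exact lt_of_le_of_lt (b := 2) (by compute_degree) (by norm_num)
  · simp [coeff_X]

lemma exists_squarefree_mul_sq {R : Type*} [CommRing R] [IsDomain R] [UniqueFactorizationMonoid R]
    (a : R) (ha : a ≠ 0) : ∃ r s : R, Squarefree r ∧ a = r * s ^ 2 := by
  classical
  induction a using UniqueFactorizationMonoid.induction_on_prime with
  | h₁ => exact absurd rfl ha
  | h₂ x hx => exact ⟨x, 1, hx.squarefree, by ring⟩
  | h₃ a p ha' hp ih =>
    obtain ⟨r, s, hr, rfl⟩ := ih ha'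
    by_cases h : p ∣ r
    · obtain ⟨r', rfl⟩ := h
      exact ⟨r', p * s, hr.of_mul_right, by ring⟩
    · refine ⟨p * r, s, ?_, by ring⟩
      have hrel : IsRelPrime p r := (hp.irreducible.isRelPrime_iff_not_dvd).2 h
      exact squarefree_mul_iff.2 ⟨hrel, hp.irreducible.squarefree, hr⟩

/-- The formal properties of the absolute norm of a sextic ring used below. -/
structure IsNormLike {R : Type*} [CommRing R] (N : R →* ℤ) : Prop where
  dvd : ∀ x, x ∣ ((N x : ℤ) : R)
  map_int : ∀ n : ℤ, N (n : R) = n ^ 6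
  ne_zero : ∀ x, x ≠ 0 → N x ≠ 0

namespace IsNormLike
variable {R : Type*} [CommRing R] {N : R →* ℤ}

lemma isUnit (hN : IsNormLike N) {x : R} (hx : IsUnit (N x)) : IsUnit x :=
  isUnit_of_dvd_unit (hN.dvd x) (hx.map (Int.castRingHom R))

lemma exists_nat_prime (hN : IsNormLike N) {ϖ : R} (h : Prime ϖ) :
    ∃ p : ℕ, p.Prime ∧ ϖ ∣ (p : R) := by
  have key : ∀ n : ℕ, n ≠ 0 → ϖ ∣ (n : R) → ∃ p : ℕ, p.Prime ∧ ϖ ∣ (p : R) := by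
    intro n
    induction n using Nat.recOnPrimePow with
    | zero => intro h0; exact absurd rfl h0
    | one => intro _ h1; exact absurd (isUnit_of_dvd_one (by simpa using h1)) h.not_isUnit
    | prime_pow_mul a p n hp hpa hn ih =>
      intro _ h1
      rw [Nat.cast_mul, Nat.cast_pow] at h1
      rcases h.dvd_mul.1 h1 with h2 | h2
      · exact ⟨p, hp, h.dvd_of_dvd_pow h2⟩
      · exact ih (by rintro rfl; simp at hpa) h2
  refine key (N ϖ).natAbs (by simpa using hN.ne_zero _ h.ne_zero) ?_
  rcases Int.natAbs_eq (N ϖ) with h1 | h1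
  · have := hN.dvd ϖ
    rw [h1] at this
    simpa using this
  · have := hN.dvd ϖ
    rw [h1] at this
    simpa using this

lemma dvd_norm_of_prime_dvd (hN : IsNormLike N) {ϖ : R} (h : Prime ϖ) {p : ℕ} (hp : p.Prime)
    (hd : ϖ ∣ (p : R)) : (p : ℤ) ∣ N ϖ := by
  have h1 : N ϖ ∣ (p : ℤ) ^ 6 := by
    have h2 := map_dvd N hd
    rwa [show ((p : R)) = (((p : ℤ)) : R) by simp, hN.map_int] at h2
  obtain ⟨i, -, hi⟩ := (dvd_prime_pow (Nat.prime_iff_prime_int.1 hp) 6).1 h1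
  rcases i with _ | i
  · rw [pow_zero] at hi
    exact absurd (hN.isUnit (associated_one_iff_isUnit.1 hi)) h.not_isUnit
  · exact (dvd_pow_self _ (by omega)).trans hi.symm.dvd

lemma dvd_of_dvd_norm_prime (hN : IsNormLike N) {ϖ : R} (h : Prime ϖ) {p : ℕ} (hp : p.Prime)
    (hd : (p : ℤ) ∣ N ϖ) : ϖ ∣ (p : R) := by
  obtain ⟨p', hp', hd'⟩ := hN.exists_nat_prime h
  have h1 : N ϖ ∣ (p' : ℤ) ^ 6 := by
    have h2 := map_dvd N hd'
    rwa [show ((p' : R)) = (((p' : ℤ)) : R) by simp, hN.map_int] at h2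
  have h2 : p ∣ p' := by
    have h3 := (Nat.prime_iff_prime_int.1 hp).dvd_of_dvd_pow (hd.trans h1)
    exact_mod_cast h3
  rwa [(Nat.prime_dvd_prime_iff_eq hp hp').1 h2]

lemma exists_prime_dvd_of_dvd_norm [IsDomain R] [UniqueFactorizationMonoid R] (hN : IsNormLike N) {p : ℕ} (hp : p.Prime) (x : R)
    (hx : x ≠ 0) (hd : (p : ℤ) ∣ N x) : ∃ ϖ : R, Prime ϖ ∧ ϖ ∣ x ∧ ϖ ∣ (p : R) := by
  induction x using UniqueFactorizationMonoid.induction_on_prime with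
  | h₁ => exact absurd rfl hx
  | h₂ x hxu =>
    exact absurd (isUnit_of_dvd_unit hd (hxu.map N)) (Nat.prime_iff_prime_int.1 hp).not_isUnit
  | h₃ a ϖ ha' hϖ ih =>
    rw [map_mul] at hd
    rcases (Nat.prime_iff_prime_int.1 hp).dvd_mul.1 hd with h | h
    · exact ⟨ϖ, hϖ, dvd_mul_right _ _, hN.dvd_of_dvd_norm_prime hϖ hp h⟩
    · obtain ⟨ϖ', h1, h2, h3⟩ := ih ha' h
      exact ⟨ϖ', h1, h2.mul_left _, h3⟩

/-- A squarefree element whose norm is a square is a unit, provided that the primes above each `p`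
dividing it divide a common element whose norm is not divisible by `p ^ 2`. -/
lemma isUnit_of_squarefree [IsDomain R] [UniqueFactorizationMonoid R] (hN : IsNormLike N) {r : R} (hr : Squarefree r)
    (hsq : IsSquare (N r))
    (hloc : ∀ p : ℕ, p.Prime → (∃ ϖ : R, Prime ϖ ∧ ϖ ∣ r ∧ ϖ ∣ (p : R)) →
      ∃ y : R, ¬ ((p : ℤ) ^ 2 ∣ N y) ∧ ∀ ϖ : R, Prime ϖ → ϖ ∣ r → ϖ ∣ (p : R) → ϖ ∣ y) :
    IsUnit r := by
  by_contra hu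
  obtain ⟨ϖ, hirr, hϖr⟩ := WfDvdMonoid.exists_irreducible_factor hu hr.ne_zero
  have hϖ : Prime ϖ := hirr.prime
  obtain ⟨p, hp, hϖp⟩ := hN.exists_nat_prime hϖ
  obtain ⟨y, hy, hy'⟩ := hloc p hp ⟨ϖ, hϖ, hϖr, hϖp⟩
  obtain ⟨r', rfl⟩ := hϖr
  have hpN := hN.dvd_norm_of_prime_dvd hϖ hp hϖp
  have hpN' : ¬ (p : ℤ) ^ 2 ∣ N ϖ := fun h =>
    hy (h.trans (map_dvd N (hy' ϖ hϖ (dvd_mul_right _ _) hϖp)))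
  have hr'0 : r' ≠ 0 := right_ne_zero_of_mul hr.ne_zero
  have hpr' : ¬ (p : ℤ) ∣ N r' := by
    intro h
    obtain ⟨ϖ', h1, h2, h3⟩ := hN.exists_prime_dvd_of_dvd_norm hp r' hr'0 h
    have hd1 := hy' ϖ hϖ (dvd_mul_right _ _) hϖp
    have hd2 := hy' ϖ' h1 (h2.mul_left _) h3
    have hna : ¬ ϖ' ∣ ϖ := fun h' => by
      have := hr ϖ' (mul_dvd_mul h' h2)
      exact h1.not_isUnit this
    obtain ⟨y', rfl⟩ := hd1
    have hd3 : ϖ' ∣ y' := (h1.dvd_mul.1 hd2).resolve_left hna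
    apply hy
    rw [map_mul, pow_two]
    exact mul_dvd_mul hpN ((hN.dvd_norm_of_prime_dvd h1 hp h3).trans (map_dvd N hd3))
  have hpI := Nat.prime_iff_prime_int.1 hp
  obtain ⟨a, ha⟩ := hsq
  rw [map_mul] at ha
  have h1 : (p : ℤ) ∣ a := by
    have : (p : ℤ) ∣ a * a := ha ▸ hpN.mul_right _
    exact (hpI.dvd_mul.1 this).elim id id
  have h2 : (p : ℤ) ^ 2 ∣ N ϖ * N r' := by
    rw [ha, pow_two]; exact mul_dvd_mul h1 h1
  exact hpN' ((hpI.coprime_iff_not_dvd.2 hpr').pow_left.dvd_of_dvd_mul_right h2)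

end IsNormLike

/-- A quadratic polynomial over a field is either squarefree or a constant times the square of a
linear polynomial. -/
lemma squarefree_or_eq_mul_sq_of_natDegree_le_two {F : Type*} [Field F] (f : F[X]) (hf : f ≠ 0)
    (hd : f.natDegree ≤ 2) : Squarefree f ∨ ∃ a e : F, a ≠ 0 ∧ f = C a * (X - C e) ^ 2 := by
  by_contra! h
  obtain ⟨h1, h2⟩ := h
  simp only [Squarefree, not_forall] at h1
  obtain ⟨x, ⟨y, hy⟩, hx⟩ := h1
  have hx0 : x ≠ 0 := by rintro rfl; simp at hy; exact hf hy
  have hy0 : y ≠ 0 := by rintro rfl; simp at hy; exact hf hy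
  have hdx : 0 < x.natDegree := by
    by_contra! h
    rw [Nat.le_zero, natDegree_eq_zero] at h
    obtain ⟨c, rfl⟩ := h
    exact hx (isUnit_C.2 (isUnit_iff_ne_zero.2 (by simpa using hx0)))
  have hdeg : f.natDegree = x.natDegree + x.natDegree + y.natDegree := by
    rw [hy, natDegree_mul (mul_ne_zero hx0 hx0) hy0, natDegree_mul hx0 hx0]
  have hx1 : x.natDegree = 1 := by omega
  obtain ⟨c, rfl⟩ := natDegree_eq_zero.1 (show y.natDegree = 0 by omega)
  obtain ⟨u, hu, v, rfl⟩ := natDegree_eq_one.1 hx1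
  have hc : c ≠ 0 := by simpa using hy0
  refine h2 (c * u ^ 2) (-v / u) (mul_ne_zero hc (pow_ne_zero _ hu)) ?_
  have : (C u * X + C v : F[X]) = C u * (X - C (-v / u)) := by
    rw [mul_sub, ← C_mul, mul_div_cancel₀ _ hu]; simp
  rw [hy, this, C_mul, C_pow]; ring

lemma exists_sub_C_mul_eq_of_map_dvd {p : ℕ} (A U : ℤ[X])
    (h : U.map (Int.castRingHom (ZMod p)) ∣ A.map (Int.castRingHom (ZMod p))) :
    ∃ L A' : ℤ[X], A = U * L + C (p : ℤ) * A' := by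
  obtain ⟨l, hl⟩ := h
  obtain ⟨L, rfl⟩ := map_surjective (Int.castRingHom (ZMod p)) (ZMod.ringHom_surjective _) l
  have h1 : (A - U * L).map (Int.castRingHom (ZMod p)) = 0 := by simp [hl]
  have h2 : C (p : ℤ) ∣ A - U * L := by
    rw [C_dvd_iff_dvd_coeff]
    intro i
    have := congrArg (fun f => coeff f i) h1
    simp only [coeff_map, coeff_zero, eq_intCast] at this
    exact (ZMod.intCast_zmod_eq_zero_iff_dvd _ p).1 this
  obtain ⟨A', hA'⟩ := h2
  exact ⟨L, A', by rw [← hA']; ring⟩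

lemma map_ne_zero_of_isPrimitive {p : ℕ} (hp : p.Prime) (U : ℤ[X]) (hU : U.IsPrimitive) :
    U.map (Int.castRingHom (ZMod p)) ≠ 0 := by
  intro h
  have h2 : C (p : ℤ) ∣ U := by
    rw [C_dvd_iff_dvd_coeff]
    intro i
    have := congrArg (fun f => coeff f i) h
    simp only [coeff_map, coeff_zero, eq_intCast] at this
    exact (ZMod.intCast_zmod_eq_zero_iff_dvd _ p).1 this
  exact (Nat.prime_iff_prime_int.1 hp).not_isUnit (hU _ h2)

lemma dvd_of_dvd_C_mul_of_isPrimitive {U f : ℤ[X]} (hU : U.IsPrimitive) {n : ℤ} (hn : n ≠ 0)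
    (h : U ∣ C n * f) : U ∣ f := by
  rw [IsPrimitive.Int.dvd_iff_map_cast_dvd_map_cast U _ hU] at h ⊢
  rw [Polynomial.map_mul, map_C] at h
  have hu : IsUnit (C ((Int.castRingHom ℚ) n)) :=
    isUnit_C.2 (isUnit_iff_ne_zero.2 (by simpa using hn))
  exact hu.dvd_mul_left.1 h

lemma exists_minimal_denominator (U A G : ℤ[X]) (m : ℤ) (hU : U.IsPrimitive)
    (hd : U.natDegree ≤ 2) (hm : m ≠ 0) (h : U ∣ A ^ 2 - C (m ^ 2) * G) :
    ∃ (A : ℤ[X]) (m : ℤ), m ≠ 0 ∧ U ∣ A ^ 2 - C (m ^ 2) * G ∧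
      ∀ p : ℕ, p.Prime → (p : ℤ) ∣ m → ∃ (a e : ℤ) (S : ℤ[X]),
        ¬ (p : ℤ) ∣ a ∧ U = C a * (X - C e) ^ 2 + C (p : ℤ) * S := by
  induction hk : m.natAbs using Nat.strong_induction_on generalizing m A with
  | _ k ih =>
  by_cases hall : ∀ p : ℕ, p.Prime → (p : ℤ) ∣ m → ∃ (a e : ℤ) (S : ℤ[X]),
        ¬ (p : ℤ) ∣ a ∧ U = C a * (X - C e) ^ 2 + C (p : ℤ) * S
  · exact ⟨A, m, hm, h, hall⟩
  push Not at hall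
  obtain ⟨p, hp, ⟨m', rfl⟩, hno⟩ := hall
  have : Fact p.Prime := ⟨hp⟩
  have hp0 : (p : ℤ) ≠ 0 := by exact_mod_cast hp.ne_zero
  have hm' : m' ≠ 0 := right_ne_zero_of_mul hm
  have hU0 := map_ne_zero_of_isPrimitive hp U hU
  have hdvd : U.map (Int.castRingHom (ZMod p)) ∣ A.map (Int.castRingHom (ZMod p)) := by
    rcases squarefree_or_eq_mul_sq_of_natDegree_le_two _ hU0 ((natDegree_map_le).trans hd) with
      hsq | ⟨a, e, ha, he⟩
    · rw [← hsq.dvd_pow_iff_dvd two_ne_zero]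
      have := Polynomial.map_dvd (Int.castRingHom (ZMod p)) h
      simpa using this
    · exfalso
      obtain ⟨a, rfl⟩ := ZMod.intCast_surjective a
      obtain ⟨e, rfl⟩ := ZMod.intCast_surjective e
      obtain ⟨L, S, hS⟩ := exists_sub_C_mul_eq_of_map_dvd (p := p) (U - C a * (X - C e) ^ 2) 0
        (by simp [he])
      refine hno a e S (fun h => ha ((ZMod.intCast_zmod_eq_zero_iff_dvd _ p).2 h)) ?_
      linear_combination hS
  obtain ⟨L, A', hA'⟩ := exists_sub_C_mul_eq_of_map_dvd A U hdvd
  refine ih m'.natAbs ?_ A' m' hm' ?_ rfl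
  · rw [← hk, Int.natAbs_mul]
    have h1 := Int.natAbs_pos.2 hm'
    have h2 := hp.one_lt
    simp only [Int.natAbs_natCast]
    nlinarith
  · apply dvd_of_dvd_C_mul_of_isPrimitive hU (pow_ne_zero 2 hp0)
    have h3 : C ((p : ℤ) ^ 2) * (A' ^ 2 - C (m' ^ 2) * G)
        = (A ^ 2 - C ((p * m') ^ 2) * G) - U * (L * (A + C (p : ℤ) * A')) := by
      rw [hA']; simp only [C_mul, C_pow]; ring
    rw [h3]
    exact dvd_sub h (dvd_mul_right _ _)

lemma eq_unit_mul_sq_of_dvd {R : Type*} [CommRing R] [IsDomain R] [UniqueFactorizationMonoid R]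
    {N : R →* ℤ} (hN : IsNormLike N) (τ : R) (G U A : ℤ[X]) (m : ℤ) (hU : U.IsPrimitive)
    (hd : U.natDegree ≤ 2) (hm : m ≠ 0) (h : U ∣ A ^ 2 - C (m ^ 2) * G)
    (hG : aeval τ G = 0) (hNτ : ∀ e : ℤ, N ((e : R) - τ) = G.eval e)
    (hU0 : aeval τ U ≠ 0) (h2 : ∀ ϖ : R, Prime ϖ → ϖ ∣ aeval τ U → ¬ ϖ ∣ 2) (p₀ : ℕ)
    (hp₀ : p₀.Prime) (e₀ : ℤ)
    (hspec : ∀ ϖ : R, Prime ϖ → ϖ ∣ aeval τ (derivative G) → ¬ ϖ ∣ 2 →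
      ϖ ∣ (p₀ : R) ∧ ϖ ∣ (e₀ : R) - τ)
    (h₀ : ¬ (p₀ : ℤ) ^ 2 ∣ G.eval e₀) (hsq : IsSquare (N (aeval τ U) : ℚ)) :
    ∃ (ε : Rˣ) (s : R), aeval τ U = ε * s ^ 2 := by
  obtain ⟨A, m, hm, ⟨W, hW⟩, hmin⟩ := exists_minimal_denominator U A G m hU hd hm h
  obtain ⟨r, s, hr, hrs⟩ := exists_squarefree_mul_sq _ hU0
  have hs0 : s ≠ 0 := by rintro rfl; simp at hrs; exact hU0 hrs
  have hcop : ∀ (ϖ : R), Prime ϖ → ∀ (p : ℕ), p.Prime → ϖ ∣ (p : R) → ∀ a : ℤ, ϖ ∣ (a : R) →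
      (p : ℤ) ∣ a := by
    intro ϖ hϖ p hp hϖp a hϖa
    by_contra hpa
    obtain ⟨x, y, hxy⟩ := (Nat.prime_iff_prime_int.1 hp).coprime_iff_not_dvd.2 hpa
    apply hϖ.not_isUnit
    apply isUnit_of_dvd_one
    have : (1 : R) = x * p + y * a := by
      have := congrArg (Int.cast (R := R)) hxy
      push_cast at this; exact this.symm
    rw [this]
    exact dvd_add (hϖp.mul_left _) (hϖa.mul_left _)
  have hspec' : ∀ (ϖ : R), Prime ϖ → ϖ ∣ r → ∀ p : ℕ, p.Prime → ϖ ∣ (p : R) →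
      ϖ ∣ aeval τ (derivative G) → p = p₀ ∧ ϖ ∣ (e₀ : R) - τ := by
    intro ϖ hϖ hϖr p hp hϖp hd
    obtain ⟨h3, h4⟩ := hspec ϖ hϖ hd (h2 ϖ hϖ (by rw [hrs]; exact hϖr.mul_right _))
    refine ⟨?_, h4⟩
    have h5 := hcop ϖ hϖ p hp hϖp p₀ (by simpa using h3)
    exact (Nat.prime_dvd_prime_iff_eq hp hp₀).1 (by exact_mod_cast h5)
  have hru : IsUnit r := by
    apply hN.isUnit_of_squarefree hr
    · rw [hrs, map_mul, map_pow] at hsq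
      have hNs : (N s : ℚ) ≠ 0 := by exact_mod_cast hN.ne_zero s hs0
      obtain ⟨q, hq⟩ := hsq
      rw [← Rat.isSquare_intCast_iff]
      refine ⟨q / N s, ?_⟩
      push_cast at hq
      field_simp
      linear_combination hq
    · intro p hp ⟨ϖ₁, hϖ₁, hϖ₁r, hϖ₁p⟩
      by_cases hpm : (p : ℤ) ∣ m
      · obtain ⟨a, e, S, hpa, hUe⟩ := hmin p hp hpm
        have hτe : ∀ ϖ : R, Prime ϖ → ϖ ∣ r → ϖ ∣ (p : R) → ϖ ∣ (e : R) - τ := by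
          intro ϖ hϖ hϖr hϖp
          have h3 : ϖ ∣ aeval τ U := by rw [hrs]; exact hϖr.mul_right _
          have h4 : aeval τ U = a * ((e : R) - τ) ^ 2 + p * aeval τ S := by
            rw [hUe]
            simp only [eq_intCast, map_add, map_mul, map_pow, map_sub, aeval_X, map_intCast,
              Int.cast_natCast, map_natCast]
            ring
          rw [h4] at h3
          have h5 := (dvd_add_left (hϖp.mul_right _)).1 h3
          rcases hϖ.dvd_mul.1 h5 with h6 | h6
          · exact absurd (hcop ϖ hϖ p hp hϖp a h6) hpa
          · exact hϖ.dvd_of_dvd_pow h6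
        by_cases hG' : (p : ℤ) ∣ (derivative G).eval e
        · have h3 : ∀ ϖ : R, Prime ϖ → ϖ ∣ r → ϖ ∣ (p : R) → ϖ ∣ aeval τ (derivative G) := by
            intro ϖ hϖ hϖr hϖp
            have h4 : (e : R) - τ ∣ aeval (e : R) (derivative G) - aeval τ (derivative G) := by
              simp only [aeval_def, ← eval_map]
              exact sub_dvd_eval_sub _ _ _
            have h5 : aeval (e : R) (derivative G) = (((derivative G).eval e : ℤ) : R) := by
              have := aeval_algebraMap_apply R e (derivative G)
              simpa using this
            have h6 : ϖ ∣ aeval (e : R) (derivative G) := by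
              rw [h5]
              obtain ⟨c, hc⟩ := hG'
              rw [hc]; push_cast; exact hϖp.mul_right _
            exact (dvd_sub_right h6).1 ((hτe ϖ hϖ hϖr hϖp).trans h4)
          obtain ⟨rfl, -⟩ := hspec' ϖ₁ hϖ₁ hϖ₁r p hp hϖ₁p (h3 ϖ₁ hϖ₁ hϖ₁r hϖ₁p)
          refine ⟨(e₀ : R) - τ, by rwa [hNτ], fun ϖ hϖ hϖr hϖp => ?_⟩
          exact (hspec' ϖ hϖ hϖr p hp hϖp (h3 ϖ hϖ hϖr hϖp)).2
        · by_cases hG2 : (p : ℤ) ^ 2 ∣ G.eval e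
          · refine ⟨((e + p : ℤ) : R) - τ, ?_, fun ϖ hϖ hϖr hϖp => ?_⟩
            · rw [hNτ]
              intro h3
              obtain ⟨k, hk⟩ := G.binomExpansion e p
              rw [hk, dvd_add_left (dvd_mul_left _ _), dvd_add_right hG2, pow_two] at h3
              exact hG' ((mul_dvd_mul_iff_right (by exact_mod_cast hp.ne_zero)).1 h3)
            · have h3 : (((e + p : ℤ) : R)) - τ = (e - τ) + p := by push_cast; ring
              rw [h3]
              exact dvd_add (hτe ϖ hϖ hϖr hϖp) hϖp
          · exact ⟨(e : R) - τ, by rwa [hNτ], hτe⟩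
      · have h3 : ∀ ϖ : R, Prime ϖ → ϖ ∣ r → ϖ ∣ (p : R) → ϖ ∣ aeval τ (derivative G) := by
          intro ϖ hϖ hϖr hϖp
          have hα : ϖ ∣ aeval τ U := by rw [hrs]; exact hϖr.mul_right _
          have hAW : (aeval τ A) ^ 2 = r * s ^ 2 * aeval τ W := by
            have := congrArg (aeval τ) hW
            simp only [map_sub, map_mul, map_pow, hG, mul_zero, sub_zero] at this
            rw [this, hrs]
          have hsA : s ∣ aeval τ A := by
            rw [← IsIntegrallyClosed.pow_dvd_pow_iff two_ne_zero, hAW]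
            exact ⟨r * aeval τ W, by ring⟩
          obtain ⟨A', hA'⟩ := hsA
          have hA'W : A' * A' = r * aeval τ W := by
            have : s ^ 2 * (A' * A') = s ^ 2 * (r * aeval τ W) := by
              rw [hA'] at hAW; linear_combination hAW
            exact mul_left_cancel₀ (pow_ne_zero 2 hs0) this
          have hϖA' : ϖ ∣ A' := by
            have : ϖ ∣ A' * A' := hA'W ▸ hϖr.mul_right _
            exact (hϖ.dvd_mul.1 this).elim id id
          have hϖW : ϖ ∣ aeval τ W :=
            Squarefree.dvd_of_squarefree_of_mul_dvd_mul_right hr (hA'W ▸ mul_dvd_mul hϖA' hϖA')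
          have hϖA : ϖ ∣ aeval τ A := hA' ▸ hϖA'.mul_left _
          have h4 := congrArg (fun f => aeval τ (derivative f)) hW
          simp only [derivative_sub, derivative_mul, derivative_C, derivative_pow, map_sub,
            map_mul, map_add, zero_mul, zero_add] at h4
          have h5 : ϖ ∣ ((m : ℤ) : R) ^ 2 * aeval τ (derivative G) := by
            have h6 : ((m : ℤ) : R) ^ 2 * aeval τ (derivative G) =
                (2 * aeval τ (derivative A)) * aeval τ A - aeval τ (derivative U) * aeval τ W
                - aeval τ U * aeval τ (derivative W) := by
              simp only [Nat.cast_ofNat, map_ofNat, Nat.add_one_sub_one, pow_one, eq_intCast,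
                map_pow, map_intCast] at h4
              linear_combination -h4
            rw [h6]
            exact dvd_sub (dvd_sub (hϖA.mul_left _) (hϖW.mul_left _)) (hα.mul_right _)
          rcases hϖ.dvd_mul.1 h5 with h6 | h6
          · exact absurd (hcop ϖ hϖ p hp hϖp m (hϖ.dvd_of_dvd_pow h6)) hpm
          · exact h6
        obtain ⟨rfl, -⟩ := hspec' ϖ₁ hϖ₁ hϖ₁r p hp hϖ₁p (h3 ϖ₁ hϖ₁ hϖ₁r hϖ₁p)
        refine ⟨(e₀ : R) - τ, by rwa [hNτ], fun ϖ hϖ hϖr hϖp => ?_⟩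
        exact (hspec' ϖ hϖ hϖr p hp hϖp (h3 ϖ hϖ hϖr hϖp)).2
  obtain ⟨ε, rfl⟩ := hru
  exact ⟨ε, s, hrs⟩

/-- If the unit rank is two, any eight units that are pairwise distinct modulo squares represent
all units modulo squares. -/
lemma exists_isSquare_mul_of_card_eq_eight {K : Type*} [Field K] [NumberField K]
    (hrank : Units.rank K = 2) {ι : Type*} [Fintype ι] (hι : Fintype.card ι = 8)
    (E : ι → (𝓞 K)ˣ) (hE : ∀ i j, IsSquare (E i * E j) → i = j) (x : (𝓞 K)ˣ) :
    ∃ i, IsSquare (x * E i) := by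
  classical
  obtain ⟨ζ, hζ⟩ := IsCyclic.exists_generator (α := Units.torsion K)
  have hrep : ∀ y : (𝓞 K)ˣ, ∃ (a : ℤ) (f : Fin (Units.rank K) → ℤ),
      y = (ζ : (𝓞 K)ˣ) ^ a * ∏ i, (Units.fundSystem K i) ^ (f i) := by
    intro y
    obtain ⟨⟨z, f⟩, h, -⟩ := Units.exist_unique_eq_mul_prod K y
    obtain ⟨a, ha⟩ := Subgroup.mem_zpowers_iff.1 (hζ z)
    refine ⟨a, f, ?_⟩
    rw [h, ← ha]; simp
  choose a f haf using hrep
  let χ : (𝓞 K)ˣ → ZMod 2 × (Fin (Units.rank K) → ZMod 2) :=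
    fun y => ((a y : ZMod 2), fun i => (f y i : ZMod 2))
  have hχ : ∀ y z, χ y = χ z → IsSquare (y * z) := by
    intro y z h
    have hpar : ∀ m n : ℤ, ((m : ZMod 2) = (n : ZMod 2)) → Even (m + n) := by
      intro m n h
      rw [← ZMod.intCast_eq_zero_iff_even]
      push_cast
      rw [h, CharTwo.add_self_eq_zero]
    have h1 := hpar _ _ (congrArg Prod.fst h)
    have h2 := fun i => hpar _ _ (congrFun (congrArg Prod.snd h) i)
    have h3 : y * z = (ζ : (𝓞 K)ˣ) ^ (a y + a z) *
        ∏ i, (Units.fundSystem K i) ^ (f y i + f z i) := by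
      conv_lhs => rw [haf y, haf z]
      simp only [zpow_add, Finset.prod_mul_distrib]
      exact mul_mul_mul_comm _ _ _ _
    rw [h3]
    refine IsSquare.mul (h1.isSquare_zpow _) ?_
    exact Finset.isSquare_prod _ fun i _ => (h2 i).isSquare_zpow _
  have hinj : Function.Injective (χ ∘ E) := fun i j h => hE i j (hχ _ _ h)
  have hcard : Fintype.card ι = Fintype.card (ZMod 2 × (Fin (Units.rank K) → ZMod 2)) := by
    simp [hι, hrank, ZMod.card]
  obtain ⟨i, hi⟩ := ((Fintype.bijective_iff_injective_and_card _).2 ⟨hinj, hcard⟩).2 (χ x)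
  exact ⟨i, hχ _ _ hi.symm⟩

lemma abs_discr_le_of_family {K : Type*} [Field K] [NumberField K] {n : ℕ}
    (hn : Module.finrank ℚ K = n) (v : Fin n → 𝓞 K)
    (hv : Algebra.discr ℚ (fun i => (v i : K)) ≠ 0) :
    (|NumberField.discr K| : ℚ) ≤ |Algebra.discr ℚ (fun i => (v i : K))| := by
  let b : Module.Basis (Fin n) ℤ (𝓞 K) := (RingOfIntegers.basis K).reindex
    (Fintype.equivFinOfCardEq (by
      rw [← Module.finrank_eq_card_chooseBasisIndex, RingOfIntegers.rank, hn]))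
  have h1 : Algebra.discr ℤ v = (b.toMatrix v).det ^ 2 * Algebra.discr ℤ b := by
    rw [← Algebra.discr_of_matrix_vecMul, Module.Basis.toMatrix_map_vecMul]
  have h2 : Algebra.discr ℚ (fun i => (v i : K)) = ((Algebra.discr ℤ v : ℤ) : ℚ) := by
    rw [Algebra.discr_def, Algebra.discr_def, ← eq_intCast (algebraMap ℤ ℚ), RingHom.map_det]
    congr 1
    ext i j
    simp only [Algebra.traceMatrix_apply, Algebra.traceForm_apply, RingHom.mapMatrix_apply,
      Matrix.map_apply]
    rw [← map_mul, Algebra.trace_localization ℤ (nonZeroDivisors ℤ)]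
  rw [h2, h1, discr_eq_discr] at hv ⊢
  have h3 : (b.toMatrix v).det ≠ 0 := by
    intro h; apply hv; rw [h]; simp
  have h4 : (1 : ℤ) ≤ (b.toMatrix v).det ^ 2 := by
    have := pow_pos (abs_pos.2 h3) 2
    rw [sq_abs] at this; omega
  have h5 : |NumberField.discr K| ≤ |(b.toMatrix v).det ^ 2 * NumberField.discr K| := by
    rw [abs_mul, abs_of_pos (by omega : (0:ℤ) < (b.toMatrix v).det ^ 2)]
    nlinarith [abs_nonneg (NumberField.discr K)]
  exact_mod_cast h5

lemma isNormLike_norm {K : Type*} [Field K] [NumberField K] (hn : Module.finrank ℚ K = 6) :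
    IsNormLike (Algebra.norm ℤ : 𝓞 K →* ℤ) where
  dvd x := by
    have h := Ideal.absNorm_mem (Ideal.span {x})
    rw [Ideal.absNorm_span_singleton, Ideal.mem_span_singleton] at h
    rcases Int.natAbs_eq (Algebra.norm ℤ x) with h1 | h1
    · rw [h1]; simpa using h
    · rw [h1]; simpa using h
  map_int n := by
    have := Algebra.norm_algebraMap_of_basis (RingOfIntegers.basis K) n
    rw [← Module.finrank_eq_card_chooseBasisIndex, RingOfIntegers.rank, hn] at this
    simpa using this
  ne_zero x hx := Algebra.norm_ne_zero_iff.2 hx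

lemma norm_algebraMap_sub_gen {K : Type*} [Field K] [NumberField K] (pb : PowerBasis ℚ K) (e : ℚ) :
    Algebra.norm ℚ (algebraMap ℚ K e - pb.gen) = (minpoly ℚ pb.gen).eval e := by
  rw [← charpoly_leftMulMatrix pb, Matrix.eval_charpoly, Algebra.norm_eq_matrix_det pb.basis]
  congr 1
  rw [map_sub, AlgHom.commutes, Matrix.algebraMap_eq_diagonal]
  rfl

lemma exists_eq_mul_add_linear {F : Type*} [Field F] (A U : F[X]) (hU : U.natDegree = 2) :
    ∃ p q : F, ∃ Q : F[X], A = U * Q + (C p * X + C q) := by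
  have h1 : (A % U).natDegree < 2 := by
    rw [← hU]; exact natDegree_mod_lt _ (by omega)
  refine ⟨(A % U).coeff 1, (A % U).coeff 0, A / U, ?_⟩
  rw [← eq_X_add_C_of_natDegree_le_one (by omega), EuclideanDomain.div_add_mod]

lemma isSquare_norm_aeval_of_natDegree_le_two {K : Type*} [Field K] [NumberField K]
    (pb : PowerBasis ℚ K) (hn : Module.finrank ℚ K = 6) (U A W : ℚ[X]) (m : ℚ) (hm : m ≠ 0)
    (hU : U.natDegree ≤ 2) (h : A ^ 2 - C (m ^ 2) * minpoly ℚ pb.gen = U * W) :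
    IsSquare (Algebra.norm ℚ (aeval pb.gen U)) := by
  set G := minpoly ℚ pb.gen with hG
  have hdim : pb.dim = 6 := by rw [← hn, pb.finrank]
  have hNC : ∀ q : ℚ, Algebra.norm ℚ (algebraMap ℚ K q) = q ^ 6 := fun q => by
    rw [Algebra.norm_algebraMap, hn]
  rcases Nat.lt_or_ge U.natDegree 2 with hlt | hge
  · rcases Nat.lt_or_ge U.natDegree 1 with h0 | h1
    · obtain ⟨u, rfl⟩ := natDegree_eq_zero.1 (Nat.lt_one_iff.1 h0)
      rw [aeval_C, hNC]
      exact ⟨u ^ 3, by ring⟩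
    · obtain ⟨u, hu, v, rfl⟩ := natDegree_eq_one.1 (show U.natDegree = 1 by omega)
      have h2 : aeval pb.gen (C u * X + C v) =
          algebraMap ℚ K (-u) * (algebraMap ℚ K (-v / u) - pb.gen) := by
        simp only [map_add, map_mul, aeval_C, aeval_X, mul_sub, ← map_mul]
        rw [show -u * (-v / u) = v by field_simp]
        simp; ring
      rw [h2, map_mul, hNC, norm_algebraMap_sub_gen, ← hG]
      have h3 := congrArg (eval (-v / u)) h
      simp only [eval_sub, eval_mul, eval_pow, eval_C, eval_add, eval_X] at h3
      rw [mul_div_cancel₀ _ hu, neg_add_cancel, zero_mul, sub_eq_zero] at h3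
      refine ⟨u ^ 3 * A.eval (-v / u) / m, ?_⟩
      generalize A.eval (-v / u) = x at *
      generalize G.eval (-v / u) = y at *
      field_simp
      linear_combination -h3
  · have hU2 : U.natDegree = 2 := le_antisymm hU hge
    let M : Matrix (Fin pb.dim) (Fin pb.dim) ℂ :=
      (Algebra.leftMulMatrix pb.basis pb.gen).map (algebraMap ℚ ℂ)
    have hdet : ∀ r : ℂ, (M - Matrix.scalar _ r).det = (G.map (algebraMap ℚ ℂ)).eval r := by
      intro r
      rw [hG, ← charpoly_leftMulMatrix pb, ← Matrix.charpoly_map, Matrix.eval_charpoly,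
        ← neg_sub, Matrix.det_neg]
      simp [hdim, M, Even.neg_pow (show Even 6 by decide)]
    obtain ⟨w, v, u, hu, rfl⟩ : ∃ w v u : ℚ, u ≠ 0 ∧ U = C u * X ^ 2 + C v * X + C w := by
      refine ⟨U.coeff 0, U.coeff 1, U.coeff 2, ?_, ?_⟩
      · rw [← hU2]; exact leadingCoeff_ne_zero.2 (by rintro rfl; simp at hU2)
      · conv_lhs => rw [U.as_sum_range_C_mul_X_pow, hU2]
        simp [Finset.sum_range_succ]; ring
    have huC : (u : ℂ) ≠ 0 := by exact_mod_cast hu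
    obtain ⟨δ, hδ⟩ := IsAlgClosed.exists_pow_nat_eq ((v : ℂ) ^ 2 - 4 * u * w) two_pos
    set r : ℂ := (-v + δ) / (2 * u) with hr
    set r' : ℂ := (-v - δ) / (2 * u) with hr'
    have hsum : (u : ℂ) * (r + r') = -v := by rw [hr, hr']; field_simp; ring
    have hprod : (u : ℂ) * (r * r') = w := by
      rw [hr, hr']; field_simp; linear_combination -hδ
    obtain ⟨p, q, Q, hA⟩ := exists_eq_mul_add_linear A _ hU2
    have hev : ∀ z : ℂ, (u : ℂ) * z ^ 2 + v * z + w = 0 →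
        (p * z + q) ^ 2 = (m : ℂ) ^ 2 * (G.map (algebraMap ℚ ℂ)).eval z := by
      intro z hz
      have h1 := congrArg (fun f => eval z (f.map (algebraMap ℚ ℂ))) h
      simp only [hA, Polynomial.map_sub, Polynomial.map_mul, Polynomial.map_add,
        Polynomial.map_pow, map_C, map_X, eval_sub, eval_mul, eval_pow, eval_add, eval_C,
        eval_X, eq_ratCast, Rat.cast_pow] at h1
      rw [hz] at h1
      linear_combination h1
    have hzr : (u : ℂ) * r ^ 2 + v * r + w = 0 := by linear_combination r * hsum - hprod
    have hzr' : (u : ℂ) * r' ^ 2 + v * r' + w = 0 := by linear_combination r' * hsum - hprod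
    have hN : ((Algebra.norm ℚ (aeval pb.gen (C u * X ^ 2 + C v * X + C w)) : ℚ) : ℂ) =
        u ^ 6 * ((G.map (algebraMap ℚ ℂ)).eval r * (G.map (algebraMap ℚ ℂ)).eval r') := by
      rw [← hdet, ← hdet, Algebra.norm_eq_matrix_det pb.basis, ← eq_ratCast (algebraMap ℚ ℂ),
        RingHom.map_det, ← Matrix.det_mul, show (6 : ℕ) = Fintype.card (Fin pb.dim) by simp [hdim],
        ← Matrix.det_smul]
      congr 1
      have h1 : (Algebra.leftMulMatrix pb.basis)
          ((aeval pb.gen) (C u * X ^ 2 + C v * X + C w)) =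
          u • (Algebra.leftMulMatrix pb.basis pb.gen) ^ 2 +
          v • (Algebra.leftMulMatrix pb.basis pb.gen) + w • 1 := by
        rw [← aeval_algHom_apply]
        simp [Algebra.smul_def, aeval_C]
      rw [h1]
      have h2 : (algebraMap ℚ ℂ).mapMatrix (u • (Algebra.leftMulMatrix pb.basis pb.gen) ^ 2 +
          v • (Algebra.leftMulMatrix pb.basis pb.gen) + w • 1) =
          (u : ℂ) • M ^ 2 + (v : ℂ) • M + (w : ℂ) • 1 := by
        rw [map_add, map_add]
        congr 1
        · congr 1
          · ext i j
            simp [M, ← Matrix.map_pow]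
          · ext i j
            simp [M]
        · ext i j
          by_cases hij : i = j <;> simp [hij]
      rw [h2, ← hprod, show (v : ℂ) = -(u * (r + r')) by rw [hsum, neg_neg]]
      simp only [Matrix.scalar_apply, ← Matrix.smul_one_eq_diagonal, sub_mul, mul_sub, smul_sub,
        smul_mul_assoc, mul_smul_comm, one_mul, mul_one, ← pow_two]
      module
    set d : ℚ := p ^ 2 * (w / u) + p * q * (-v / u) + q ^ 2 with hd
    have hdC : (p * r + q) * (p * r' + q) = (d : ℂ) := by
      rw [hd]; push_cast
      field_simp
      linear_combination (p : ℂ) ^ 2 * hprod + (p : ℂ) * q * hsum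
    refine ⟨u ^ 3 * d / m ^ 2, ?_⟩
    have : (((Algebra.norm ℚ (aeval pb.gen (C u * X ^ 2 + C v * X + C w)) : ℚ)) : ℂ) =
        ((u ^ 3 * d / m ^ 2 * (u ^ 3 * d / m ^ 2) : ℚ) : ℂ) := by
      have hmC : (m : ℂ) ≠ 0 := by exact_mod_cast hm
      rw [hN]; push_cast; rw [← hdC]
      field_simp
      linear_combination (-(m : ℂ) ^ 2 * (G.map (algebraMap ℚ ℂ)).eval r') * hev r hzr
        - (p * r + q) ^ 2 * hev r' hzr'
    exact_mod_cast this

lemma isTotallyComplex_of_sq_eq_neg {K : Type*} [Field K] [NumberField K] (w : K) (c : ℚ)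
    (hc : 0 < c) (hw : w ^ 2 = -(c : K)) : IsTotallyComplex K := by
  refine ⟨fun v => ?_⟩
  rw [← InfinitePlace.not_isReal_iff_isComplex, InfinitePlace.isReal_iff]
  intro hv
  have h1 : v.embedding w ^ 2 = -(c : ℂ) := by rw [← map_pow, hw]; simp
  obtain ⟨r, hr⟩ := Complex.conj_eq_iff_real.1 (RingHom.congr_fun hv w)
  rw [hr] at h1
  have h2 : r ^ 2 = -(c : ℝ) := by exact_mod_cast h1
  have h3 : (0 : ℝ) < c := by exact_mod_cast hc
  nlinarith [sq_nonneg r]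

lemma nrComplexPlaces_eq_three {K : Type*} [Field K] [NumberField K]
    (hn : Module.finrank ℚ K = 6) [IsTotallyComplex K] : InfinitePlace.nrComplexPlaces K = 3 := by
  have := InfinitePlace.card_add_two_mul_card_eq_rank K
  rw [IsTotallyComplex.nrRealPlaces_eq_zero, hn] at this
  omega

lemma units_rank_eq_two {K : Type*} [Field K] [NumberField K]
    (hn : Module.finrank ℚ K = 6) [IsTotallyComplex K] : Units.rank K = 2 := by
  rw [Units.rank, InfinitePlace.card_eq_nrRealPlaces_add_nrComplexPlaces,
    IsTotallyComplex.nrRealPlaces_eq_zero, nrComplexPlaces_eq_three hn]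

lemma isPrincipalIdealRing_of_forall_absNorm_lt {K : Type*} [Field K] [NumberField K]
    (hn : Module.finrank ℚ K = 6) [IsTotallyComplex K] (S B : ℕ)
    (hd : |NumberField.discr K| ≤ (S : ℤ) ^ 2) (hSB : 32 * S < 1000 * B)
    (h : ∀ I : Ideal (𝓞 K), I.IsPrime → I ≠ ⊥ → Ideal.absNorm I < B → I.IsPrincipal) :
    IsPrincipalIdealRing (𝓞 K) := by
  refine RingOfIntegers.isPrincipalIdealRing_of_isPrincipal_of_norm_le_of_isPrime ?_
  intro I hI hIn
  refine h I hI (nonZeroDivisors.coe_ne_zero I) ?_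
  rw [nrComplexPlaces_eq_three hn, hn] at hIn
  have hsq : √(|NumberField.discr K| : ℝ) ≤ S := by
    refine Real.sqrt_le_iff.2 ⟨Nat.cast_nonneg _, ?_⟩
    exact_mod_cast hd
  have hpi : 4 / Real.pi ≤ 1.274 := by
    rw [div_le_iff₀ Real.pi_pos]
    nlinarith [Real.pi_gt_d4]
  have hpi0 : 0 ≤ 4 / Real.pi := by positivity
  have h3 : (4 / Real.pi) ^ 3 ≤ 1.274 ^ 3 := pow_le_pow_left₀ hpi0 hpi 3
  have h4 : (Ideal.absNorm (I : Ideal (𝓞 K)) : ℝ) ≤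
      1.274 ^ 3 * (((6 : ℕ).factorial : ℝ) / (6 : ℕ) ^ 6 * S) := by
    refine hIn.trans ?_
    gcongr
  have h5 : (32 : ℝ) * S < 1000 * B := by exact_mod_cast hSB
  have h6 : (Ideal.absNorm (I : Ideal (𝓞 K)) : ℝ) < B := by
    norm_num [Nat.factorial] at h4
    linarith [Nat.cast_nonneg (α := ℝ) S]
  exact_mod_cast h6

lemma quotient_facts_of_isPrime {K : Type*} [Field K] [NumberField K] (I : Ideal (𝓞 K))
    (hI : I.IsPrime) (h0 : I ≠ ⊥) : IsPrimePow (Ideal.absNorm I) ∧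
      ((Ideal.absNorm I : 𝓞 K ⧸ I) = 0) ∧ ∀ x : 𝓞 K ⧸ I, x ^ Ideal.absNorm I = x := by
  have := hI.isMaximal h0
  letI := Ideal.Quotient.field I
  have : Finite (𝓞 K ⧸ I) := Ideal.finiteQuotientOfFreeOfNeBot I h0
  letI := Fintype.ofFinite (𝓞 K ⧸ I)
  have hc : Ideal.absNorm I = Fintype.card (𝓞 K ⧸ I) := by
    rw [Ideal.absNorm_apply, Submodule.cardQuot_apply, Nat.card_eq_fintype_card]
  rw [hc]
  exact ⟨Fintype.isPrimePow_card_of_field, Nat.cast_card_eq_zero _, FiniteField.pow_card⟩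

/-- The data of the sextic field `ℚ(θ)` with `h(θ) + 2wq(θ) = 0`, where `w² = -c`,
`h = t³ + t² - 2t - 1` and `q = t² + t`. -/
structure SexticField (c : ℤ) (K : Type*) [Field K] [NumberField K] where
  w : 𝓞 K
  θ : 𝓞 K
  w_sq : w ^ 2 = -(c : 𝓞 K)
  θ_rel : θ ^ 3 + θ ^ 2 - 2 * θ - 1 + 2 * w * (θ ^ 2 + θ) = 0
  finrank_eq : Module.finrank ℚ K = 6
  adjoin_eq_top : Algebra.adjoin ℚ {((θ - 1 : 𝓞 K) : K)} = ⊤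
  isPrincipalIdealRing : IsPrincipalIdealRing (𝓞 K)

lemma adjoin_sub_one_eq_top {K : Type*} [Field K] [NumberField K] (w θ : K)
    (h : θ ^ 3 + θ ^ 2 - 2 * θ - 1 + 2 * w * (θ ^ 2 + θ) = 0)
    (htop : Algebra.adjoin ℚ {θ + w} = ⊤) : Algebra.adjoin ℚ {θ - 1} = ⊤ := by
  rw [← IntermediateField.adjoin_simple_toSubalgebra_of_isAlgebraic
    (Algebra.IsAlgebraic.isAlgebraic _)]
  set F := IntermediateField.adjoin ℚ {θ - 1}
  have h1 : θ - 1 ∈ F := IntermediateField.mem_adjoin_simple_self ℚ _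
  have h2 : θ ∈ F := by
    have := F.add_mem h1 F.one_mem
    simpa using this
  have hq : θ ^ 2 + θ ≠ 0 := by
    intro h0
    have h3 : θ * (θ + 1) = 0 := by linear_combination h0
    rcases mul_eq_zero.1 h3 with h4 | h4
    · rw [h4] at h; norm_num at h
    · rw [eq_neg_of_add_eq_zero_left h4] at h; norm_num at h
  have h3 : w ∈ F := by
    have : w = -(θ ^ 3 + θ ^ 2 - 2 * θ - 1) / (2 * (θ ^ 2 + θ)) := by
      rw [eq_div_iff (by simpa using hq)]
      linear_combination h
    rw [this]
    have two : (2 : K) ∈ F := ofNat_mem F 2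
    exact F.div_mem (F.neg_mem (F.sub_mem (F.sub_mem (F.add_mem (pow_mem h2 3) (pow_mem h2 2))
      (F.mul_mem two h2)) F.one_mem)) (F.mul_mem two (F.add_mem (pow_mem h2 2) h2))
  rw [eq_top_iff, ← htop, Algebra.adjoin_le_iff,
    Set.singleton_subset_iff]
  exact F.add_mem h2 h3

lemma discr_powerBasis_le {K : Type*} [Field K] [NumberField K]
    (pb : PowerBasis ℚ K) (μ : 𝓞 K) (hμ : (μ : K) = pb.gen) (hn : Module.finrank ℚ K = 6) (D : ℕ)
    (hD : D ≠ 0)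
    (h : |Algebra.norm ℚ (aeval pb.gen (derivative (minpoly ℚ pb.gen)))| = D) :
    |NumberField.discr K| ≤ (D : ℤ) := by
  have hdim : pb.dim = 6 := by rw [← hn, pb.finrank]
  have h1 : (fun i : Fin pb.dim => ((μ ^ (i : ℕ) : 𝓞 K) : K)) = pb.basis := by
    ext i; simp [hμ]
  have h3 : |Algebra.discr ℚ pb.basis| = D := by
    rw [Algebra.discr_powerBasis_eq_norm, abs_mul, h]; simp
  have h2 := abs_discr_le_of_family pb.finrank (fun i : Fin pb.dim => μ ^ (i : ℕ)) (by
    intro h0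
    rw [h1] at h0
    rw [h0] at h3
    simp at h3
    exact hD (by exact_mod_cast h3.symm))
  rw [h1, h3] at h2
  exact_mod_cast h2

lemma abs_norm_eq_one_of_mul_eq_one {K : Type*} [Field K] [NumberField K] (u v : 𝓞 K)
    (h : u * v = 1) : |Algebra.norm ℚ (u : K)| = 1 := by
  have h1 := (NumberField.isUnit_iff_norm (x := u)).1 (.of_mul_eq_one _ h)
  simpa using h1

lemma norm_intCast {K : Type*} [Field K] [NumberField K] (n : ℤ) :
    Algebra.norm ℚ (n : K) = n ^ Module.finrank ℚ K := by
  simpa using Algebra.norm_algebraMap (S := K) (n : ℚ)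

lemma norm_intCast_sub_gen {K : Type*} [Field K] [NumberField K] (pb : PowerBasis ℚ K)
    (P : ℤ[X]) (hP : minpoly ℚ pb.gen = P.map (algebraMap ℤ ℚ)) (e : ℤ) :
    Algebra.norm ℚ ((e : K) - pb.gen) = (P.eval e : ℤ) := by
  have := norm_algebraMap_sub_gen pb (e : ℚ)
  rw [hP] at this
  simpa using this

lemma aeval_eq_zero_of_minpoly_eq {K : Type*} [Field K] [NumberField K] (pb : PowerBasis ℚ K)
    (μ : 𝓞 K) (hμ : (μ : K) = pb.gen) (P : ℤ[X])
    (hP : minpoly ℚ pb.gen = P.map (algebraMap ℤ ℚ)) : aeval μ P = 0 := by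
  apply RingOfIntegers.coe_injective
  have h := minpoly.aeval ℚ pb.gen
  rw [hP, aeval_map_algebraMap, ← hμ] at h
  rw [map_zero, ← aeval_algebraMap_apply]
  exact h

noncomputable def sexticFieldOne {K : Type*} [Field K] [NumberField K] (pb : PowerBasis ℚ K)
    (μ : 𝓞 K) (hμ : (μ : K) = pb.gen)
    (hP : minpoly ℚ pb.gen = sexticOne.map (algebraMap ℤ ℚ)) : SexticField 1 K := by
  have hrel : μ ^ 6 + 2 * μ ^ 5 - 2 * μ ^ 3 - μ ^ 2 + 1 = 0 := by
    simpa [sexticOne, map_ofNat] using aeval_eq_zero_of_minpoly_eq pb μ hμ _ hP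
  have hn : Module.finrank ℚ K = 6 := by
    rw [pb.finrank, ← pb.natDegree_minpoly, hP, monic_sexticOne.natDegree_map,
      natDegree_sexticOne]
  have hw : (1 + μ - μ ^ 2 - 2 * μ ^ 3 - μ ^ 4) ^ 2 = -((1 : ℤ) : 𝓞 K) := by
    push_cast
    grind
  have hθ : (-1 + μ ^ 2 + 2 * μ ^ 3 + μ ^ 4) ^ 3 + (-1 + μ ^ 2 + 2 * μ ^ 3 + μ ^ 4) ^ 2
      - 2 * (-1 + μ ^ 2 + 2 * μ ^ 3 + μ ^ 4) - 1 + 2 * (1 + μ - μ ^ 2 - 2 * μ ^ 3 - μ ^ 4) *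
      ((-1 + μ ^ 2 + 2 * μ ^ 3 + μ ^ 4) ^ 2 + (-1 + μ ^ 2 + 2 * μ ^ 3 + μ ^ 4)) = 0 := by
    grind
  haveI : IsTotallyComplex K := isTotallyComplex_of_sq_eq_neg
    ((1 + μ - μ ^ 2 - 2 * μ ^ 3 - μ ^ 4 : 𝓞 K) : K) 1 one_pos (by
      rw [← map_pow, hw]; simp)
  refine ⟨1 + μ - μ ^ 2 - 2 * μ ^ 3 - μ ^ 4, -1 + μ ^ 2 + 2 * μ ^ 3 + μ ^ 4, hw, hθ, hn, ?_, ?_⟩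
  · have := congrArg (algebraMap (𝓞 K) K) hθ
    have h1 := adjoin_sub_one_eq_top _ _ (by simpa only [map_add, map_sub, map_mul, map_pow, map_one,
      map_zero, map_ofNat] using this) (by
      rw [← pb.adjoin_gen_eq_top, ← hμ]
      simp only [map_add, map_sub, map_mul, map_pow, map_one, map_neg, map_ofNat]
      congr 2; ring)
    rw [← h1]
    simp only [map_add, map_sub, map_mul, map_pow, map_one, map_neg, map_ofNat]
  · refine isPrincipalIdealRing_of_forall_absNorm_lt hn 104 4 ?_ (by norm_num) ?_
    · refine discr_powerBasis_le pb μ hμ hn (104 ^ 2) (by norm_num) ?_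
      have hder : aeval pb.gen (derivative (minpoly ℚ pb.gen)) =
          ((2 : ℤ) : K) * (((-2 : ℤ) : K) - pb.gen) ^ 2 *
            ((1 - μ - μ ^ 2 - μ ^ 3 + 2 * μ ^ 4 + μ ^ 5 : 𝓞 K) : K) := by
        have h1 : aeval μ (derivative sexticOne) =
            2 * (-2 - μ) ^ 2 * (1 - μ - μ ^ 2 - μ ^ 3 + 2 * μ ^ 4 + μ ^ 5) := by
          simp [sexticOne, map_ofNat]
          grind
        rw [hP, derivative_map, aeval_map_algebraMap, ← hμ, aeval_algebraMap_apply, h1]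
        simp [map_ofNat]
      rw [hder, map_mul, map_mul, map_pow, abs_mul,
        abs_norm_eq_one_of_mul_eq_one _ (3 + 2 * μ - 6 * μ ^ 3 - 8 * μ ^ 4 - 3 * μ ^ 5)
          (by grind), norm_intCast, hn, norm_intCast_sub_gen pb _ hP]
      norm_num [sexticOne]
    · intro I hI h0 hlt
      exfalso
      obtain ⟨h1, h2, h3⟩ := quotient_facts_of_isPrime I hI h0
      have h4 := h3 (Ideal.Quotient.mk I μ)
      have h5 := congrArg (Ideal.Quotient.mk I) hrel
      simp only [map_add, map_sub, map_mul, map_pow, map_one, map_zero, map_ofNat] at h5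
      have h6 : (1 : 𝓞 K ⧸ I) ≠ 0 := by
        rw [← map_one (Ideal.Quotient.mk I), Ne, Ideal.Quotient.eq_zero_iff_mem,
          ← Ideal.eq_top_iff_one]
        exact hI.ne_top
      have h7 := h1.two_le
      generalize Ideal.absNorm I = q at *
      generalize Ideal.Quotient.mk I μ = a at *
      interval_cases q
      · push_cast at h2; grind
      · push_cast at h2; grind

noncomputable def sexticFieldTwo {K : Type*} [Field K] [NumberField K] (pb : PowerBasis ℚ K)
    (μ : 𝓞 K) (hμ : (μ : K) = pb.gen)
    (hP : minpoly ℚ pb.gen = sexticTwo.map (algebraMap ℤ ℚ)) : SexticField 2 K := by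
  have hrel : μ ^ 6 + 2 * μ ^ 5 + 3 * μ ^ 4 + 2 * μ ^ 3 + 2 * μ ^ 2 + 1 = 0 := by
    simpa [sexticTwo, map_ofNat] using aeval_eq_zero_of_minpoly_eq pb μ hμ _ hP
  have hn : Module.finrank ℚ K = 6 := by
    rw [pb.finrank, ← pb.natDegree_minpoly, hP, monic_sexticTwo.natDegree_map,
      natDegree_sexticTwo]
  have hw : (-1 - μ - 3 * μ ^ 2 - 2 * μ ^ 3 - μ ^ 4) ^ 2 = -((2 : ℤ) : 𝓞 K) := by
    push_cast
    grind
  have hθ : (1 + 2 * μ + 3 * μ ^ 2 + 2 * μ ^ 3 + μ ^ 4) ^ 3 +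
      (1 + 2 * μ + 3 * μ ^ 2 + 2 * μ ^ 3 + μ ^ 4) ^ 2
      - 2 * (1 + 2 * μ + 3 * μ ^ 2 + 2 * μ ^ 3 + μ ^ 4) - 1 +
      2 * (-1 - μ - 3 * μ ^ 2 - 2 * μ ^ 3 - μ ^ 4) *
      ((1 + 2 * μ + 3 * μ ^ 2 + 2 * μ ^ 3 + μ ^ 4) ^ 2 +
        (1 + 2 * μ + 3 * μ ^ 2 + 2 * μ ^ 3 + μ ^ 4)) = 0 := by
    grind
  haveI : IsTotallyComplex K := isTotallyComplex_of_sq_eq_neg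
    ((-1 - μ - 3 * μ ^ 2 - 2 * μ ^ 3 - μ ^ 4 : 𝓞 K) : K) 2 two_pos (by
      rw [← map_pow, hw]; simp [map_ofNat])
  refine ⟨-1 - μ - 3 * μ ^ 2 - 2 * μ ^ 3 - μ ^ 4, 1 + 2 * μ + 3 * μ ^ 2 + 2 * μ ^ 3 + μ ^ 4,
    hw, hθ, hn, ?_, ?_⟩
  · have := congrArg (algebraMap (𝓞 K) K) hθ
    have h1 := adjoin_sub_one_eq_top _ _ (by simpa only [map_add, map_sub, map_mul, map_pow,
      map_one, map_zero, map_ofNat] using this) (by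
      rw [← pb.adjoin_gen_eq_top, ← hμ]
      simp only [map_add, map_sub, map_mul, map_pow, map_one, map_neg, map_ofNat]
      congr 2; ring)
    rw [← h1]
    simp only [map_add, map_sub, map_mul, map_pow, map_one, map_ofNat]
  · refine isPrincipalIdealRing_of_forall_absNorm_lt hn 204 7 ?_ (by norm_num) ?_
    · refine (discr_powerBasis_le pb μ hμ hn 41472 (by norm_num) ?_).trans (by norm_num)
      have hder : aeval pb.gen (derivative (minpoly ℚ pb.gen)) =
          ((-1 - μ - 3 * μ ^ 2 - 2 * μ ^ 3 - μ ^ 4 : 𝓞 K) : K) ^ 3 *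
          (((-1 : ℤ) : K) - pb.gen) ^ 4 * ((-μ ^ 2 - μ ^ 4 : 𝓞 K) : K) := by
        have h1 : aeval μ (derivative sexticTwo) =
            (-1 - μ - 3 * μ ^ 2 - 2 * μ ^ 3 - μ ^ 4) ^ 3 * (-1 - μ) ^ 4 * (-μ ^ 2 - μ ^ 4) := by
          simp [sexticTwo, map_ofNat]
          grind
        rw [hP, derivative_map, aeval_map_algebraMap, ← hμ, aeval_algebraMap_apply, h1]
        simp [map_ofNat]
      have hNw : |Algebra.norm ℚ
          ((-1 - μ - 3 * μ ^ 2 - 2 * μ ^ 3 - μ ^ 4 : 𝓞 K) : K)| = 8 := by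
        have h0 := congrArg (algebraMap (𝓞 K) K) hw
        rw [← Int.cast_neg, map_intCast, map_pow] at h0
        have h1 := congrArg (Algebra.norm ℚ) h0
        rw [map_pow, norm_intCast, hn, ← sq_abs] at h1
        have hN := abs_nonneg (Algebra.norm ℚ
          ((-1 - μ - 3 * μ ^ 2 - 2 * μ ^ 3 - μ ^ 4 : 𝓞 K) : K))
        generalize |Algebra.norm ℚ
          ((-1 - μ - 3 * μ ^ 2 - 2 * μ ^ 3 - μ ^ 4 : 𝓞 K) : K)| = N at h1 hN ⊢
        norm_num at h1
        nlinarith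
      rw [hder, map_mul, map_mul, map_pow, map_pow, abs_mul, abs_mul, abs_pow, hNw,
        abs_norm_eq_one_of_mul_eq_one _ (2 + 2 * μ + μ ^ 2)
          (by grind), norm_intCast_sub_gen pb _ hP]
      norm_num [sexticTwo]
    · intro I hI h0 hlt
      obtain ⟨h1, h2, h3⟩ := quotient_facts_of_isPrime I hI h0
      have h4 := h3 (Ideal.Quotient.mk I μ)
      have h5 := congrArg (Ideal.Quotient.mk I) hrel
      simp only [map_add, map_mul, map_pow, map_one, map_zero, map_ofNat] at h5
      have h6 : (1 : 𝓞 K ⧸ I) ≠ 0 := by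
        rw [← map_one (Ideal.Quotient.mk I), Ne, Ideal.Quotient.eq_zero_iff_mem,
          ← Ideal.eq_top_iff_one]
        exact hI.ne_top
      have h7 := h1.two_le
      by_cases h8 : Ideal.absNorm I = 3
      · rw [h8] at h2 h4
        have h9 : μ + 1 ∈ I := by
          rw [← Ideal.Quotient.eq_zero_iff_mem, map_add, map_one]
          push_cast at h2
          grind
        have h10 : Ideal.span {μ + 1} ≤ I := by
          rwa [Ideal.span_singleton_le_iff_mem]
        obtain ⟨J, hJ⟩ := Ideal.dvd_iff_le.2 h10
        have h11 : Ideal.absNorm (Ideal.span {μ + 1}) = 3 := by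
          have h12 := norm_intCast_sub_gen pb _ hP (-1)
          have h13 : ((Algebra.norm ℤ (μ + 1) : ℤ) : ℚ) = 3 := by
            rw [Algebra.coe_norm_int]
            have : ((μ + 1 : 𝓞 K) : K) = ((-1 : ℤ) : K) * (((-1 : ℤ) : K) - pb.gen) := by
              rw [← hμ]; push_cast; ring
            rw [this, map_mul, h12, norm_intCast, hn]
            norm_num [sexticTwo]
          have h14 : Algebra.norm ℤ (μ + 1) = 3 := by exact_mod_cast h13
          rw [Ideal.absNorm_span_singleton, h14]; rfl
        rw [hJ, map_mul, h8] at h11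
        have h12 : J = ⊤ := Ideal.absNorm_eq_one_iff.1 (by omega)
        rw [h12, Ideal.mul_top] at hJ
        exact ⟨⟨μ + 1, hJ.symm⟩⟩
      · exfalso
        have hpp : ¬ IsPrimePow 6 := by
          rw [isPrimePow_nat_iff_bounded]; decide
        letI : (I : Ideal (𝓞 K)).IsPrime := hI
        have hdom : IsDomain (𝓞 K ⧸ I) := inferInstance
        generalize Ideal.absNorm I = q at *
        generalize Ideal.Quotient.mk I μ = a at *
        interval_cases q
        · push_cast at h2; grind
        · exact h8 rfl
        · push_cast at h2
          have h9 : (4 : 𝓞 K ⧸ I) = 2 * 2 := by norm_num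
          rw [h9] at h2
          have h10 := mul_self_eq_zero.1 h2
          have h11 : a ^ 3 + a + 1 = 0 := by grind
          by_cases ha : a = 0
          · rw [ha] at h11; simp at h11
          · have : a ^ 3 = 1 := mul_right_cancel₀ ha (by linear_combination h4)
            apply ha; grind
        · push_cast at h2; grind
        · exact hpp h1

lemma exists_numberField_powerBasis (P : ℤ[X]) (hP : P.Monic)
    (hirr : Irreducible (P.map (algebraMap ℤ ℚ))) :
    ∃ (K : Type) (_ : Field K) (_ : NumberField K) (pb : PowerBasis ℚ K) (μ : 𝓞 K),
      (μ : K) = pb.gen ∧ minpoly ℚ pb.gen = P.map (algebraMap ℤ ℚ) := by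
  haveI := Fact.mk hirr
  have hm : (P.map (algebraMap ℤ ℚ)).Monic := hP.map _
  have hfin : FiniteDimensional ℚ (AdjoinRoot (P.map (algebraMap ℤ ℚ))) :=
    (AdjoinRoot.powerBasis hm.ne_zero).finite
  letI : NumberField (AdjoinRoot (P.map (algebraMap ℤ ℚ))) :=
    { to_charZero := charZero_of_injective_algebraMap (algebraMap ℚ _).injective
      to_finiteDimensional := by convert hfin }
  let pb : PowerBasis ℚ (AdjoinRoot (P.map (algebraMap ℤ ℚ))) := AdjoinRoot.powerBasis hm.ne_zero
  have hmin : minpoly ℚ pb.gen = P.map (algebraMap ℤ ℚ) :=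
    AdjoinRoot.minpoly_powerBasis_gen_of_monic hm
  have h_int : IsIntegral ℤ pb.gen := by
    refine ⟨P, hP, ?_⟩
    have := minpoly.aeval ℚ pb.gen
    rw [hmin, aeval_map_algebraMap] at this
    exact this
  exact ⟨_, inferInstance, inferInstance, pb, ⟨pb.gen, h_int⟩, rfl, hmin⟩

theorem exists_sexticField (c : ℤ) (hc : c = 1 ∨ c = 2) :
    ∃ (K : Type) (_ : Field K) (_ : NumberField K), Nonempty (SexticField c K) := by
  rcases hc with rfl | rfl
  · obtain ⟨K, _, _, pb, μ, hμ, hP⟩ :=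
      exists_numberField_powerBasis _ monic_sexticOne irreducible_sexticOne
    exact ⟨K, _, _, ⟨sexticFieldOne pb μ hμ hP⟩⟩
  · obtain ⟨K, _, _, pb, μ, hμ, hP⟩ :=
      exists_numberField_powerBasis _ monic_sexticTwo irreducible_sexticTwo
    exact ⟨K, _, _, ⟨sexticFieldTwo pb μ hμ hP⟩⟩

/-- Coordinates with respect to `1, w, θ, wθ, θ², wθ²`. -/
@[ext]
structure Coord (R : Type*) where
  x0 : R
  y0 : R
  x1 : R
  y1 : R
  x2 : R
  y2 : R

namespace Coord

variable {R : Type*} [CommRing R]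

/-- Product of two elements given in coordinates, where `w² = -c` and
`θ³ = -(1 + 2w)θ² + (2 - 2w)θ + 1`. -/
def mul (c : R) (a b : Coord R) : Coord R :=
  let p0 := a.x0 * b.x0 - c * (a.y0 * b.y0)
  let q0 := a.x0 * b.y0 + a.y0 * b.x0
  let p1 := a.x0 * b.x1 - c * (a.y0 * b.y1) + (a.x1 * b.x0 - c * (a.y1 * b.y0))
  let q1 := a.x0 * b.y1 + a.y0 * b.x1 + (a.x1 * b.y0 + a.y1 * b.x0)
  let p2 := a.x0 * b.x2 - c * (a.y0 * b.y2) + (a.x1 * b.x1 - c * (a.y1 * b.y1)) +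
    (a.x2 * b.x0 - c * (a.y2 * b.y0))
  let q2 := a.x0 * b.y2 + a.y0 * b.x2 + (a.x1 * b.y1 + a.y1 * b.x1) +
    (a.x2 * b.y0 + a.y2 * b.x0)
  let p3 := a.x1 * b.x2 - c * (a.y1 * b.y2) + (a.x2 * b.x1 - c * (a.y2 * b.y1))
  let q3 := a.x1 * b.y2 + a.y1 * b.x2 + (a.x2 * b.y1 + a.y2 * b.x1)
  let p4 := a.x2 * b.x2 - c * (a.y2 * b.y2)
  let q4 := a.x2 * b.y2 + a.y2 * b.x2
  { x0 := p0 + p3 - p4 + 2 * c * q4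
    y0 := q0 + q3 - q4 - 2 * p4
    x1 := p1 + 2 * p3 + 2 * c * q3 - (1 + 4 * c) * p4 + 2 * c * q4
    y1 := q1 + 2 * q3 - 2 * p3 - (1 + 4 * c) * q4 - 2 * p4
    x2 := p2 - p3 + 2 * c * q3 + (3 - 4 * c) * p4 - 2 * c * q4
    y2 := q2 - q3 - 2 * p3 + (3 - 4 * c) * q4 + 2 * p4 }

/-- The element with given coordinates. -/
def eval (w θ : R) (a : Coord R) : R :=
  a.x0 + a.y0 * w + (a.x1 + a.y1 * w) * θ + (a.x2 + a.y2 * w) * θ ^ 2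

/-- Apply a function to all coordinates. -/
def map {S : Type*} (f : R → S) (a : Coord R) : Coord S :=
  ⟨f a.x0, f a.y0, f a.x1, f a.y1, f a.x2, f a.y2⟩

lemma eval_mul (c w θ : R) (hw : w ^ 2 = -c)
    (hθ : θ ^ 3 + θ ^ 2 - 2 * θ - 1 + 2 * w * (θ ^ 2 + θ) = 0) (a b : Coord R) :
    eval w θ (mul c a b) = eval w θ a * eval w θ b := by
  obtain ⟨a0, a1, a2, a3, a4, a5⟩ := a
  obtain ⟨b0, b1, b2, b3, b4, b5⟩ := b
  obtain rfl : c = -w ^ 2 := by rw [hw, neg_neg]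
  have h3 : θ ^ 3 = -(1 + 2 * w) * θ ^ 2 + (2 - 2 * w) * θ + 1 := by linear_combination hθ
  have h4 : θ ^ 4 = (3 + 4 * w ^ 2 + 2 * w) * θ ^ 2 + (-1 + 4 * w ^ 2 - 2 * w) * θ
      + (-1 - 2 * w) := by
    linear_combination (θ - (1 + 2 * w)) * h3
  simp only [eval, mul]
  linear_combination (-((a2 + a3 * w) * (b4 + b5 * w) + (a4 + a5 * w) * (b2 + b3 * w))) * h3
    - ((a4 + a5 * w) * (b4 + b5 * w)) * h4

lemma map_mul {S F : Type*} [CommRing S] [FunLike F R S] [RingHomClass F R S] (f : F) (c : R)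
    (a b : Coord R) : map f (mul c a b) = mul (f c) (map f a) (map f b) := by
  simp [map, mul, map_ofNat]

/-- All coordinates are divisible by `n`. -/
def Dvd (n : ℤ) (a : Coord ℤ) : Prop :=
  n ∣ a.x0 ∧ n ∣ a.y0 ∧ n ∣ a.x1 ∧ n ∣ a.y1 ∧ n ∣ a.x2 ∧ n ∣ a.y2

end Coord

namespace SexticField
variable {c : ℤ} {K : Type*} [Field K] [NumberField K]

/-- The algebraic integer with given integral coordinates. -/
noncomputable def ofCoord (S : SexticField c K) (a : Coord ℤ) : 𝓞 K :=
  (a.map (Int.castRingHom (𝓞 K))).eval S.w S.θ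

lemma ofCoord_mul (S : SexticField c K) (a b : Coord ℤ) :
    S.ofCoord (.mul c a b) = S.ofCoord a * S.ofCoord b := by
  rw [ofCoord, Coord.map_mul, Coord.eval_mul _ _ _ (by simpa using S.w_sq) S.θ_rel]
  rfl

lemma exists_coord_rat (S : SexticField c K) (s : K) :
    ∃ a : Coord ℚ, s = (a.map (algebraMap ℚ K)).eval (S.w : K) (S.θ : K) := by
  have hs : s ∈ Algebra.adjoin ℚ {((S.θ - 1 : 𝓞 K) : K)} := by rw [S.adjoin_eq_top]; trivial
  have hw := congrArg (algebraMap (𝓞 K) K) S.w_sq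
  have hθ := congrArg (algebraMap (𝓞 K) K) S.θ_rel
  simp only [map_add, map_sub, map_mul, map_pow, map_one, map_zero, map_ofNat, map_neg,
    map_intCast] at hw hθ
  induction hs using Algebra.adjoin_induction with
  | mem x hx =>
    rw [Set.mem_singleton_iff] at hx
    refine ⟨⟨-1, 0, 1, 0, 0, 0⟩, ?_⟩
    rw [hx]; simp [Coord.map, Coord.eval]; ring
  | algebraMap r => exact ⟨⟨r, 0, 0, 0, 0, 0⟩, by simp [Coord.map, Coord.eval]⟩
  | add x y _ _ hx hy =>
    obtain ⟨a, ha⟩ := hx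
    obtain ⟨b, hb⟩ := hy
    refine ⟨⟨a.x0 + b.x0, a.y0 + b.y0, a.x1 + b.x1, a.y1 + b.y1, a.x2 + b.x2, a.y2 + b.y2⟩, ?_⟩
    rw [ha, hb]; simp [Coord.map, Coord.eval]; ring
  | mul x y _ _ hx hy =>
    obtain ⟨a, ha⟩ := hx
    obtain ⟨b, hb⟩ := hy
    refine ⟨.mul (c : ℚ) a b, ?_⟩
    rw [ha, hb, Coord.map_mul, Coord.eval_mul _ _ _ (by simpa using hw) hθ]

lemma ofCoord_injective (S : SexticField c K) : Function.Injective S.ofCoord := by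
  let f : (Fin 6 → ℚ) →ₗ[ℚ] K := Fintype.linearCombination ℚ
    ![1, (S.w : K), (S.θ : K), S.w * S.θ, S.θ ^ 2, S.w * S.θ ^ 2]
  have hf : ∀ v : Fin 6 → ℚ, f v = (Coord.map (algebraMap ℚ K)
      ⟨v 0, v 1, v 2, v 3, v 4, v 5⟩).eval (S.w : K) (S.θ : K) := by
    intro v
    simp [f, Fintype.linearCombination_apply, Fin.sum_univ_six, Coord.map, Coord.eval,
      Algebra.smul_def]
    ring
  have hsurj : Function.Surjective f := by
    intro s
    obtain ⟨a, rfl⟩ := S.exists_coord_rat s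
    exact ⟨![a.x0, a.y0, a.x1, a.y1, a.x2, a.y2], by rw [hf]; rfl⟩
  have hinj : Function.Injective f :=
    (LinearMap.injective_iff_surjective_of_finrank_eq_finrank
      (by simp [S.finrank_eq])).2 hsurj
  intro a b hab
  have hcoe : ∀ a : Coord ℤ, ((S.ofCoord a : 𝓞 K) : K) =
      f ![a.x0, a.y0, a.x1, a.y1, a.x2, a.y2] := by
    intro a; rw [hf]; simp [ofCoord, Coord.map, Coord.eval]
  have h := hinj ((hcoe a).symm.trans ((congrArg _ hab).trans (hcoe b)))
  have h' := fun i => congrFun h i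
  ext
  · simpa using h' 0
  · simpa using h' 1
  · simpa using h' 2
  · simpa using h' 3
  · simpa using h' 4
  · simpa using h' 5

lemma exists_coord (S : SexticField c K) (s : K) :
    ∃ (n : ℤ) (a : Coord ℤ), n ≠ 0 ∧ (n : K) * s = S.ofCoord a ∧ ¬ (2 ∣ n ∧ a.Dvd 2) := by
  have h1 : ∃ (n : ℕ) (a : Coord ℤ), n ≠ 0 ∧ (n : K) * s = S.ofCoord a := by
    obtain ⟨a, rfl⟩ := S.exists_coord_rat s
    refine ⟨a.x0.den * a.y0.den * a.x1.den * a.y1.den * a.x2.den * a.y2.den,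
      ⟨a.x0.num * a.y0.den * a.x1.den * a.y1.den * a.x2.den * a.y2.den,
       a.x0.den * a.y0.num * a.x1.den * a.y1.den * a.x2.den * a.y2.den,
       a.x0.den * a.y0.den * a.x1.num * a.y1.den * a.x2.den * a.y2.den,
       a.x0.den * a.y0.den * a.x1.den * a.y1.num * a.x2.den * a.y2.den,
       a.x0.den * a.y0.den * a.x1.den * a.y1.den * a.x2.num * a.y2.den,
       a.x0.den * a.y0.den * a.x1.den * a.y1.den * a.x2.den * a.y2.num⟩, by simp, ?_⟩
    have hd : ∀ q : ℚ, (q : K) * q.den = q.num := fun q => by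
      exact_mod_cast congrArg (Rat.cast : ℚ → K) (Rat.mul_den_eq_num q)
    simp only [ofCoord, Coord.map, Coord.eval, map_add, map_mul, map_pow, map_intCast,
      eq_ratCast, eq_intCast, Int.cast_mul, Int.cast_natCast, Nat.cast_mul, map_natCast, ← hd]
    ring
  classical
  obtain ⟨a, hn, ha⟩ := Nat.find_spec h1
  refine ⟨(Nat.find h1 : ℕ), a, by exact_mod_cast hn, by exact_mod_cast ha, ?_⟩
  rintro ⟨h2, ⟨x0, h3⟩, ⟨y0, h4⟩, ⟨x1, h5⟩, ⟨y1, h6⟩, ⟨x2, h7⟩, ⟨y2, h8⟩⟩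
  have h2' : 2 ∣ Nat.find h1 := by exact_mod_cast h2
  obtain ⟨k, hk⟩ := h2'
  refine Nat.find_min h1 (m := k) (by omega) ⟨⟨x0, y0, x1, y1, x2, y2⟩, by omega, ?_⟩
  rw [hk] at ha
  simp only [ofCoord, Coord.map, Coord.eval, map_add, map_mul, map_pow, map_intCast,
    eq_intCast, Int.cast_mul, h3, h4, h5, h6, h7, h8, Nat.cast_mul, map_ofNat] at ha ⊢
  push_cast at ha ⊢
  have two : (2 : K) ≠ 0 := two_ne_zero
  refine mul_left_cancel₀ two ?_
  linear_combination ha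

end SexticField

namespace Coord

instance (n : ℤ) (a : Coord ℤ) : Decidable (a.Dvd n) := inferInstanceAs (Decidable (_ ∧ _))

/-- The coordinate vector with given bits. -/
def ofBits (r : Fin 6 → Fin 2) : Coord ℤ :=
  ⟨(r 0 : ℕ), (r 1 : ℕ), (r 2 : ℕ), (r 3 : ℕ), (r 4 : ℕ), (r 5 : ℕ)⟩

/-- `e r²` in coordinates. -/
def twist (c : ℤ) (e r : Coord ℤ) : Coord ℤ := mul c e (mul c r r)

/-- `e r²` is neither `0` nor `1` modulo `4`, unless `r` is divisible by `2`. -/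
def NonSquare (c : ℤ) (e : Coord ℤ) : Prop :=
  ∀ r : Fin 6 → Fin 2, r ≠ 0 → ¬ (twist c e (ofBits r)).Dvd 4 ∧
    ¬ Dvd 4 { twist c e (ofBits r) with x0 := (twist c e (ofBits r)).x0 - 1 }

/-- If `e r²` lies in `ℤ + ℤθ + ℤθ²` modulo `4` then it is divisible by `2` but not by `4`,
unless `r` is divisible by `2`. -/
def StronglyNonSquare (c : ℤ) (e : Coord ℤ) : Prop :=
  ∀ r : Fin 6 → Fin 2, r ≠ 0 → (4 ∣ (twist c e (ofBits r)).y0 ∧ 4 ∣ (twist c e (ofBits r)).y1 ∧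
    4 ∣ (twist c e (ofBits r)).y2) →
    ¬ (twist c e (ofBits r)).Dvd 4 ∧ 2 ∣ (twist c e (ofBits r)).x0 ∧
      2 ∣ (twist c e (ofBits r)).x1 ∧ 2 ∣ (twist c e (ofBits r)).x2

instance (c : ℤ) (e : Coord ℤ) : Decidable (NonSquare c e) :=
  inferInstanceAs (Decidable (∀ _, _))
instance (c : ℤ) (e : Coord ℤ) : Decidable (StronglyNonSquare c e) :=
  inferInstanceAs (Decidable (∀ _, _))

/-- Subtraction of coordinate vectors. -/
def sub (a b : Coord ℤ) : Coord ℤ :=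
  ⟨a.x0 - b.x0, a.y0 - b.y0, a.x1 - b.x1, a.y1 - b.y1, a.x2 - b.x2, a.y2 - b.y2⟩

lemma exists_bits (c : ℤ) (e a : Coord ℤ) : ∃ r : Fin 6 → Fin 2, (r = 0 → a.Dvd 2) ∧
    (sub (twist c e a) (twist c e (ofBits r))).Dvd 4 := by
  have hbit : ∀ x : ℤ, ∃ (r : Fin 2) (k : ℤ), x = (r : ℕ) + 2 * k := by
    intro x
    rcases Int.even_or_odd' x with ⟨k, h | h⟩
    · exact ⟨0, k, by simp [h]⟩
    · exact ⟨1, k, by simp [h]; ring⟩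
  choose r k hrk using hbit
  refine ⟨![r a.x0, r a.y0, r a.x1, r a.y1, r a.x2, r a.y2], ?_, ?_⟩
  · intro h
    have h' : ∀ x : ℤ, r x = 0 → (2 : ℤ) ∣ x := fun x hx => ⟨k x, by
      have := hrk x; rw [hx] at this; simpa using this⟩
    exact ⟨h' _ (congrFun h 0), h' _ (congrFun h 1), h' _ (congrFun h 2), h' _ (congrFun h 3),
      h' _ (congrFun h 4), h' _ (congrFun h 5)⟩
  · obtain ⟨a0, a1, a2, a3, a4, a5⟩ := a
    have h0 := hrk a0
    have h1 := hrk a1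
    have h2 := hrk a2
    have h3 := hrk a3
    have h4 := hrk a4
    have h5 := hrk a5
    generalize hr : (ofBits ![r a0, r a1, r a2, r a3, r a4, r a5]) = s
    obtain ⟨s0, s1, s2, s3, s4, s5⟩ := s
    simp [ofBits] at hr
    obtain ⟨e0, e1, e2, e3, e4, e5⟩ := hr
    rw [e0] at h0
    rw [e1] at h1
    rw [e2] at h2
    rw [e3] at h3
    rw [e4] at h4
    rw [e5] at h5
    generalize k a0 = k0 at *
    generalize k a1 = k1 at *
    generalize k a2 = k2 at *
    generalize k a3 = k3 at *
    generalize k a4 = k4 at *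
    generalize k a5 = k5 at *
    clear e0 e1 e2 e3 e4 e5 hrk
    subst h0 h1 h2 h3 h4 h5
    have key : ∃ v : Coord ℤ, mul c ⟨s0 + 2 * k0, s1 + 2 * k1, s2 + 2 * k2, s3 + 2 * k3,
        s4 + 2 * k4, s5 + 2 * k5⟩ ⟨s0 + 2 * k0, s1 + 2 * k1, s2 + 2 * k2, s3 + 2 * k3,
        s4 + 2 * k4, s5 + 2 * k5⟩ =
        ⟨(mul c ⟨s0, s1, s2, s3, s4, s5⟩ ⟨s0, s1, s2, s3, s4, s5⟩).x0 + 4 * v.x0,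
        (mul c ⟨s0, s1, s2, s3, s4, s5⟩ ⟨s0, s1, s2, s3, s4, s5⟩).y0 + 4 * v.y0,
        (mul c ⟨s0, s1, s2, s3, s4, s5⟩ ⟨s0, s1, s2, s3, s4, s5⟩).x1 + 4 * v.x1,
        (mul c ⟨s0, s1, s2, s3, s4, s5⟩ ⟨s0, s1, s2, s3, s4, s5⟩).y1 + 4 * v.y1,
        (mul c ⟨s0, s1, s2, s3, s4, s5⟩ ⟨s0, s1, s2, s3, s4, s5⟩).x2 + 4 * v.x2,
        (mul c ⟨s0, s1, s2, s3, s4, s5⟩ ⟨s0, s1, s2, s3, s4, s5⟩).y2 + 4 * v.y2⟩ := by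
      refine ⟨mul c ⟨s0 + k0, s1 + k1, s2 + k2, s3 + k3, s4 + k4, s5 + k5⟩
        ⟨k0, k1, k2, k3, k4, k5⟩, ?_⟩
      ext <;> simp only [mul] <;> ring
    obtain ⟨v, hv⟩ := key
    rw [twist, twist, hv]
    generalize mul c ⟨s0, s1, s2, s3, s4, s5⟩ ⟨s0, s1, s2, s3, s4, s5⟩ = t
    refine ⟨⟨(mul c e v).x0, ?_⟩, ⟨(mul c e v).y0, ?_⟩, ⟨(mul c e v).x1, ?_⟩,
      ⟨(mul c e v).y1, ?_⟩, ⟨(mul c e v).x2, ?_⟩, ⟨(mul c e v).y2, ?_⟩⟩ <;>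
    simp only [sub, mul] <;> ring

end Coord

namespace SexticField
variable {c : ℤ} {K : Type*} [Field K] [NumberField K]

/-- If `α = e s²` then modulo `4` some multiple `n²α` agrees with `e r²`, where `n` and `r` are not
both even. -/
lemma exists_twist (S : SexticField c K) (α e : Coord ℤ) (s : K)
    (h : (S.ofCoord α : K) = S.ofCoord e * s ^ 2) :
    ∃ (n : ℤ) (r : Fin 6 → Fin 2), (2 ∣ n → r ≠ 0) ∧
      (Coord.sub ⟨n ^ 2 * α.x0, n ^ 2 * α.y0, n ^ 2 * α.x1, n ^ 2 * α.y1, n ^ 2 * α.x2,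
        n ^ 2 * α.y2⟩ (.twist c e (.ofBits r))).Dvd 4 := by
  obtain ⟨n, a, hn, hna, h2⟩ := S.exists_coord s
  obtain ⟨r, hr0, hr⟩ := Coord.exists_bits c e a
  refine ⟨n, r, fun h3 h4 => h2 ⟨h3, hr0 h4⟩, ?_⟩
  have h3 : S.ofCoord ⟨n ^ 2 * α.x0, n ^ 2 * α.y0, n ^ 2 * α.x1, n ^ 2 * α.y1, n ^ 2 * α.x2,
      n ^ 2 * α.y2⟩ = S.ofCoord (.twist c e a) := by
    apply RingOfIntegers.coe_injective
    rw [Coord.twist, ofCoord_mul, ofCoord_mul]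
    have h4 : S.ofCoord ⟨n ^ 2 * α.x0, n ^ 2 * α.y0, n ^ 2 * α.x1, n ^ 2 * α.y1, n ^ 2 * α.x2,
      n ^ 2 * α.y2⟩ = (n : 𝓞 K) ^ 2 * S.ofCoord α := by
      simp [ofCoord, Coord.eval, Coord.map]; ring
    have h' : algebraMap (𝓞 K) K (S.ofCoord α) = algebraMap (𝓞 K) K (S.ofCoord e) * s ^ 2 := h
    have hna' : (n : K) * s = algebraMap (𝓞 K) K (S.ofCoord a) := hna
    rw [h4, map_mul, map_mul, map_mul, h', ← hna', map_pow, map_intCast]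
    ring
  rw [S.ofCoord_injective h3]
  exact hr

lemma not_sq_of_nonSquare (S : SexticField c K) (e : Coord ℤ) (he : e.NonSquare c) (s : K) :
    (S.ofCoord e : K) * s ^ 2 ≠ 1 := by
  intro h
  obtain ⟨n, r, h1, h2⟩ := S.exists_twist ⟨1, 0, 0, 0, 0, 0⟩ e s (by
    rw [h]; simp [ofCoord, Coord.eval, Coord.map])
  simp only [Coord.sub, Coord.Dvd, mul_one, mul_zero, zero_sub, dvd_neg] at h2
  obtain ⟨h3, h4, h5, h6, h7, h8⟩ := h2
  rcases Int.even_or_odd' n with ⟨k, hk | hk⟩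
  · refine (he r (h1 ⟨k, hk⟩)).1 ⟨?_, h4, h5, h6, h7, h8⟩
    have : (4 : ℤ) ∣ n ^ 2 := ⟨k ^ 2, by rw [hk]; ring⟩
    exact (Int.dvd_iff_dvd_of_dvd_sub h3).1 this
  · have h9 : (4 : ℤ) ∣ n ^ 2 - 1 := ⟨k ^ 2 + k, by rw [hk]; ring⟩
    have hx : (4 : ℤ) ∣ (Coord.twist c e (.ofBits r)).x0 - 1 := by
      have := dvd_sub h9 h3
      simpa using this
    refine (he r ?_).2 ⟨hx, h4, h5, h6, h7, h8⟩
    rintro rfl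
    simp [Coord.twist, Coord.ofBits, Coord.mul] at hx

lemma ne_mul_sq_of_stronglyNonSquare (S : SexticField c K) (e : Coord ℤ)
    (he : e.StronglyNonSquare c) (u0 u1 u2 : ℤ) (hu : ¬ (2 ∣ u0 ∧ 2 ∣ u1 ∧ 2 ∣ u2)) (s : K) :
    (S.ofCoord ⟨u0, 0, u1, 0, u2, 0⟩ : K) ≠ S.ofCoord e * s ^ 2 := by
  intro h
  obtain ⟨n, r, h1, h2⟩ := S.exists_twist _ e s h
  simp only [Coord.sub, Coord.Dvd, mul_zero, zero_sub, dvd_neg] at h2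
  obtain ⟨h3, h4, h5, h6, h7, h8⟩ := h2
  have hodd : ¬ 2 ∣ n → ∀ x y : ℤ, 4 ∣ n ^ 2 * x - y → 2 ∣ y → 2 ∣ x := by
    intro hn x y hxy hy
    have h9 : (2 : ℤ) ∣ n ^ 2 * x :=
      (Int.dvd_iff_dvd_of_dvd_sub (dvd_trans (by norm_num) hxy)).2 hy
    rcases Int.prime_two.dvd_or_dvd h9 with h | h
    · exact absurd (Int.prime_two.dvd_of_dvd_pow h) hn
    · exact h
  by_cases hr : r = 0
  · have hn : ¬ 2 ∣ n := fun h => h1 h hr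
    subst hr
    apply hu
    have hz : (Coord.twist c e (.ofBits 0)) = ⟨0, 0, 0, 0, 0, 0⟩ := by
      simp [Coord.twist, Coord.ofBits, Coord.mul]
    rw [hz] at h3 h5 h7
    exact ⟨hodd hn _ _ h3 (dvd_zero _), hodd hn _ _ h5 (dvd_zero _), hodd hn _ _ h7 (dvd_zero _)⟩
  · obtain ⟨h9, h10, h11, h12⟩ := he r hr ⟨h4, h6, h8⟩
    by_cases hn : 2 ∣ n
    · apply h9
      have h13 : (4 : ℤ) ∣ n ^ 2 := by
        obtain ⟨k, rfl⟩ := hn; exact ⟨k ^ 2, by ring⟩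
      exact ⟨(Int.dvd_iff_dvd_of_dvd_sub h3).1 (h13.mul_right _), h4,
        (Int.dvd_iff_dvd_of_dvd_sub h5).1 (h13.mul_right _), h6,
        (Int.dvd_iff_dvd_of_dvd_sub h7).1 (h13.mul_right _), h8⟩
    · exact hu ⟨hodd hn _ _ h3 h10, hodd hn _ _ h5 h11, hodd hn _ _ h7 h12⟩

/-- A quadratic polynomial in `θ` with not all coefficients even that is a unit times a square is
`ofCoord (E i)` times a square, with `i` not excluded modulo `4`. -/
lemma eq_mul_sq_of_units (S : SexticField c K) (hc : 0 < c) (E I : Fin 8 → Coord ℤ)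
    (hEI : ∀ i, Coord.mul c (E i) (I i) = ⟨1, 0, 0, 0, 0, 0⟩)
    (hE : ∀ i j, i ≠ j → (Coord.mul c (E i) (E j)).NonSquare c)
    (u0 u1 u2 : ℤ) (hu : ¬ (2 ∣ u0 ∧ 2 ∣ u1 ∧ 2 ∣ u2)) (ε : (𝓞 K)ˣ) (s : 𝓞 K)
    (h : S.ofCoord ⟨u0, 0, u1, 0, u2, 0⟩ = ε * s ^ 2) :
    ∃ (i : Fin 8) (t : K), ¬ (E i).StronglyNonSquare c ∧
      (S.ofCoord ⟨u0, 0, u1, 0, u2, 0⟩ : K) = S.ofCoord (E i) * t ^ 2 := by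
  haveI : IsTotallyComplex K := isTotallyComplex_of_sq_eq_neg (S.w : K) c (by exact_mod_cast hc)
    (by rw [← map_pow, S.w_sq]; simp)
  have hone : S.ofCoord ⟨1, 0, 0, 0, 0, 0⟩ = 1 := by simp [ofCoord, Coord.eval, Coord.map]
  have hmul : ∀ i, S.ofCoord (E i) * S.ofCoord (I i) = 1 := fun i => by
    rw [← ofCoord_mul, hEI, hone]
  obtain ⟨i, v, hv⟩ := exists_isSquare_mul_of_card_eq_eight (units_rank_eq_two S.finrank_eq)
    (Fintype.card_fin 8) (fun i => Units.mkOfMulEqOne _ _ (hmul i)) (by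
      rintro i j ⟨v, hv⟩
      by_contra hij
      refine S.not_sq_of_nonSquare _ (hE i j hij) (((v⁻¹ : (𝓞 K)ˣ) : 𝓞 K) : K) ?_
      have h1 := congrArg (fun x : (𝓞 K)ˣ => (x : 𝓞 K)) hv
      simp only [Units.val_mul, Units.val_mkOfMulEqOne] at h1
      rw [ofCoord_mul, h1, ← map_pow, ← map_mul]
      rw [show (v : 𝓞 K) * v * ((v⁻¹ : (𝓞 K)ˣ) : 𝓞 K) ^ 2 =
        (v * ((v⁻¹ : (𝓞 K)ˣ) : 𝓞 K)) ^ 2 by ring, Units.mul_inv]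
      simp) ε
  have h1 := congrArg (fun x : (𝓞 K)ˣ => (x : 𝓞 K)) hv
  simp only [Units.val_mul, Units.val_mkOfMulEqOne] at h1
  have h2 : S.ofCoord ⟨u0, 0, u1, 0, u2, 0⟩ =
      S.ofCoord (E i) * (v * s * S.ofCoord (I i)) ^ 2 := by
    rw [h]
    linear_combination (s ^ 2 * S.ofCoord (E i) * S.ofCoord (I i) ^ 2) * h1
      - (ε * s ^ 2 * (1 + S.ofCoord (E i) * S.ofCoord (I i))) * hmul i
  have h3 : (S.ofCoord ⟨u0, 0, u1, 0, u2, 0⟩ : K) =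
      S.ofCoord (E i) * ((v * s * S.ofCoord (I i) : 𝓞 K) : K) ^ 2 := by
    rw [h2]
    exact (map_mul (algebraMap (𝓞 K) K) _ _).trans (congrArg _ (map_pow _ _ _))
  exact ⟨i, _, fun he => S.ne_mul_sq_of_stronglyNonSquare _ he _ _ _ hu _ h3, h3⟩

/-- Representatives of the units modulo squares for `c = 1`. -/
def unitsOne : Fin 8 → Coord ℤ :=
  ![⟨1, 0, 0, 0, 0, 0⟩, ⟨0, 1, 0, 0, 0, 0⟩, ⟨-1, 0, 0, 1, 0, 0⟩, ⟨0, -1, -1, 0, 0, 0⟩,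
    ⟨-1, 0, 0, 1, 1, 0⟩, ⟨0, -1, -1, 0, 0, 1⟩, ⟨1, 1, 2, 0, 0, -1⟩, ⟨-1, 1, 0, 2, 1, 0⟩]

/-- Representatives of the units modulo squares for `c = 2`. -/
def unitsTwo : Fin 8 → Coord ℤ :=
  ![⟨1, 0, 0, 0, 0, 0⟩, ⟨-1, 0, 0, 0, 0, 0⟩, ⟨0, 1, 1, 0, 0, 0⟩, ⟨0, -1, -1, 0, 0, 0⟩,
    ⟨-1, 0, 0, 1, 1, 0⟩, ⟨1, 0, 0, -1, -1, 0⟩, ⟨1, -1, -1, -2, -1, 0⟩, ⟨-1, 1, 1, 2, 1, 0⟩]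

lemma eq_sq_of_units (S : SexticField c K) (hc : c = 1 ∨ c = 2)
    (u0 u1 u2 : ℤ) (hu : ¬ (2 ∣ u0 ∧ 2 ∣ u1 ∧ 2 ∣ u2)) (ε : (𝓞 K)ˣ) (s : 𝓞 K)
    (h : S.ofCoord ⟨u0, 0, u1, 0, u2, 0⟩ = ε * s ^ 2) :
    ∃ t : K, (S.ofCoord ⟨u0, 0, u1, 0, u2, 0⟩ : K) = t ^ 2 ∨
      (S.ofCoord ⟨u0, 0, u1, 0, u2, 0⟩ : K) = -t ^ 2 := by
  rcases hc with rfl | rfl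
  · obtain ⟨i, t, hi, ht⟩ := S.eq_mul_sq_of_units one_pos unitsOne
      ![⟨1, 0, 0, 0, 0, 0⟩, ⟨0, -1, 0, 0, 0, 0⟩, ⟨-1, 1, 1, 1, 1, 0⟩, ⟨1, 1, 1, -1, 0, -1⟩,
        ⟨-2, 1, 0, 2, 1, 0⟩, ⟨1, 2, 2, 0, 0, -1⟩, ⟨1, -2, -2, -1, -1, 1⟩,
        ⟨-2, -1, -1, 2, 1, 1⟩] (by intro i; fin_cases i <;> rfl) (by decide +kernel)
      u0 u1 u2 hu ε s h
    refine ⟨t, .inl ?_⟩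
    have h0 : i = 0 := by clear ht; revert i; decide +kernel
    rw [ht, h0]
    simp [unitsOne, ofCoord, Coord.eval, Coord.map]
  · obtain ⟨i, t, hi, ht⟩ := S.eq_mul_sq_of_units two_pos unitsTwo
      ![⟨1, 0, 0, 0, 0, 0⟩, ⟨-1, 0, 0, 0, 0, 0⟩, ⟨0, -1, -1, -1, -1, 0⟩, ⟨0, 1, 1, 1, 1, 0⟩,
        ⟨-3, 0, -3, 2, 1, 1⟩, ⟨3, 0, 3, -2, -1, -1⟩, ⟨1, 2, 4, 1, 1, -1⟩,
        ⟨-1, -2, -4, -1, -1, 1⟩] (by intro i; fin_cases i <;> rfl) (by decide +kernel)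
      u0 u1 u2 hu ε s h
    have h0 : i = 0 ∨ i = 1 := by clear ht; revert i; decide +kernel
    refine ⟨t, ?_⟩
    rw [ht]
    rcases h0 with rfl | rfl
    · left; simp [unitsTwo, ofCoord, Coord.eval, Coord.map]
    · right; simp [unitsTwo, ofCoord, Coord.eval, Coord.map]

end SexticField

/-- The sextic `h² + 4cq²` in the coordinate `t - 1`. -/
noncomputable def sexticShift (c : ℤ) : ℤ[X] :=
  (X ^ 3 + 4 * X ^ 2 + 3 * X - 1) ^ 2 + C (4 * c) * ((X + 1) * (X + 2)) ^ 2

lemma sexticShift_aux (c : ℤ) : ((X ^ 3 + 4 * X ^ 2 + 3 * X - 1) ^ 2 : ℤ[X]).natDegree = 6 ∧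
    (C (4 * c) * ((X + 1) * (X + 2)) ^ 2 : ℤ[X]).natDegree ≤ 4 ∧
    ((X ^ 3 + 4 * X ^ 2 + 3 * X - 1) ^ 2 : ℤ[X]).Monic := by
  refine ⟨?_, ?_, by monicity!⟩
  · have : (X ^ 3 + 4 * X ^ 2 + 3 * X - 1 : ℤ[X]).natDegree = 3 := by compute_degree!
    rw [natDegree_pow, this]
  · compute_degree

lemma natDegree_sexticShift (c : ℤ) : (sexticShift c).natDegree = 6 := by
  obtain ⟨h1, h2, -⟩ := sexticShift_aux c
  rw [sexticShift, natDegree_add_eq_left_of_natDegree_lt (by omega), h1]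

lemma monic_sexticShift (c : ℤ) : (sexticShift c).Monic := by
  obtain ⟨h1, h2, h3⟩ := sexticShift_aux c
  exact h3.add_of_left (degree_lt_degree (by omega))

lemma exists_bezout_of_map_ne_zero (U H : ℤ[X]) (hH : Irreducible (H.map (Int.castRingHom (ZMod 2))))
    (hd : U.natDegree < (H.map (Int.castRingHom (ZMod 2))).natDegree)
    (hU : U.map (Int.castRingHom (ZMod 2)) ≠ 0) :
    ∃ A B D : ℤ[X], A * U + B * H = 1 + 2 * D := by
  have hcop : IsCoprime (U.map (Int.castRingHom (ZMod 2))) (H.map (Int.castRingHom (ZMod 2))) := by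
    refine ((hH.coprime_iff_not_dvd).2 fun hdvd => ?_).symm
    have := natDegree_le_of_dvd hdvd hU
    have h2 := natDegree_map_le (f := Int.castRingHom (ZMod 2)) (p := U)
    omega
  obtain ⟨a, b, hab⟩ := hcop
  obtain ⟨A, rfl⟩ := map_surjective _ (ZMod.ringHom_surjective (Int.castRingHom (ZMod 2))) a
  obtain ⟨B, rfl⟩ := map_surjective _ (ZMod.ringHom_surjective (Int.castRingHom (ZMod 2))) b
  have hker : (A * U + B * H - 1).map (Int.castRingHom (ZMod 2)) = 0 := by
    simp [← hab]
  have h2 : C (2 : ℤ) ∣ A * U + B * H - 1 := by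
    rw [C_dvd_iff_dvd_coeff]
    intro i
    have := congrArg (fun p => coeff p i) hker
    simp only [coeff_map, coeff_zero] at this
    exact (ZMod.intCast_zmod_eq_zero_iff_dvd _ 2).1 (by simpa using this)
  obtain ⟨D, hD⟩ := h2
  exact ⟨A, B, D, by
    have h3 : (C (2 : ℤ) : ℤ[X]) = 2 := by simp
    rw [h3] at hD
    linear_combination hD⟩

namespace SexticField
variable {c : ℤ} {K : Type*} [Field K] [NumberField K]

lemma aeval_sexticShift (S : SexticField c K) : aeval (S.θ - 1) (sexticShift c) = 0 := by
  have hw := S.w_sq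
  have hθ := S.θ_rel
  simp only [sexticShift, map_add, map_mul, map_sub, map_pow, aeval_X, aeval_C, map_one, map_ofNat,
    algebraMap_int_eq, eq_intCast, map_intCast]
  linear_combination (S.θ ^ 3 + S.θ ^ 2 - 2 * S.θ - 1 - 2 * S.w * (S.θ ^ 2 + S.θ)) * hθ
    + 4 * (S.θ ^ 2 + S.θ) ^ 2 * hw

/-- The power basis generated by `θ - 1`. -/
noncomputable def powerBasis (S : SexticField c K) : PowerBasis ℚ K :=
  PowerBasis.ofAdjoinEqTop (Algebra.IsIntegral.isIntegral _) S.adjoin_eq_top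

lemma powerBasis_gen (S : SexticField c K) : S.powerBasis.gen = ((S.θ - 1 : 𝓞 K) : K) := by
  simp [powerBasis]

lemma minpoly_powerBasis_gen (S : SexticField c K) :
    minpoly ℚ S.powerBasis.gen = (sexticShift c).map (algebraMap ℤ ℚ) := by
  refine (Polynomial.eq_of_monic_of_associated (minpoly.monic S.powerBasis.isIntegral_gen)
    ((monic_sexticShift c).map _) ?_)
  have hdvd : minpoly ℚ S.powerBasis.gen ∣ (sexticShift c).map (algebraMap ℤ ℚ) := by
    apply minpoly.dvd
    rw [aeval_map_algebraMap, powerBasis_gen, aeval_algebraMap_apply, S.aeval_sexticShift, map_zero]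
  refine associated_of_dvd_of_natDegree_le hdvd ((monic_sexticShift c).map _).ne_zero ?_
  rw [(monic_sexticShift c).natDegree_map, natDegree_sexticShift, S.powerBasis.natDegree_minpoly,
    ← S.powerBasis.finrank, S.finrank_eq]

lemma isUnit_not_dvd_two (S : SexticField c K) (U : ℤ[X]) (hU : U.IsPrimitive)
    (hd : U.natDegree ≤ 2) (ϖ : 𝓞 K) (hϖ : Prime ϖ) (h : ϖ ∣ aeval (S.θ - 1) U) : ¬ ϖ ∣ 2 := by
  intro h2
  have hirr : Irreducible ((X ^ 3 + 4 * X ^ 2 + 3 * X - 1 : ℤ[X]).map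
      (Int.castRingHom (ZMod 2))) := by
    apply irreducible_cubic_zmod_two
    · rw [Monic.natDegree_map (by monicity!)]; compute_degree!
    · simp
    · simp; decide
  obtain ⟨A, B, D, hABD⟩ := exists_bezout_of_map_ne_zero U _ hirr (by
    rw [Monic.natDegree_map (by monicity!)]
    refine lt_of_le_of_lt hd ?_
    have : (X ^ 3 + 4 * X ^ 2 + 3 * X - 1 : ℤ[X]).natDegree = 3 := by compute_degree!
    omega) (map_ne_zero_of_isPrimitive (p := 2) Nat.prime_two U hU)
  have h3 := congrArg (aeval (S.θ - 1)) hABD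
  simp only [map_add, map_mul, map_one, map_ofNat, map_sub, map_pow, aeval_X] at h3
  apply hϖ.not_isUnit
  apply isUnit_of_dvd_one
  have h4 : (1 : 𝓞 K) = aeval (S.θ - 1) A * aeval (S.θ - 1) U -
      2 * (aeval (S.θ - 1) B * S.w * (S.θ ^ 2 + S.θ) + aeval (S.θ - 1) D) := by
    linear_combination -h3 + aeval (S.θ - 1) B * S.θ_rel
  rw [h4]
  exact dvd_sub (h.mul_left _) (h2.mul_right _)

lemma special_prime_one (x ϖ : 𝓞 K) (hϖ : Prime ϖ) (hx : aeval x (sexticShift 1) = 0)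
    (h : ϖ ∣ aeval x (derivative (sexticShift 1))) (h2 : ¬ ϖ ∣ 2) :
    ϖ ∣ ((13 : ℕ) : 𝓞 K) ∧ ϖ ∣ ((2 : ℤ) : 𝓞 K) - x := by
  have hG : 17 + 42 * x + 53 * x ^ 2 + 46 * x ^ 3 + 26 * x ^ 4 + 8 * x ^ 5 + x ^ 6 = 0 := by
    simp [sexticShift, map_ofNat] at hx
    linear_combination hx
  have hD : ϖ ∣ 42 + 106 * x + 138 * x ^ 2 + 104 * x ^ 3 + 40 * x ^ 4 + 6 * x ^ 5 := by
    simp [sexticShift, derivative_pow, map_ofNat] at h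
    convert h using 1
    ring
  generalize hDe : 42 + 106 * x + 138 * x ^ 2 + 104 * x ^ 3 + 40 * x ^ 4 + 6 * x ^ 5 = D at hD
  have h13 : ϖ ∣ 13 := by
    have : ϖ ∣ 2 ^ 3 * 13 := by
      rw [show (2 ^ 3 * 13 : 𝓞 K) = (-633 - 1109 * x - 1166 * x ^ 2 - 865 * x ^ 3 - 336 * x ^ 4
        - 50 * x ^ 5) * D by
        rw [← hDe]
        linear_combination (1570 + 2808 * x + 3102 * x ^ 2 + 1616 * x ^ 3 + 300 * x ^ 4) * hG]
      exact hD.mul_left _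
    rcases hϖ.dvd_or_dvd this with h | h
    · exact absurd (hϖ.dvd_of_dvd_pow h) h2
    · exact h
  refine ⟨by exact_mod_cast h13, hϖ.dvd_of_dvd_pow (n := 2) ?_⟩
  rw [show (((2 : ℤ) : 𝓞 K) - x) ^ 2 = x ^ 3 * D - 13 * (1 + 14 * x + 39 * x ^ 2 + 62 * x ^ 3
    + 67 * x ^ 4 + 52 * x ^ 5 + 27 * x ^ 6 + 8 * x ^ 7 + x ^ 8) by
    rw [← hDe]; push_cast
    linear_combination (1 + 8 * x + 7 * x ^ 2) * hG]
  exact dvd_sub (hD.mul_left _) (h13.mul_right _)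

lemma special_prime_two (x ϖ : 𝓞 K) (hϖ : Prime ϖ) (hx : aeval x (sexticShift 2) = 0)
    (h : ϖ ∣ aeval x (derivative (sexticShift 2))) (h2 : ¬ ϖ ∣ 2) :
    ϖ ∣ ((3 : ℕ) : 𝓞 K) ∧ ϖ ∣ ((0 : ℤ) : 𝓞 K) - x := by
  have hG : 33 + 90 * x + 105 * x ^ 2 + 70 * x ^ 3 + 30 * x ^ 4 + 8 * x ^ 5 + x ^ 6 = 0 := by
    simp [sexticShift, map_ofNat] at hx
    linear_combination hx
  have hD : ϖ ∣ 90 + 210 * x + 210 * x ^ 2 + 120 * x ^ 3 + 40 * x ^ 4 + 6 * x ^ 5 := by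
    simp [sexticShift, derivative_pow, map_ofNat] at h
    convert h using 1
    ring
  generalize hDe : 90 + 210 * x + 210 * x ^ 2 + 120 * x ^ 3 + 40 * x ^ 4 + 6 * x ^ 5 = D at hD
  have h3 : ϖ ∣ 3 := by
    have : ϖ ∣ 2 ^ 4 * 3 ^ 2 := by
      rw [show (2 ^ 4 * 3 ^ 2 : 𝓞 K) = (-489 - 813 * x - 610 * x ^ 2 - 285 * x ^ 3 - 80 * x ^ 4
        - 10 * x ^ 5) * D by
        rw [← hDe]
        linear_combination (1338 + 1680 * x + 1110 * x ^ 2 + 400 * x ^ 3 + 60 * x ^ 4) * hG]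
      exact hD.mul_left _
    rcases hϖ.dvd_or_dvd this with h | h
    · exact absurd (hϖ.dvd_of_dvd_pow h) h2
    · exact hϖ.dvd_of_dvd_pow h
  refine ⟨by exact_mod_cast h3, hϖ.dvd_of_dvd_pow (n := 3) ?_⟩
  rw [show (((0 : ℤ) : 𝓞 K) - x) ^ 3 = 3 * (11 + 60 * x + 165 * x ^ 2 + 233 * x ^ 3
    + 190 * x ^ 4 + 96 * x ^ 5 + 29 * x ^ 6 + 4 * x ^ 7) - (x + 2 * x ^ 2) * D by
    rw [← hDe]; push_cast
    linear_combination -hG]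
  exact dvd_sub (h3.mul_right _) (hD.mul_left _)

/-- A primitive quadratic polynomial dividing `A² - m²G` is plus or minus a square at a root of
`G`. -/
theorem aeval_eq_sq_or_neg_sq (S : SexticField c K) (hc : c = 1 ∨ c = 2) (u0 u1 u2 m : ℤ)
    (A : ℤ[X]) (hm : m ≠ 0) (hU : (C u0 * X ^ 2 + C u1 * X + C u2).IsPrimitive)
    (h : C u0 * X ^ 2 + C u1 * X + C u2 ∣ A ^ 2 - C (m ^ 2) * sexticShift c) :
    ∃ s : K, aeval (S.θ - 1 : K) (C u0 * X ^ 2 + C u1 * X + C u2 : ℤ[X]) = s ^ 2 ∨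
      aeval (S.θ - 1 : K) (C u0 * X ^ 2 + C u1 * X + C u2 : ℤ[X]) = -s ^ 2 := by
  haveI := S.isPrincipalIdealRing
  have hgen := S.powerBasis_gen
  have hmp := S.minpoly_powerBasis_gen
  have hd : (C u0 * X ^ 2 + C u1 * X + C u2 : ℤ[X]).natDegree ≤ 2 := natDegree_quadratic_le
  have hev : aeval (S.θ - 1 : 𝓞 K) (C u0 * X ^ 2 + C u1 * X + C u2 : ℤ[X]) =
      S.ofCoord ⟨u0 - u1 + u2, 0, u1 - 2 * u0, 0, u0, 0⟩ := by
    simp [ofCoord, Coord.eval, Coord.map]; ring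
  have hpar : ¬ (2 ∣ u0 - u1 + u2 ∧ 2 ∣ u1 - 2 * u0 ∧ 2 ∣ u0) := by
    rintro ⟨h1, h2, h3⟩
    have h4 := hU 2 (by
      rw [C_dvd_iff_dvd_coeff]
      have hu1 : 2 ∣ u1 := by omega
      have hu2 : 2 ∣ u2 := by omega
      intro i
      simp only [coeff_add, coeff_C_mul]
      refine dvd_add (dvd_add (h3.mul_right _) (hu1.mul_right _)) ?_
      rw [coeff_C]; split_ifs
      · exact hu2
      · exact dvd_zero _)
    exact absurd h4 (by decide)
  set U : ℤ[X] := C u0 * X ^ 2 + C u1 * X + C u2 with hUdef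
  have hU0 : aeval (S.θ - 1 : 𝓞 K) U ≠ 0 := by
    intro h0
    have h1 : minpoly ℚ S.powerBasis.gen ∣ U.map (algebraMap ℤ ℚ) := by
      apply minpoly.dvd
      rw [aeval_map_algebraMap, hgen, aeval_algebraMap_apply, h0, map_zero]
    have h2 : U.map (algebraMap ℤ ℚ) ≠ 0 :=
      (Polynomial.map_ne_zero_iff (algebraMap ℤ ℚ).injective_int).2 hU.ne_zero
    have h3 := natDegree_le_of_dvd h1 h2
    rw [hmp, (monic_sexticShift c).natDegree_map, natDegree_sexticShift] at h3
    have h4 := natDegree_map_le (f := algebraMap ℤ ℚ) (p := U)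
    omega
  have hNτ : ∀ e : ℤ, Algebra.norm ℤ ((e : 𝓞 K) - (S.θ - 1)) = (sexticShift c).eval e := by
    intro e
    have h1 := norm_intCast_sub_gen S.powerBasis _ hmp e
    rw [hgen] at h1
    have h2 := Algebra.coe_norm_int ((e : 𝓞 K) - (S.θ - 1))
    have h3 : (((e : 𝓞 K) - (S.θ - 1) : 𝓞 K) : K) = (e : K) - ((S.θ - 1 : 𝓞 K) : K) := by simp
    rw [h3, h1] at h2
    exact_mod_cast h2
  have hsq : IsSquare ((Algebra.norm ℤ (aeval (S.θ - 1 : 𝓞 K) U) : ℤ) : ℚ) := by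
    obtain ⟨W, hW⟩ := h
    have h1 := isSquare_norm_aeval_of_natDegree_le_two S.powerBasis S.finrank_eq
      (U.map (algebraMap ℤ ℚ)) (A.map (algebraMap ℤ ℚ)) (W.map (algebraMap ℤ ℚ)) m
      (by exact_mod_cast hm) (natDegree_map_le.trans hd) (by
        rw [hmp, ← Polynomial.map_mul, ← hW]; simp)
    rw [aeval_map_algebraMap, hgen, aeval_algebraMap_apply] at h1
    have h2 := Algebra.coe_norm_int (aeval (S.θ - 1 : 𝓞 K) U)
    rw [h2]
    exact h1
  have hGτ := S.aeval_sexticShift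
  obtain ⟨ε, s, hs⟩ : ∃ (ε : (𝓞 K)ˣ) (s : 𝓞 K), aeval (S.θ - 1 : 𝓞 K) U = ε * s ^ 2 := by
    rcases hc with rfl | rfl
    · exact eq_unit_mul_sq_of_dvd (isNormLike_norm S.finrank_eq) (S.θ - 1) (sexticShift 1) U A m hU
        hd hm h hGτ hNτ hU0 (S.isUnit_not_dvd_two U hU hd) 13 (by norm_num) 2
        (fun ϖ hϖ h1 h2 => special_prime_one _ ϖ hϖ hGτ h1 h2) (by
          simp [sexticShift]) hsq
    · exact eq_unit_mul_sq_of_dvd (isNormLike_norm S.finrank_eq) (S.θ - 1) (sexticShift 2) U A m hU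
        hd hm h hGτ hNτ hU0 (S.isUnit_not_dvd_two U hU hd) 3 (by norm_num) 0
        (fun ϖ hϖ h1 h2 => special_prime_two _ ϖ hϖ hGτ h1 h2) (by
          simp [sexticShift]) hsq
  obtain ⟨t, ht⟩ := S.eq_sq_of_units hc _ _ _ hpar ε s (hev ▸ hs)
  refine ⟨t, ?_⟩
  have h5 : aeval (S.θ - 1 : K) U = (S.ofCoord ⟨u0 - u1 + u2, 0, u1 - 2 * u0, 0, u0, 0⟩ : K) := by
    rw [← hev]
    exact (by simp : (S.θ - 1 : K) = algebraMap (𝓞 K) K (S.θ - 1)) ▸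
      aeval_algebraMap_apply K (S.θ - 1) U
  rw [h5]
  exact ht

end SexticField

lemma eq_of_quadratic_eq {R : Type*} [CommRing R] {a b c a' b' c' : R}
    (h : C a * X ^ 2 + C b * X + C c = C a' * X ^ 2 + C b' * X + C c') :
    a = a' ∧ b = b' ∧ c = c' := by
  have hc : ∀ (x y z : R) (i : ℕ), (C x * X ^ 2 + C y * X + C z : R[X]).coeff i =
      x * (if i = 2 then 1 else 0) + y * (if i = 1 then 1 else 0) + (if i = 0 then z else 0) := by
    intro x y z i
    rw [coeff_add, coeff_add, coeff_C_mul, coeff_C_mul, coeff_X_pow, coeff_X, coeff_C]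
    simp only [eq_comm]
  have h' : ∀ i, _ := fun i => congrArg (fun p => coeff p i) h
  simp only [hc] at h'
  exact ⟨by simpa using h' 2, by simpa using h' 1, by simpa using h' 0⟩

lemma eq_quadratic_of_natDegree_le {R : Type*} [CommRing R] {P : R[X]} (h : P.natDegree ≤ 2) :
    P = C (P.coeff 2) * X ^ 2 + C (P.coeff 1) * X + C (P.coeff 0) := by
  conv_lhs => rw [P.as_sum_range_C_mul_X_pow' (Nat.lt_succ_of_le h)]
  simp [Finset.sum_range_succ]
  ring

lemma exists_sq_sub_eq_mul_minpoly {K : Type*} [Field K] [Algebra ℚ K]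
    (hn : Module.finrank ℚ K = 6) (ρ s : K) (g U : ℚ[X]) (κ : ℚ) (hg : g.natDegree = 6)
    (hgρ : aeval ρ g = 0) (hρ : ∀ P : ℚ[X], P.natDegree ≤ 5 → aeval ρ P = 0 → P = 0)
    (hU : U.natDegree ≤ 2) (hs : κ • aeval ρ U = s ^ 2) :
    ∃ (A B : ℚ[X]) (d : ℚ), A.natDegree ≤ 3 ∧ B.natDegree ≤ 2 ∧ B ≠ 0 ∧
      A ^ 2 - C κ * U * B ^ 2 = C d * g := by
  have : FiniteDimensional ℚ K := Module.finite_of_finrank_pos (by omega)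
  let f : (degreeLT ℚ 4 × degreeLT ℚ 3) →ₗ[ℚ] K :=
    ((aeval ρ).toLinearMap ∘ₗ (degreeLT ℚ 4).subtype) ∘ₗ LinearMap.fst ℚ _ _ -
      (LinearMap.mulLeft ℚ s ∘ₗ (aeval ρ).toLinearMap ∘ₗ (degreeLT ℚ 3).subtype) ∘ₗ
        LinearMap.snd ℚ _ _
  have := (degreeLTEquiv ℚ 4).symm.finiteDimensional
  have := (degreeLTEquiv ℚ 3).symm.finiteDimensional
  have hdim : Module.finrank ℚ K < Module.finrank ℚ (degreeLT ℚ 4 × degreeLT ℚ 3) := by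
    rw [Module.finrank_prod, (degreeLTEquiv ℚ 4).finrank_eq, (degreeLTEquiv ℚ 3).finrank_eq, hn]
    simp
  obtain ⟨⟨⟨A, hA⟩, ⟨B, hB⟩⟩, hmem, hne⟩ := Submodule.exists_mem_ne_zero_of_ne_bot
    (LinearMap.ker_ne_bot_of_finrank_lt (f := f) hdim)
  have hAB : aeval ρ A = s * aeval ρ B := by
    have : aeval ρ A - s * aeval ρ B = 0 := hmem
    exact sub_eq_zero.1 this
  have hA3 : A.natDegree ≤ 3 := by
    rw [natDegree_le_iff_degree_le]
    exact Order.le_of_lt_succ (mem_degreeLT.1 hA)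
  have hB2 : B.natDegree ≤ 2 := by
    rw [natDegree_le_iff_degree_le]
    exact Order.le_of_lt_succ (mem_degreeLT.1 hB)
  have hB0 : B ≠ 0 := by
    rintro rfl
    have : A = 0 := hρ A (by omega) (by simpa using hAB)
    subst this
    exact hne rfl
  have hg0 : g ≠ 0 := by rintro rfl; simp at hg
  set P := A ^ 2 - C κ * U * B ^ 2 with hP
  have hPd : P.natDegree ≤ 6 := by
    refine (natDegree_sub_le _ _).trans (max_le (natDegree_pow_le.trans (by omega)) ?_)
    refine natDegree_mul_le.trans ?_
    have h1 := natDegree_C_mul_le κ U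
    have h2 : (B ^ 2).natDegree ≤ 2 * B.natDegree := natDegree_pow_le
    omega
  have hPρ : aeval ρ P = 0 := by
    rw [hP, map_sub, map_pow, map_mul, map_mul, map_pow, aeval_C, hAB, ← Algebra.smul_def, hs]
    ring
  refine ⟨A, B, P.coeff 6 / g.coeff 6, hA3, hB2, hB0, ?_⟩
  have hlc : g.coeff 6 ≠ 0 := by rw [← hg]; exact leadingCoeff_ne_zero.2 hg0
  refine sub_eq_zero.1 (hρ (P - _) ?_ ?_)
  · rw [natDegree_le_iff_coeff_eq_zero]
    intro N hN
    rcases Nat.lt_or_ge 6 N with h6 | h6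
    · rw [coeff_sub, coeff_C_mul, coeff_eq_zero_of_natDegree_lt (p := P) (n := N) (by omega),
        coeff_eq_zero_of_natDegree_lt (p := g) (n := N) (by omega)]
      simp
    · obtain rfl : N = 6 := by omega
      rw [coeff_sub, coeff_C_mul]
      field_simp
      ring
  · rw [map_sub, hPρ, map_mul, hgρ]; simp

lemma right_or_wrong (g U V W A B : ℚ[X]) (κ d u0 u1 u2 : ℚ) (hirr : Irreducible g)
    (hg : g.natDegree = 6) (hu2 : u2 ≠ 0) (hU : U = C u0 + C u1 * X + C u2 * X ^ 2)
    (h : V ^ 2 - g = U * W) (hA : A ^ 2 - C κ * U * B ^ 2 = C d * g) :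
    (∃ (p : ℚ) (Q : ℚ[X]), p ≠ 0 ∧ d = p ^ 2 ∧ A = C p * V + U * Q) ∨
    ∃ (q : ℚ) (Q : ℚ[X]), d = q ^ 2 * ((u1 / (2 * u2)) ^ 2 - u0 / u2) ∧
      A = C q * (X + C (u1 / (2 * u2))) * V + U * Q := by
  have hUd : U.natDegree = 2 := by
    rw [hU, show C u0 + C u1 * X + C u2 * X ^ 2 = C u2 * X ^ 2 + C u1 * X + C u0 by ring,
      natDegree_quadratic hu2]
  have hU0 : U ≠ 0 := by rintro rfl; simp at hUd
  have hcop : IsCoprime V U := by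
    have h1 : IsCoprime g U := by
      refine (hirr.coprime_iff_not_dvd).2 fun hd => ?_
      have := natDegree_le_of_dvd hd hU0
      omega
    have h2 : IsCoprime (V ^ 2) U := by
      rw [show V ^ 2 = g + U * W by linear_combination h]
      exact h1.add_mul_left_left W
    exact (IsCoprime.pow_left_iff two_pos).1 h2
  obtain ⟨a, b, hab⟩ := hcop
  set R := (A * a) % U with hR
  have hdm := EuclideanDomain.div_add_mod (A * a) U
  rw [← hR] at hdm
  have hRd : R.natDegree ≤ 1 := by
    have : R.natDegree < U.natDegree := natDegree_mod_lt _ (by omega)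
    omega
  have hAR : A = R * V + U * (A * b + (A * a / U) * V) := by
    linear_combination -A * hab - V * hdm
  obtain ⟨q, p, hpq⟩ := exists_eq_X_add_C_of_natDegree_le_one hRd
  have hdvd : U ∣ R ^ 2 - C d := by
    have h3 : U ∣ V ^ 2 * (R ^ 2 - C d) := by
      set T := A * b + (A * a / U) * V
      refine ⟨C κ * B ^ 2 - C d * W - T * (2 * R * V + U * T), ?_⟩
      have h4 : (R * V + U * T) ^ 2 - C κ * U * B ^ 2 = C d * g := by rw [← hAR]; exact hA
      linear_combination h4 - C d * h
    exact (IsCoprime.pow_right (n := 2) (IsCoprime.symm ⟨a, b, hab⟩)).dvd_of_dvd_mul_left h3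
  obtain ⟨T, hT⟩ := hdvd
  have hTd : T.natDegree = 0 := by
    by_cases hT0 : T = 0
    · simp [hT0]
    have h4 : (U * T).natDegree = 2 + T.natDegree := by rw [natDegree_mul hU0 hT0, hUd]
    have h5 : (R ^ 2 - C d).natDegree ≤ 2 :=
      (natDegree_sub_le _ _).trans (max_le (natDegree_pow_le.trans (by omega)) (by simp))
    rw [hT] at h5
    omega
  obtain ⟨r, rfl⟩ := natDegree_eq_zero.1 hTd
  have hexp : R ^ 2 - C d = C (q ^ 2) * X ^ 2 + C (2 * p * q) * X + C (p ^ 2 - d) := by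
    rw [hpq]; simp only [C_mul, C_pow, C_sub, C_ofNat]; ring
  have hexp' : U * C r = C (u2 * r) * X ^ 2 + C (u1 * r) * X + C (u0 * r) := by
    rw [hU]; simp only [C_mul]; ring
  obtain ⟨e2, e1, e0⟩ := eq_of_quadratic_eq (hexp.symm.trans (hT.trans hexp'))
  by_cases hq : q = 0
  · have hr : r = 0 := by
      rcases mul_eq_zero.1 (e2.symm.trans (by rw [hq]; norm_num)) with h | h
      · exact absurd h hu2
      · exact h
    subst hr hq
    by_cases hp : p = 0
    · right
      refine ⟨0, A * b + (A * a / U) * V, ?_, hAR.trans ?_⟩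
      · subst hp; linarith
      · rw [hpq, hp]; simp
    · left
      refine ⟨p, A * b + (A * a / U) * V, hp, by linarith, hAR.trans ?_⟩
      rw [hpq]; simp
  · right
    have hr : r = q ^ 2 / u2 := by field_simp; linarith
    have hp : p = q * (u1 / (2 * u2)) := by
      rw [hr] at e1
      have h1 : q * (p - q * (u1 / (2 * u2))) = 0 := by
        field_simp at e1 ⊢
        linear_combination q * e1
      rcases mul_eq_zero.1 h1 with h | h
      · exact absurd h hq
      · linarith
    refine ⟨q, A * b + (A * a / U) * V, ?_, hAR.trans ?_⟩
    · rw [hp, hr] at e0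
      field_simp at e0 ⊢
      linarith
    · rw [hpq, hp]; simp only [C_mul]; ring

lemma disc_eq_zero_of_sq_eq (U A B : ℚ[X]) (κ u0 u1 u2 : ℚ) (hu2 : u2 ≠ 0)
    (hU : U = C u0 + C u1 * X + C u2 * X ^ 2) (hκ : κ ≠ 0) (hB : B ≠ 0)
    (h : A ^ 2 = C κ * U * B ^ 2) : (u1 / (2 * u2)) ^ 2 - u0 / u2 = 0 := by
  have hdvd : B ∣ A := by
    refine (IsIntegrallyClosed.pow_dvd_pow_iff (n := 2) two_ne_zero).1 ?_
    rw [h]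
    exact dvd_mul_left _ _
  obtain ⟨E, rfl⟩ := hdvd
  have hE : E ^ 2 = C κ * U := by
    have : B ^ 2 * (E ^ 2 - C κ * U) = 0 := by linear_combination h
    rcases mul_eq_zero.1 this with h | h
    · exact absurd (pow_eq_zero_iff two_ne_zero |>.1 h) hB
    · exact sub_eq_zero.1 h
  have hexp' : C κ * U = C (κ * u2) * X ^ 2 + C (κ * u1) * X + C (κ * u0) := by
    rw [hU]; simp only [C_mul]; ring
  have hEd : E.natDegree ≤ 1 := by
    have h1 : (E ^ 2).natDegree = 2 * E.natDegree := natDegree_pow _ _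
    have h2 : (C κ * U).natDegree ≤ 2 := by rw [hexp']; exact natDegree_quadratic_le
    rw [hE] at h1
    omega
  obtain ⟨a, b, rfl⟩ := exists_eq_X_add_C_of_natDegree_le_one hEd
  have hexp : (C a * X + C b) ^ 2 = C (a ^ 2) * X ^ 2 + C (2 * a * b) * X + C (b ^ 2) := by
    simp only [C_mul, C_pow, C_ofNat]; ring
  rw [hexp, hexp'] at hE
  obtain ⟨e2, e1, e0⟩ := eq_of_quadratic_eq hE
  have h3 : κ ^ 2 * (u1 ^ 2 - 4 * u0 * u2) = 0 := by
    have : κ ^ 2 * (u1 ^ 2 - 4 * u0 * u2) = (κ * u1) ^ 2 - 4 * (κ * u0) * (κ * u2) := by ring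
    rw [this, ← e0, ← e1, ← e2]; ring
  have h4 : u1 ^ 2 - 4 * u0 * u2 = 0 := by
    rcases mul_eq_zero.1 h3 with h | h
    · exact absurd (pow_eq_zero_iff two_ne_zero |>.1 h) hκ
    · exact h
  field_simp
  linarith

lemma eq_zero_of_sq_add_mul_sq {c : ℚ} (hc : 0 < c) {a b : ℚ} (h : a ^ 2 + c * b ^ 2 = 0) :
    a = 0 ∧ b = 0 := by
  have h1 : 0 ≤ c * b ^ 2 := by positivity
  have ha : a ^ 2 = 0 := by nlinarith [sq_nonneg a]
  have hb : c * b ^ 2 = 0 := by linarith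
  exact ⟨by simpa using ha, by simpa [hc.ne'] using hb⟩

lemma eq_zero_of_sq_add_mul_sq_poly {c : ℚ} (hc : 0 < c) {a b : ℚ[X]}
    (h : a ^ 2 + C c * b ^ 2 = 0) : a = 0 ∧ b = 0 := by
  have h1 : ∀ x, a.eval x = 0 ∧ b.eval x = 0 := fun x =>
    eq_zero_of_sq_add_mul_sq hc (by simpa using congrArg (eval x) h)
  exact ⟨Polynomial.funext fun x => by simpa using (h1 x).1,
    Polynomial.funext fun x => by simpa using (h1 x).2⟩

lemma not_both_wrong (g U V A₁ B₁ Q₁ A₂ B₂ Q₂ : ℚ[X]) (L : ℚ[X]) (c κ q₁ q₂ Δ : ℚ) (hc : 0 < c)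
    (hκ : κ ≠ 0) (hirr : Irreducible g) (hg : g.natDegree = 6) (hU : U.natDegree = 2)
    (hA₁ : A₁.natDegree ≤ 3) (hA₂ : A₂.natDegree ≤ 3) (hB₁ : B₁.natDegree ≤ 2)
    (hB₂ : B₂.natDegree ≤ 2) (hB₁0 : B₁ ≠ 0) (hq₁ : q₁ ≠ 0) (hq₂ : q₂ ≠ 0) (hΔ : Δ ≠ 0)
    (h₁ : A₁ ^ 2 - C κ * U * B₁ ^ 2 = C (q₁ ^ 2 * Δ) * g)
    (h₂ : A₂ ^ 2 - C (-c * κ) * U * B₂ ^ 2 = C (q₂ ^ 2 * Δ) * g)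
    (hw₁ : A₁ = C q₁ * L * V + U * Q₁) (hw₂ : A₂ = C q₂ * L * V + U * Q₂) : False := by
  have hU0 : U ≠ 0 := by rintro rfl; simp at hU
  set ℓ := C q₂ * Q₁ - C q₁ * Q₂ with hℓ
  set b₁ := C q₂ * B₁ with hb₁
  set b₂ := C q₁ * B₂ with hb₂
  set a₁ := C q₂ * A₁ with ha₁
  set a₂ := C q₁ * A₂ with ha₂
  have hdiff : a₁ - a₂ = U * ℓ := by rw [ha₁, ha₂, hw₁, hw₂, hℓ]; ring
  have hb₁d : b₁.natDegree ≤ 2 := (natDegree_C_mul_le _ _).trans hB₁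
  have hb₂d : b₂.natDegree ≤ 2 := (natDegree_C_mul_le _ _).trans hB₂
  have ha₁d : a₁.natDegree ≤ 3 := (natDegree_C_mul_le _ _).trans hA₁
  have ha₂d : a₂.natDegree ≤ 3 := (natDegree_C_mul_le _ _).trans hA₂
  have hb₁0 : b₁ ≠ 0 := mul_ne_zero (C_ne_zero.2 hq₂) hB₁0
  have hd0 : q₁ ^ 2 * q₂ ^ 2 * Δ ≠ 0 := by positivity
  have hg₁ : a₁ ^ 2 - C κ * U * b₁ ^ 2 = C (q₁ ^ 2 * q₂ ^ 2 * Δ) * g := by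
    rw [ha₁, hb₁]
    simp only [C_mul, C_pow] at h₁ ⊢
    linear_combination C q₂ ^ 2 * h₁
  have hg₂ : a₂ ^ 2 - C (-c * κ) * U * b₂ ^ 2 = C (q₁ ^ 2 * q₂ ^ 2 * Δ) * g := by
    rw [ha₂, hb₂]
    simp only [C_mul, C_pow] at h₂ ⊢
    linear_combination C q₁ ^ 2 * h₂
  have hsum : ℓ * (a₁ + a₂) = C κ * (b₁ ^ 2 + C c * b₂ ^ 2) := by
    have : U * (ℓ * (a₁ + a₂) - C κ * (b₁ ^ 2 + C c * b₂ ^ 2)) = 0 := by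
      rw [show C (-c * κ) = -(C c * C κ) by simp] at hg₂
      linear_combination hg₁ - hg₂ - (a₁ + a₂) * hdiff
    rcases mul_eq_zero.1 this with h | h
    · exact absurd h hU0
    · exact sub_eq_zero.1 h
  have hℓ0 : ℓ ≠ 0 := by
    intro h0
    rw [h0, zero_mul] at hsum
    rcases mul_eq_zero.1 hsum.symm with h | h
    · exact hκ (C_eq_zero.1 h)
    · exact hb₁0 (eq_zero_of_sq_add_mul_sq_poly hc h).1
  have hℓd : ℓ.natDegree ≤ 1 := by
    have h3 : (U * ℓ).natDegree = 2 + ℓ.natDegree := by rw [natDegree_mul hU0 hℓ0, hU]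
    have h4 : (a₁ - a₂).natDegree ≤ 3 := (natDegree_sub_le _ _).trans (max_le ha₁d ha₂d)
    rw [hdiff] at h4
    omega
  rcases Nat.lt_or_ge ℓ.natDegree 1 with h0 | h1
  · obtain ⟨l, hl⟩ := natDegree_eq_zero.1 (by omega : ℓ.natDegree = 0)
    have hl0 : l ≠ 0 := by rintro rfl; simp at hl; exact hℓ0 hl.symm
    have hsd : (a₁ + a₂).natDegree ≤ 3 := (natDegree_add_le _ _).trans (max_le ha₁d ha₂d)
    have hco : b₁.coeff 2 ^ 2 + c * b₂.coeff 2 ^ 2 = 0 := by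
      have h5 := congrArg (fun p => coeff p 4) hsum
      simp only [← hl, coeff_C_mul, coeff_add] at h5
      have h6 : (b₁ ^ 2).coeff 4 = b₁.coeff 2 ^ 2 := by
        simpa using coeff_pow_of_natDegree_le (m := 2) hb₁d
      have h7 : (b₂ ^ 2).coeff 4 = b₂.coeff 2 ^ 2 := by
        simpa using coeff_pow_of_natDegree_le (m := 2) hb₂d
      rw [h6, h7, coeff_eq_zero_of_natDegree_lt (p := a₁) (by omega),
        coeff_eq_zero_of_natDegree_lt (p := a₂) (by omega)] at h5
      simpa [hκ] using h5.symm
    obtain ⟨hc1, hc2⟩ := eq_zero_of_sq_add_mul_sq hc hco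
    have hred : ∀ b : ℚ[X], b.natDegree ≤ 2 → b.coeff 2 = 0 → b.natDegree ≤ 1 := by
      intro b hb hb2
      rw [natDegree_le_iff_coeff_eq_zero] at hb ⊢
      intro N hN
      rcases Nat.lt_or_ge 2 N with h | h
      · exact hb N h
      · obtain rfl : N = 2 := by omega
        exact hb2
    have hb1' := hred _ hb₁d hc1
    have hb2' := hred _ hb₂d hc2
    have hs2 : (a₁ + a₂).natDegree ≤ 2 := by
      have h8 : (ℓ * (a₁ + a₂)).natDegree = (a₁ + a₂).natDegree := by
        rw [← hl, natDegree_C_mul hl0]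
      rw [← h8, hsum]
      refine (natDegree_C_mul_le _ _).trans ((natDegree_add_le _ _).trans (max_le ?_ ?_))
      · exact natDegree_pow_le.trans (by omega)
      · exact (natDegree_C_mul_le _ _).trans (natDegree_pow_le.trans (by omega))
    have ha2 : a₁.natDegree ≤ 2 := by
      have h9 : a₁ = C (1 / 2) * ((a₁ + a₂) + U * ℓ) := by
        rw [← hdiff, show (a₁ + a₂ + (a₁ - a₂)) = C 2 * a₁ by
          rw [show (C 2 : ℚ[X]) = 2 from rfl]; ring, ← mul_assoc, ← C_mul]
        norm_num
      rw [h9]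
      refine (natDegree_C_mul_le _ _).trans ((natDegree_add_le _ _).trans (max_le hs2 ?_))
      rw [← hl, mul_comm]
      exact (natDegree_C_mul_le _ _).trans hU.le
    have : (C (q₁ ^ 2 * q₂ ^ 2 * Δ) * g).natDegree ≤ 4 := by
      rw [← hg₁]
      refine (natDegree_sub_le _ _).trans (max_le (natDegree_pow_le.trans (by omega)) ?_)
      refine natDegree_mul_le.trans ?_
      have h1 := natDegree_C_mul_le κ U
      have h2 : (b₁ ^ 2).natDegree ≤ 2 * b₁.natDegree := natDegree_pow_le
      omega
    rw [natDegree_C_mul hd0] at this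
    omega
  · obtain ⟨x, hx⟩ := exists_root_of_degree_eq_one
      (degree_eq_iff_natDegree_eq_of_pos one_pos |>.2 (le_antisymm hℓd h1))
    have h3 := congrArg (eval x) hsum
    simp only [eval_mul, hx.eq_zero, zero_mul, eval_C, eval_add, eval_pow] at h3
    obtain ⟨hx1, hx2⟩ := eq_zero_of_sq_add_mul_sq hc
      ((mul_eq_zero.1 h3.symm).resolve_left hκ)
    obtain ⟨β₁, hβ₁⟩ := dvd_iff_isRoot.2 hx1
    obtain ⟨β₂, hβ₂⟩ := dvd_iff_isRoot.2 hx2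
    obtain ⟨γ, hγ⟩ := dvd_iff_isRoot.2 hx
    have hγ0 : γ ≠ 0 := by rintro rfl; simp at hγ; exact hℓ0 hγ
    have hγd : γ.natDegree = 0 := by
      have := congrArg natDegree hγ
      rw [natDegree_mul (X_sub_C_ne_zero x) hγ0, natDegree_X_sub_C] at this
      omega
    obtain ⟨k, rfl⟩ := natDegree_eq_zero.1 hγd
    have hk : k ≠ 0 := by simpa using hγ0
    have h4 : C k * (a₁ + a₂) = C κ * (X - C x) * (β₁ ^ 2 + C c * β₂ ^ 2) := by
      have : (X - C x) * (C k * (a₁ + a₂) - C κ * (X - C x) * (β₁ ^ 2 + C c * β₂ ^ 2)) = 0 := by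
        rw [hβ₁, hβ₂, hγ] at hsum
        linear_combination hsum
      exact sub_eq_zero.1 ((mul_eq_zero.1 this).resolve_left (X_sub_C_ne_zero x))
    have h5 := congrArg (eval x) h4
    have h6 := congrArg (eval x) hdiff
    simp only [eval_mul, eval_C, eval_add, eval_sub, eval_X, sub_self, mul_zero, zero_mul,
      hx.eq_zero] at h5 h6
    have h7 : eval x a₁ = 0 := by
      have := (mul_eq_zero.1 h5).resolve_left hk
      linarith
    have h8 := congrArg (eval x) hg₁
    simp only [eval_sub, eval_pow, eval_mul, eval_C, h7, hx1] at h8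
    have h9 : g.eval x = 0 := by
      have : (q₁ ^ 2 * q₂ ^ 2 * Δ) * g.eval x = 0 := by rw [← h8]; ring
      exact (mul_eq_zero.1 this).resolve_left hd0
    have h10 := degree_eq_one_of_irreducible_of_root hirr h9
    have h11 : g.natDegree = 1 := natDegree_eq_of_degree_eq_some (by simpa using h10)
    omega

/-- From representations of multiples of `g` by `A² - κUB²` and `A² + cκUB²` one obtains one with
`A` congruent to `V` modulo `U`, where `V² ≡ g` modulo `U`. -/
theorem exists_halving (g U V W A₁ B₁ A₂ B₂ : ℚ[X]) (c κ d₁ d₂ : ℚ) (hc : 0 < c)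
    (hκ : κ ≠ 0) (hirr : Irreducible g) (hg : g.natDegree = 6) (hU : U.natDegree = 2)
    (hV : V.natDegree ≤ 3) (h : V ^ 2 - g = U * W)
    (hA₁ : A₁.natDegree ≤ 3) (hA₂ : A₂.natDegree ≤ 3) (hB₁ : B₁.natDegree ≤ 2)
    (hB₂ : B₂.natDegree ≤ 2) (hB₁0 : B₁ ≠ 0) (hB₂0 : B₂ ≠ 0)
    (h₁ : A₁ ^ 2 - C κ * U * B₁ ^ 2 = C d₁ * g)
    (h₂ : A₂ ^ 2 - C (-c * κ) * U * B₂ ^ 2 = C d₂ * g) :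
    ∃ (k : ℚ) (ℓ B : ℚ[X]), k ≠ 0 ∧ B ≠ 0 ∧ ℓ.natDegree ≤ 1 ∧ B.natDegree ≤ 2 ∧
      (V + U * ℓ) ^ 2 - g = C k * U * B ^ 2 := by
  have hU0 : U ≠ 0 := by rintro rfl; simp at hU
  have right : ∀ (A B Q : ℚ[X]) (k p : ℚ), A.natDegree ≤ 3 → B.natDegree ≤ 2 → B ≠ 0 → k ≠ 0 →
      p ≠ 0 → A = C p * V + U * Q → A ^ 2 - C k * U * B ^ 2 = C (p ^ 2) * g →
      ∃ (k : ℚ) (ℓ B : ℚ[X]), k ≠ 0 ∧ B ≠ 0 ∧ ℓ.natDegree ≤ 1 ∧ B.natDegree ≤ 2 ∧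
      (V + U * ℓ) ^ 2 - g = C k * U * B ^ 2 := by
    intro A B Q k p hA hB hB0 hk hp hAQ hrel
    have hpi : C p * C p⁻¹ = (1 : ℚ[X]) := by rw [← C_mul, mul_inv_cancel₀ hp, C_1]
    refine ⟨k, C p⁻¹ * Q, C p⁻¹ * B, hk, mul_ne_zero (C_ne_zero.2 (inv_ne_zero hp)) hB0, ?_,
      (natDegree_C_mul_le _ _).trans hB, ?_⟩
    · refine (natDegree_C_mul_le _ _).trans ?_
      by_cases hQ : Q = 0
      · simp [hQ]
      have h3 : (U * Q).natDegree = 2 + Q.natDegree := by rw [natDegree_mul hU0 hQ, hU]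
      have h4 : (A - C p * V).natDegree ≤ 3 :=
        (natDegree_sub_le _ _).trans (max_le hA ((natDegree_C_mul_le _ _).trans hV))
      rw [show A - C p * V = U * Q by rw [hAQ]; ring] at h4
      omega
    · rw [hAQ, C_pow] at hrel
      have h5 : V + U * (C p⁻¹ * Q) = C p⁻¹ * (C p * V + U * Q) := by
        linear_combination -V * hpi
      rw [h5]
      linear_combination (C p⁻¹) ^ 2 * hrel + g * (C p * C p⁻¹ + 1) * hpi
  obtain ⟨u2, u1, u0, hu2, hUe⟩ : ∃ u2 u1 u0 : ℚ, u2 ≠ 0 ∧ U = C u2 * X ^ 2 + C u1 * X + C u0 :=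
    ⟨_, _, _, by rw [← hU]; exact leadingCoeff_ne_zero.2 hU0, eq_quadratic_of_natDegree_le hU.le⟩
  have hUe' : U = C u0 + C u1 * X + C u2 * X ^ 2 := by rw [hUe]; ring
  have hκ₂ : -c * κ ≠ 0 := mul_ne_zero (neg_ne_zero.2 hc.ne') hκ
  rcases right_or_wrong g U V W A₁ B₁ κ d₁ u0 u1 u2 hirr hg hu2 hUe' h h₁ with
    ⟨p, Q, hp, rfl, hAQ⟩ | ⟨q₁, Q₁, hd₁, hw₁⟩
  · exact right A₁ B₁ Q κ p hA₁ hB₁ hB₁0 hκ hp hAQ h₁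
  rcases right_or_wrong g U V W A₂ B₂ (-c * κ) d₂ u0 u1 u2 hirr hg hu2 hUe' h h₂ with
    ⟨p, Q, hp, rfl, hAQ⟩ | ⟨q₂, Q₂, hd₂, hw₂⟩
  · exact right A₂ B₂ Q _ p hA₂ hB₂ hB₂0 hκ₂ hp hAQ h₂
  exfalso
  have hboth : d₁ = 0 → d₂ = 0 → False := by
    rintro rfl rfl
    simp only [C_0, zero_mul] at h₁ h₂
    have h6 : (A₂ * B₁) ^ 2 + C c * (A₁ * B₂) ^ 2 = 0 := by
      simp only [C_mul, C_neg] at h₂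
      linear_combination B₁ ^ 2 * h₂ + C c * B₂ ^ 2 * h₁
    have h7 := (eq_zero_of_sq_add_mul_sq_poly hc h6).2
    rcases mul_eq_zero.1 h7 with h8 | h8
    · rw [h8] at h₁
      have h9 : C κ * U * B₁ ^ 2 = 0 := by linear_combination -h₁
      simp [hκ, hU0, hB₁0] at h9
    · exact hB₂0 h8
  set Δ := (u1 / (2 * u2)) ^ 2 - u0 / u2 with hΔdef
  by_cases h1 : d₁ = 0
  · have hΔ : Δ = 0 := disc_eq_zero_of_sq_eq U A₁ B₁ κ u0 u1 u2 hu2 hUe' hκ hB₁0 (by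
      rw [h1] at h₁; simp at h₁; linear_combination h₁)
    exact hboth h1 (by rw [hd₂, hΔ, mul_zero])
  by_cases h2 : d₂ = 0
  · have hΔ : Δ = 0 := disc_eq_zero_of_sq_eq U A₂ B₂ (-c * κ) u0 u1 u2 hu2 hUe' hκ₂ hB₂0 (by
      rw [h2, C_0, zero_mul] at h₂; linear_combination h₂)
    exact hboth (by rw [hd₁, hΔ, mul_zero]) h2
  have hq₁ : q₁ ≠ 0 := by rintro rfl; simp at hd₁; exact h1 hd₁
  have hq₂ : q₂ ≠ 0 := by rintro rfl; simp at hd₂; exact h2 hd₂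
  have hΔ : Δ ≠ 0 := by intro h0; rw [h0, mul_zero] at hd₁; exact h1 hd₁
  rw [hd₁] at h₁
  rw [hd₂] at h₂
  exact not_both_wrong g U V A₁ B₁ Q₁ A₂ B₂ Q₂ _ c κ q₁ q₂ Δ hc hκ hirr hg hU hA₁ hA₂ hB₁ hB₂ hB₁0
    hq₁ hq₂ hΔ h₁ h₂ hw₁ hw₂

/-- The cubic form `h` in the coordinate `1 / (t - 1)`. -/
noncomputable def cubicForm : ℤ[X] := 1 + 4 * X + 3 * X ^ 2 - X ^ 3

/-- The cubic form `q` in the coordinate `1 / (t - 1)`. -/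
noncomputable def cuspForm : ℤ[X] := X + 3 * X ^ 2 + 2 * X ^ 3

/-- The sextic `h² + 4cq²` in the coordinate `1 / (t - 1)`. -/
noncomputable def sexticForm (c : ℤ) : ℤ[X] := cubicForm ^ 2 + C (4 * c) * cuspForm ^ 2

lemma natDegree_cubicForm_le : cubicForm.natDegree ≤ 3 := by
  unfold cubicForm; compute_degree

lemma natDegree_cuspForm_le : cuspForm.natDegree ≤ 3 := by
  unfold cuspForm; compute_degree

lemma natDegree_sexticForm_le (c : ℤ) : (sexticForm c).natDegree ≤ 6 := by
  have h1 := natDegree_cubicForm_le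
  have h2 := natDegree_cuspForm_le
  refine (natDegree_add_le _ _).trans (max_le (natDegree_pow_le.trans (by omega)) ?_)
  exact (natDegree_C_mul_le _ _).trans (natDegree_pow_le.trans (by omega))

lemma coeff_six_sexticForm (c : ℤ) : (sexticForm c).coeff 6 = 1 + 16 * c := by
  have h1 : (cubicForm ^ 2).coeff 6 = cubicForm.coeff 3 ^ 2 := by
    simpa using coeff_pow_of_natDegree_le (m := 2) natDegree_cubicForm_le
  have h2 : (cuspForm ^ 2).coeff 6 = cuspForm.coeff 3 ^ 2 := by
    simpa using coeff_pow_of_natDegree_le (m := 2) natDegree_cuspForm_le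
  rw [sexticForm, coeff_add, coeff_C_mul, h1, h2]
  simp [cubicForm, cuspForm, coeff_X, coeff_one, coeff_ofNat_mul]
  ring

lemma reflect_cubicForm : reflect 3 cubicForm = X ^ 3 + 4 * X ^ 2 + 3 * X - 1 := by
  have : cubicForm = C 1 * X ^ 0 + C 4 * X ^ 1 + C 3 * X ^ 2 - C 1 * X ^ 3 := by
    simp [cubicForm]
  rw [this]
  simp only [reflect_sub, reflect_add, reflect_C_mul_X_pow]
  simp [revAt_le]

lemma reflect_cuspForm : reflect 3 cuspForm = (X + 1) * (X + 2) := by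
  have : cuspForm = C 1 * X ^ 1 + C 3 * X ^ 2 + C 2 * X ^ 3 := by
    simp [cuspForm]
  rw [this]
  simp only [reflect_add, reflect_C_mul_X_pow]
  simp [revAt_le]
  ring

lemma reflect_sq {R : Type*} [CommRing R] (f : R[X]) (n : ℕ) (h : f.natDegree ≤ n) :
    reflect (n + n) (f ^ 2) = reflect n f ^ 2 := by
  rw [sq, reflect_mul f f h h, sq]

lemma reflect_sexticForm (c : ℤ) : reflect 6 (sexticForm c) = sexticShift c := by
  have h1 := reflect_sq _ 3 natDegree_cubicForm_le
  have h2 := reflect_sq _ 3 natDegree_cuspForm_le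
  norm_num at h1 h2
  rw [sexticForm, reflect_add, reflect_C_mul, h1, h2, reflect_cubicForm, reflect_cuspForm,
    sexticShift]

lemma aeval_inv_mul_pow {R K : Type*} [CommRing R] [Field K] [Algebra R K] (τ : K) (hτ : τ ≠ 0)
    (P : R[X]) (N : ℕ) (hP : P.natDegree ≤ N) :
    aeval τ⁻¹ P * τ ^ N = aeval τ (reflect N P) := by
  letI := invertibleOfNonzero hτ
  have := eval₂_reflect_mul_pow (algebraMap R K) τ N (reflect N P)
    (natDegree_reflect_le.trans (by simp [hP]))
  rwa [reflect_reflect, invOf_eq_inv] at this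

lemma irreducible_of_aeval_eq_zero {K : Type*} [Field K] [Algebra ℚ K] (ρ : K) (g : ℚ[X])
    (hg : g.natDegree = 6) (hgρ : aeval ρ g = 0)
    (hρ : ∀ P : ℚ[X], P.natDegree ≤ 5 → aeval ρ P = 0 → P = 0) : Irreducible g := by
  have hg0 : g ≠ 0 := by rintro rfl; simp at hg
  have key : ∀ a b : ℚ[X], g = a * b → aeval ρ a = 0 → IsUnit b := by
    intro a b hab ha
    have ha0 : a ≠ 0 := by rintro rfl; simp at hab; exact hg0 hab
    have hb0 : b ≠ 0 := by rintro rfl; simp at hab; exact hg0 hab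
    have h1 : ¬ a.natDegree ≤ 5 := fun h => ha0 (hρ a h ha)
    have h2 : g.natDegree = a.natDegree + b.natDegree := by rw [hab, natDegree_mul ha0 hb0]
    rw [isUnit_iff_degree_eq_zero, degree_eq_natDegree hb0]
    exact_mod_cast (by omega : b.natDegree = 0)
  refine ⟨fun hu => ?_, fun a b hab => ?_⟩
  · have := natDegree_eq_zero_of_isUnit hu
    omega
  · have h1 : aeval ρ a * aeval ρ b = 0 := by rw [← map_mul, ← hab, hgρ]
    rcases mul_eq_zero.1 h1 with h | h
    · exact Or.inr (key a b hab h)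
    · exact Or.inl (key b a (by rw [hab, mul_comm]) h)

theorem exists_rational_halving (c : ℤ) (hc : c = 1 ∨ c = 2) (m : ℤ) (U V W : ℤ[X]) (hm : m ≠ 0)
    (hU : U.IsPrimitive) (hU2 : U.natDegree = 2) (hV : V.natDegree ≤ 3)
    (h : V ^ 2 - C (m ^ 2) * sexticForm c = U * W) :
    ∃ (k : ℚ) (ℓ B : ℚ[X]), k ≠ 0 ∧ B ≠ 0 ∧ ℓ.natDegree ≤ 1 ∧ B.natDegree ≤ 2 ∧
      (C (m : ℚ)⁻¹ * V.map (algebraMap ℤ ℚ) + U.map (algebraMap ℤ ℚ) * ℓ) ^ 2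
        - (sexticForm c).map (algebraMap ℤ ℚ) = C k * U.map (algebraMap ℤ ℚ) * B ^ 2 := by
  obtain ⟨K, _, _, ⟨S⟩⟩ := exists_sexticField c hc
  have hU0 : U ≠ 0 := hU.ne_zero
  have hinj : Function.Injective (algebraMap ℤ ℚ) := (algebraMap ℤ ℚ).injective_int
  have hW4 : W.natDegree ≤ 4 := by
    by_cases hW : W = 0
    · simp [hW]
    have h1 : (U * W).natDegree = 2 + W.natDegree := by rw [natDegree_mul hU0 hW, hU2]
    have h2 : (V ^ 2 - C (m ^ 2) * sexticForm c).natDegree ≤ 6 :=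
      (natDegree_sub_le _ _).trans (max_le (natDegree_pow_le.trans (by omega))
        ((natDegree_C_mul_le _ _).trans (natDegree_sexticForm_le c)))
    rw [h] at h2
    omega
  have hrefl : reflect 3 V ^ 2 - C (m ^ 2) * sexticShift c = reflect 2 U * reflect 4 W := by
    have h1 := reflect_sq _ 3 hV
    norm_num at h1
    rw [← h1, ← reflect_sexticForm, ← reflect_C_mul, ← reflect_sub, h,
      ← reflect_mul U W hU2.le hW4]
  have hUr : reflect 2 U = C (U.coeff 0) * X ^ 2 + C (U.coeff 1) * X + C (U.coeff 2) := by
    have h1 : U = C (U.coeff 2) * X ^ 2 + C (U.coeff 1) * X ^ 1 + C (U.coeff 0) * X ^ 0 := by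
      rw [pow_one, pow_zero, mul_one]
      exact eq_quadratic_of_natDegree_le hU2.le
    conv_lhs => rw [h1]
    simp only [reflect_add, reflect_C_mul_X_pow]
    simp [revAt_le]
    ring
  have hUp : (reflect 2 U).IsPrimitive := by
    intro r hr
    refine hU r ?_
    rw [C_dvd_iff_dvd_coeff] at hr ⊢
    intro i
    simpa [coeff_reflect] using hr (revAt 2 i)
  rw [hUr] at hUp
  obtain ⟨s, hs⟩ := S.aeval_eq_sq_or_neg_sq hc _ _ _ m (reflect 3 V) hm hUp
    (by rw [← hUr]; exact ⟨_, hrefl⟩)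
  rw [← hUr] at hs
  set τ : K := (S.θ - 1 : K) with hτdef
  have hgen : S.powerBasis.gen = τ := by rw [S.powerBasis_gen]; simp [τ]
  have hτmin : ∀ P : ℚ[X], P.natDegree ≤ 5 → aeval τ P = 0 → P = 0 := by
    intro P hP h0
    by_contra hne
    have h1 := natDegree_le_of_dvd (minpoly.dvd ℚ τ h0) hne
    rw [← hgen, S.minpoly_powerBasis_gen, (monic_sexticShift c).natDegree_map,
      natDegree_sexticShift] at h1
    omega
  have hτ0 : τ ≠ 0 := by
    intro h0
    have := hτmin X (by simp) (by simpa using h0)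
    exact X_ne_zero this
  have hgτ : aeval τ (sexticShift c) = 0 := by
    have h1 := congrArg (algebraMap (𝓞 K) K) S.aeval_sexticShift
    rw [← aeval_algebraMap_apply, map_zero] at h1
    simpa [τ] using h1
  have hρmin : ∀ P : ℚ[X], P.natDegree ≤ 5 → aeval τ⁻¹ P = 0 → P = 0 := by
    intro P hP h0
    have h1 := aeval_inv_mul_pow τ hτ0 P 5 hP
    rw [h0, zero_mul] at h1
    exact reflect_eq_zero_iff.1 (hτmin _ (natDegree_reflect_le.trans (by simp [hP])) h1.symm)
  have hgρ : aeval τ⁻¹ ((sexticForm c).map (algebraMap ℤ ℚ)) = 0 := by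
    rw [aeval_map_algebraMap]
    have h1 := aeval_inv_mul_pow τ hτ0 _ 6 (natDegree_sexticForm_le c)
    rw [reflect_sexticForm, hgτ] at h1
    exact (mul_eq_zero.1 h1).resolve_right (pow_ne_zero _ hτ0)
  have hgd : ((sexticForm c).map (algebraMap ℤ ℚ)).natDegree = 6 := by
    rw [natDegree_map_eq_of_injective hinj]
    refine natDegree_eq_of_le_of_coeff_ne_zero (natDegree_sexticForm_le c) ?_
    rw [coeff_six_sexticForm]
    rcases hc with rfl | rfl <;> norm_num
  have hirr := irreducible_of_aeval_eq_zero _ _ hgd hgρ hρmin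
  have hUd : (U.map (algebraMap ℤ ℚ)).natDegree = 2 := by
    rw [natDegree_map_eq_of_injective hinj, hU2]
  have hUρ : aeval τ⁻¹ (U.map (algebraMap ℤ ℚ)) = aeval τ (reflect 2 U) / τ ^ 2 := by
    rw [aeval_map_algebraMap, eq_div_iff (pow_ne_zero _ hτ0), aeval_inv_mul_pow τ hτ0 _ 2 hU2.le]
  obtain ⟨ε, hε, hsε⟩ : ∃ ε : ℚ, ε ≠ 0 ∧ ε • aeval τ⁻¹ (U.map (algebraMap ℤ ℚ)) = (s / τ) ^ 2 := by
    rcases hs with hs | hs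
    · exact ⟨1, one_ne_zero, by rw [one_smul, hUρ, hs, div_pow]⟩
    · exact ⟨-1, by norm_num, by rw [neg_smul, one_smul, hUρ, hs, div_pow]; ring⟩
  have hw : ((S.w : 𝓞 K) : K) ^ 2 = -(c : K) := by
    have := congrArg (algebraMap (𝓞 K) K) S.w_sq
    simpa using this
  have hsε₂ : (-(c : ℚ) * ε) • aeval τ⁻¹ (U.map (algebraMap ℤ ℚ)) = (S.w * (s / τ)) ^ 2 := by
    rw [mul_smul, hsε, mul_pow, hw, Algebra.smul_def]
    simp
  obtain ⟨A₁, B₁, d₁, hA₁, hB₁, hB₁0, h₁⟩ := exists_sq_sub_eq_mul_minpoly S.finrank_eq _ _ _ _ ε hgd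
    hgρ hρmin hUd.le hsε
  obtain ⟨A₂, B₂, d₂, hA₂, hB₂, hB₂0, h₂⟩ := exists_sq_sub_eq_mul_minpoly S.finrank_eq _ _ _ _ _ hgd
    hgρ hρmin hUd.le hsε₂
  have hmq : (m : ℚ) ≠ 0 := by exact_mod_cast hm
  refine exists_halving _ _ _ (C ((m : ℚ)⁻¹ ^ 2) * W.map (algebraMap ℤ ℚ)) A₁ B₁ A₂ B₂ c ε d₁ d₂ ?_
    hε hirr hgd hUd ((natDegree_C_mul_le _ _).trans (natDegree_map_le.trans hV)) ?_ hA₁ hA₂ hB₁ hB₂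
    hB₁0 hB₂0 h₁ h₂
  · rcases hc with rfl | rfl <;> norm_num
  · have h1 := congrArg (map (algebraMap ℤ ℚ)) h
    rw [Polynomial.map_sub, Polynomial.map_pow, Polynomial.map_mul, Polynomial.map_mul, map_C,
      show algebraMap ℤ ℚ (m ^ 2) = (m : ℚ) ^ 2 by simp, C_pow] at h1
    have h2 : C (m : ℚ) * C (m : ℚ)⁻¹ = 1 := by rw [← C_mul, mul_inv_cancel₀ hmq, C_1]
    rw [C_pow]
    linear_combination (C (m : ℚ)⁻¹) ^ 2 * h1 +
      (sexticForm c).map (algebraMap ℤ ℚ) * (C (m : ℚ) * C (m : ℚ)⁻¹ + 1) * h2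

/-- Primitive quadratic polynomials `U` modulo which the sextic is a square, with a square root
of the form `h + 2Z/m` with `m` odd. -/
def IsHalvable (c : ℤ) (U : ℤ[X]) : Prop :=
  U.IsPrimitive ∧ U.natDegree = 2 ∧ ∃ (m : ℤ) (Z W : ℤ[X]), Odd m ∧ Z.natDegree ≤ 3 ∧
    Z ^ 2 + C m * cubicForm * Z - C (c * m ^ 2) * cuspForm ^ 2 = U * W

lemma exists_C_mul_eq_map (P : ℚ[X]) :
    ∃ (n : ℕ) (Q : ℤ[X]), n ≠ 0 ∧ C (n : ℚ) * P = Q.map (algebraMap ℤ ℚ) := by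
  obtain ⟨b, hb, h⟩ := IsLocalization.integerNormalization_spec (nonZeroDivisors ℤ) P
  set Q := IsLocalization.integerNormalization (nonZeroDivisors ℤ) P
  have hb0 : b ≠ 0 := nonZeroDivisors.ne_zero hb
  refine ⟨b.natAbs, C (SignType.sign b : ℤ) * Q, by simpa using hb0, ?_⟩
  have h1 : ((b.natAbs : ℕ) : ℚ) = ((SignType.sign b : ℤ) : ℚ) * b := by
    have : (b.natAbs : ℤ) = (SignType.sign b : ℤ) * b := by rw [Int.natCast_natAbs, sign_mul_self]
    rw [← Int.cast_natCast, this, Int.cast_mul]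
  have h2 : b • P = C (b : ℚ) * P := by
    rw [← smul_eq_C_mul]
    ext i
    simp
  rw [Polynomial.map_mul, h, map_C, h1, h2, C_mul, mul_assoc]
  simp

lemma exists_isPrimitive_eq_C_mul_map (P : ℚ[X]) (hP : P ≠ 0) :
    ∃ (b : ℚ) (Q : ℤ[X]), b ≠ 0 ∧ Q.IsPrimitive ∧ P = C b * Q.map (algebraMap ℤ ℚ) := by
  obtain ⟨n, Q, hn, hQ⟩ := exists_C_mul_eq_map P
  have hn' : (n : ℚ) ≠ 0 := by exact_mod_cast hn
  have hinv : C (n : ℚ) * C (n : ℚ)⁻¹ = 1 := by rw [← C_mul, mul_inv_cancel₀ hn', C_1]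
  have hQ0 : Q ≠ 0 := by
    rintro rfl
    have : C (n : ℚ) * P = 0 := by simpa using hQ
    simp [hn, hP] at this
  refine ⟨(n : ℚ)⁻¹ * Q.content, Q.primPart, ?_, Q.isPrimitive_primPart, ?_⟩
  · have : Q.content ≠ 0 := by rwa [Ne, content_eq_zero_iff]
    exact mul_ne_zero (inv_ne_zero hn') (by exact_mod_cast this)
  · have h1 := congrArg (map (algebraMap ℤ ℚ)) Q.eq_C_content_mul_primPart
    rw [Polynomial.map_mul, map_C, ← hQ, show algebraMap ℤ ℚ Q.content = (Q.content : ℚ) by simp]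
      at h1
    rw [C_mul, mul_assoc, ← h1]
    linear_combination -P * hinv

/-- Clearing denominators while keeping the result nonzero modulo `2` when the denominator is
even. -/
lemma exists_C_mul_eq_map_of_even (P : ℚ[X]) :
    ∃ (n : ℕ) (Q : ℤ[X]), n ≠ 0 ∧ C (n : ℚ) * P = Q.map (algebraMap ℤ ℚ) ∧
      (Even n → ¬ C (2 : ℤ) ∣ Q) := by
  classical
  have hex : ∃ n : ℕ, n ≠ 0 ∧ ∃ Q : ℤ[X], C (n : ℚ) * P = Q.map (algebraMap ℤ ℚ) := by
    obtain ⟨n, Q, h1, h2⟩ := exists_C_mul_eq_map P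
    exact ⟨n, h1, Q, h2⟩
  obtain ⟨hn, Q, hQ⟩ := Nat.find_spec hex
  refine ⟨Nat.find hex, Q, hn, hQ, ?_⟩
  rintro ⟨k, hk⟩ ⟨R, rfl⟩
  refine Nat.find_min hex (m := k) (by omega) ⟨by omega, R, ?_⟩
  rw [hk, Polynomial.map_mul, map_C] at hQ
  have h2 : C (2 : ℚ) ≠ 0 := by simp
  refine mul_left_cancel₀ h2 ?_
  rw [← mul_assoc, ← C_mul]
  simp only [algebraMap_int_eq, eq_intCast, Int.cast_ofNat] at hQ ⊢
  rw [← hQ]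
  push_cast
  ring_nf

lemma exists_intCast_of_map_eq_C_mul {P Q : ℤ[X]} (hQ : Q.IsPrimitive) {κ : ℚ}
    (h : P.map (algebraMap ℤ ℚ) = C κ * Q.map (algebraMap ℤ ℚ)) : ∃ ν : ℤ, P = C ν * Q := by
  have hd : Q ∣ P := by
    rw [IsPrimitive.Int.dvd_iff_map_cast_dvd_map_cast _ _ hQ]
    exact ⟨C κ, by rw [mul_comm]; exact h⟩
  obtain ⟨R, rfl⟩ := hd
  have hQ0 : Q.map (algebraMap ℤ ℚ) ≠ 0 :=
    (Polynomial.map_ne_zero_iff (algebraMap ℤ ℚ).injective_int).2 hQ.ne_zero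
  have hR : R.map (algebraMap ℤ ℚ) = C κ := by
    rw [Polynomial.map_mul, mul_comm] at h
    exact mul_right_cancel₀ hQ0 h
  have hR0 : R.natDegree = 0 := by
    rw [← natDegree_map_eq_of_injective (algebraMap ℤ ℚ).injective_int, hR, natDegree_C]
  obtain ⟨ν, rfl⟩ := natDegree_eq_zero.1 hR0
  exact ⟨ν, mul_comm _ _⟩

lemma even_and_even_of_derivative_rel {n ν b bx bw w wx wy T x y : ℤ} (hn : Even n) (hn0 : n ≠ 0)
    (hν : Odd ν) (h : ν * b ^ 2 = n ^ 2 * w) (hx : 2 * ν * b * bx = n ^ 2 * wx + n * T * x)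
    (hy : 2 * ν * b * bw = n ^ 2 * wy + n * T * y) (hT : Odd T) : Even x ∧ Even y := by
  obtain ⟨k, n', hn', rfl⟩ : ∃ (k : ℕ) (n' : ℤ), ¬ 2 ∣ n' ∧ n = 2 ^ k * n' := by
    obtain ⟨n', h1, h2⟩ := (Int.finiteMultiplicity_iff.2 ⟨by norm_num, hn0⟩ :
      FiniteMultiplicity (2 : ℤ) n).exists_eq_pow_mul_and_not_dvd
    exact ⟨_, n', h2, h1⟩
  have hno : Odd n' := by rwa [← Int.not_even_iff_odd, even_iff_two_dvd]
  have hk : k ≠ 0 := by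
    rintro rfl
    rw [pow_zero, one_mul] at hn
    exact (Int.not_even_iff_odd.2 hno) hn
  obtain ⟨j, rfl⟩ := Nat.exists_eq_succ_of_ne_zero hk
  have hb : (2 : ℤ) ^ (j + 1) ∣ b := by
    rw [← Int.pow_dvd_pow_iff two_ne_zero]
    have hco : IsCoprime (((2 : ℤ) ^ (j + 1)) ^ 2) ν := by
      refine IsCoprime.pow_left (IsCoprime.pow_left ?_)
      obtain ⟨r, rfl⟩ := hν
      exact ⟨-r, 1, by ring⟩
    refine hco.dvd_of_dvd_mul_left ?_
    rw [h]
    exact ⟨n' ^ 2 * w, by rw [Nat.succ_eq_add_one]; ring⟩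
  obtain ⟨β, rfl⟩ := hb
  have hp : (2 : ℤ) ^ (j + 1) ≠ 0 := by positivity
  have key : ∀ bx wx x : ℤ, 2 * ν * (2 ^ (j + 1) * β) * bx =
      (2 ^ (j + 1) * n') ^ 2 * wx + 2 ^ (j + 1) * n' * T * x → Even x := by
    intro bx wx x hx
    have h1 : n' * T * x = 2 * (ν * β * bx - 2 ^ j * n' ^ 2 * wx) := by
      refine mul_left_cancel₀ hp ?_
      rw [pow_succ] at hx ⊢
      linear_combination -hx
    have h2 : Even (n' * T * x) := by rw [h1]; exact even_two_mul _
    rcases Int.even_mul.1 h2 with h3 | h3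
    · exact absurd h3 (Int.not_even_iff_odd.2 (hno.mul hT))
    · exact h3
  exact ⟨key _ _ _ hx, key _ _ _ hy⟩

lemma odd_cubic_eval {x y : ℤ} (h : ¬ (Even x ∧ Even y)) :
    Odd (y ^ 3 + 4 * x * y ^ 2 + 3 * x ^ 2 * y - x ^ 3) := by
  rw [← Int.not_even_iff_odd]
  have h4 : Even (4 : ℤ) := by decide
  have h3 : ¬ Even (3 : ℤ) := by decide
  simp only [Int.even_sub, Int.even_add, Int.even_mul, Int.even_pow, h4, h3] 
  tauto

lemma coeff_relation {P : ℤ[X]} (h : P.natDegree ≤ 3) :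
    P = C (P.coeff 0) + C (P.coeff 1) * X + C (P.coeff 2) * X ^ 2 + C (P.coeff 3) * X ^ 3 := by
  conv_lhs => rw [P.as_sum_range_C_mul_X_pow' (Nat.lt_succ_of_le h)]
  simp [Finset.sum_range_succ]

lemma eq_zero_of_quartic_eq_zero {a b c d e : ℤ}
    (h : C a + C b * X + C c * X ^ 2 + C d * X ^ 3 + C e * X ^ 4 = (0 : ℤ[X])) :
    a = 0 ∧ b = 0 ∧ c = 0 ∧ d = 0 ∧ e = 0 := by
  have h' : ∀ i, _ := fun i => congrArg (fun p => coeff p i) h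
  simp only [coeff_add, coeff_C_mul, coeff_X_pow, coeff_X, coeff_C, coeff_zero] at h'
  exact ⟨by simpa using h' 0, by simpa using h' 1, by simpa using h' 2, by simpa using h' 3,
    by simpa using h' 4⟩

lemma even_and_even_of_quartic_eq {n ν m u0 u1 u2 w0 w1 w2 w3 w4 z0 z1 z2 z3 l0 l1 b0 b1 b2 : ℤ}
    (hn : Even n) (hn0 : n ≠ 0) (hν : Odd ν) (hm : Odd m)
    (h : C (n ^ 2) * (C w0 + C w1 * X + C w2 * X ^ 2 + C w3 * X ^ 3 + C w4 * X ^ 4) +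
      C n * (2 * (C z0 + C z1 * X + C z2 * X ^ 2 + C z3 * X ^ 3) + C m * cubicForm) *
        (C l1 * X + C l0) + (C u2 * X ^ 2 + C u1 * X + C u0) * (C l1 * X + C l0) ^ 2 =
      C ν * (C b2 * X ^ 2 + C b1 * X + C b0) ^ 2) : Even l0 ∧ Even l1 := by
  by_contra hne
  have h' : C (n ^ 2 * w0 + n * (2 * z0 + m) * l0 + u0 * l0 ^ 2 - ν * b0 ^ 2) +
      C (n ^ 2 * w1 + n * ((2 * z0 + m) * l1 + (2 * z1 + 4 * m) * l0) +
        (u1 * l0 ^ 2 + 2 * u0 * l0 * l1) - 2 * ν * b0 * b1) * X +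
      C (n ^ 2 * w2 + n * ((2 * z1 + 4 * m) * l1 + (2 * z2 + 3 * m) * l0) +
        (u2 * l0 ^ 2 + 2 * u1 * l0 * l1 + u0 * l1 ^ 2) - ν * (b1 ^ 2 + 2 * b0 * b2)) * X ^ 2 +
      C (n ^ 2 * w3 + n * ((2 * z2 + 3 * m) * l1 + (2 * z3 - m) * l0) +
        (2 * u2 * l0 * l1 + u1 * l1 ^ 2) - 2 * ν * b1 * b2) * X ^ 3 +
      C (n ^ 2 * w4 + n * (2 * z3 - m) * l1 + u2 * l1 ^ 2 - ν * b2 ^ 2) * X ^ 4 = (0 : ℤ[X]) := by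
    rw [cubicForm] at h
    simp only [C_add, C_sub, C_mul, C_pow, C_ofNat] at h ⊢
    linear_combination h
  obtain ⟨e0, e1, e2, e3, e4⟩ := eq_zero_of_quartic_eq_zero h'
  have hT := odd_cubic_eval (x := -l0) (y := l1) (by simpa using hne)
  have := even_and_even_of_derivative_rel (n := n) (ν := ν)
    (b := b0 * l1 ^ 2 + b1 * (-l0) * l1 + b2 * (-l0) ^ 2)
    (bx := b1 * l1 + 2 * b2 * (-l0)) (bw := 2 * b0 * l1 + b1 * (-l0))
    (w := w0 * l1 ^ 4 + w1 * (-l0) * l1 ^ 3 + w2 * (-l0) ^ 2 * l1 ^ 2 + w3 * (-l0) ^ 3 * l1 +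
      w4 * (-l0) ^ 4)
    (wx := w1 * l1 ^ 3 + 2 * w2 * (-l0) * l1 ^ 2 + 3 * w3 * (-l0) ^ 2 * l1 + 4 * w4 * (-l0) ^ 3)
    (wy := 4 * w0 * l1 ^ 3 + 3 * w1 * (-l0) * l1 ^ 2 + 2 * w2 * (-l0) ^ 2 * l1 + w3 * (-l0) ^ 3)
    (T := 2 * (z0 * l1 ^ 3 + z1 * (-l0) * l1 ^ 2 + z2 * (-l0) ^ 2 * l1 + z3 * (-l0) ^ 3) +
      m * (l1 ^ 3 + 4 * (-l0) * l1 ^ 2 + 3 * (-l0) ^ 2 * l1 - (-l0) ^ 3)) (x := l1) (y := l0)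
    hn hn0 hν
    (by linear_combination -(e0 * l1 ^ 4 + e1 * (-l0) * l1 ^ 3 + e2 * (-l0) ^ 2 * l1 ^ 2 +
      e3 * (-l0) ^ 3 * l1 + e4 * (-l0) ^ 4))
    (by linear_combination -(e1 * l1 ^ 3 + 2 * e2 * (-l0) * l1 ^ 2 + 3 * e3 * (-l0) ^ 2 * l1 +
      4 * e4 * (-l0) ^ 3))
    (by linear_combination -(4 * e0 * l1 ^ 3 + 3 * e1 * (-l0) * l1 ^ 2 + 2 * e2 * (-l0) ^ 2 * l1 +
      e3 * (-l0) ^ 3))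
    ((even_two_mul _).add_odd (hm.mul hT))
  exact hne this.symm

lemma sq_ne_mul_sq {d : ℤ} (hd : d = 17 ∨ d = 33) {a b : ℤ} (hb : b ≠ 0) : a ^ 2 ≠ d * b ^ 2 := by
  intro h
  have hdvd : b ∣ a := by
    rw [← Int.pow_dvd_pow_iff two_ne_zero, h]
    exact dvd_mul_left _ _
  obtain ⟨e, rfl⟩ := hdvd
  have he : e ^ 2 = d := by
    have : b ^ 2 * (e ^ 2 - d) = 0 := by linear_combination h
    rcases mul_eq_zero.1 this with h0 | h0
    · exact absurd (pow_eq_zero_iff two_ne_zero |>.1 h0) hb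
    · linarith
  have h6 : e ≤ 6 := by rcases hd with rfl | rfl <;> nlinarith
  have h7 : -6 ≤ e := by rcases hd with rfl | rfl <;> nlinarith
  rcases hd with rfl | rfl <;> interval_cases e <;> omega

lemma coeff_two_ne_zero {c : ℤ} (hc : c = 1 ∨ c = 2) {M ν : ℤ} {z U B : ℤ[X]} (hMo : Odd M)
    (hZd : z.natDegree ≤ 3) (hU : U.natDegree ≤ 2) (hBd : B.natDegree ≤ 2)
    (h : z ^ 2 + C M * cubicForm * z - C (c * M ^ 2) * cuspForm ^ 2 = C ν * U * B ^ 2) :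
    B.coeff 2 ≠ 0 := by
  intro hb2
  have hh := natDegree_cubicForm_le
  have hq := natDegree_cuspForm_le
  have hM0 : M ≠ 0 := by intro h0; rw [h0] at hMo; simp at hMo
  have hc6 := congrArg (fun p => coeff p 6) h
  have e1 : (z ^ 2).coeff 6 = z.coeff 3 ^ 2 := by
    simpa using coeff_pow_of_natDegree_le (m := 2) hZd
  have e2 : (cuspForm ^ 2).coeff 6 = cuspForm.coeff 3 ^ 2 := by
    simpa using coeff_pow_of_natDegree_le (m := 2) hq
  have e3 : (cubicForm * z).coeff 6 = cubicForm.coeff 3 * z.coeff 3 :=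
    coeff_mul_add_eq_of_natDegree_le (df := 3) (dg := 3) hh hZd
  have e4 : (U * B ^ 2).coeff 6 = U.coeff 2 * (B ^ 2).coeff 4 := by
    have h4 : (B ^ 2).natDegree ≤ 4 := natDegree_pow_le.trans (by omega)
    exact coeff_mul_add_eq_of_natDegree_le (df := 2) (dg := 4) hU h4
  have e5 : (B ^ 2).coeff 4 = B.coeff 2 ^ 2 := by
    simpa using coeff_pow_of_natDegree_le (m := 2) hBd
  simp only [coeff_sub, coeff_add, mul_assoc, coeff_C_mul, e1, e2, e3, e4, e5, hb2] at hc6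
  have e6 : cuspForm.coeff 3 = 2 := by simp [cuspForm, coeff_X, coeff_ofNat_mul]
  have e7 : cubicForm.coeff 3 = -1 := by
    simp [cubicForm, coeff_X, coeff_one, coeff_ofNat_mul]
  rw [e6, e7] at hc6
  refine sq_ne_mul_sq (d := 1 + 16 * c) (a := 2 * z.coeff 3 - M) (b := M) ?_ hM0 ?_
  · rcases hc with rfl | rfl <;> norm_num
  · linear_combination 4 * hc6

theorem IsHalvable.exists_half {c : ℤ} (hc : c = 1 ∨ c = 2) {U : ℤ[X]} (h : IsHalvable c U) :
    ∃ (B Z : ℤ[X]) (m ν : ℤ), IsHalvable c B ∧ Odd m ∧ Z.natDegree ≤ 3 ∧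
      Z ^ 2 + C m * cubicForm * Z - C (c * m ^ 2) * cuspForm ^ 2 = C ν * U * B ^ 2 := by
  obtain ⟨hU, hU2, m, Z, W, hm, hZ, hZW⟩ := h
  have hm0 : m ≠ 0 := by rintro rfl; simp at hm
  have hh := natDegree_cubicForm_le
  have hq := natDegree_cuspForm_le
  have hU0 : U ≠ 0 := hU.ne_zero
  have hinj : Function.Injective (algebraMap ℤ ℚ) := (algebraMap ℤ ℚ).injective_int
  have hdeg : ∀ (m : ℤ) (Z : ℤ[X]), Z.natDegree ≤ 3 →
      (Z ^ 2 + C m * cubicForm * Z - C (c * m ^ 2) * cuspForm ^ 2).natDegree ≤ 6 := by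
    intro m Z hZ
    refine (natDegree_sub_le _ _).trans (max_le ((natDegree_add_le _ _).trans (max_le ?_ ?_)) ?_)
    · exact natDegree_pow_le.trans (by omega)
    · refine natDegree_mul_le.trans ?_
      have := natDegree_C_mul_le m cubicForm
      omega
    · exact (natDegree_C_mul_le _ _).trans (natDegree_pow_le.trans (by omega))
  have hW4 : W.natDegree ≤ 4 := by
    by_cases hW : W = 0
    · simp [hW]
    have h1 : (U * W).natDegree = 2 + W.natDegree := by rw [natDegree_mul hU0 hW, hU2]
    have h2 := hdeg m Z hZ
    rw [hZW] at h2
    omega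
  obtain ⟨k, ℓ, B', hk, hB'0, hℓ, hB'2, hrel⟩ := exists_rational_halving c hc m U
    (C m * cubicForm + 2 * Z) (4 * W) hm0 hU hU2
    ((natDegree_add_le _ _).trans (max_le ((natDegree_C_mul_le _ _).trans hh)
      ((natDegree_C_mul_le (2 : ℤ) _).trans hZ)))
    (by rw [sexticForm]; simp only [C_mul, C_pow, C_ofNat] at hZW ⊢; linear_combination 4 * hZW)
  obtain ⟨n, L, hn, hL, hLeven⟩ := exists_C_mul_eq_map_of_even (C ((m : ℚ) / 2) * ℓ)
  obtain ⟨b, B, hb, hB, rfl⟩ := exists_isPrimitive_eq_C_mul_map B' hB'0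
  have hLd : L.natDegree ≤ 1 := by
    rw [← natDegree_map_eq_of_injective hinj, ← hL]
    exact (natDegree_C_mul_le _ _).trans ((natDegree_C_mul_le _ _).trans hℓ)
  have hBd : B.natDegree ≤ 2 := by
    rwa [natDegree_C_mul hb, natDegree_map_eq_of_injective hinj] at hB'2
  obtain ⟨ν, hν⟩ : ∃ ν : ℤ, C ((n : ℤ) ^ 2) * W + C (n : ℤ) * (2 * Z + C m * cubicForm) * L + U * L ^ 2
      = C ν * B ^ 2 := by
    refine exists_intCast_of_map_eq_C_mul (κ := n ^ 2 * m ^ 2 * k * b ^ 2 / 4)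
      (by rw [sq]; exact hB.mul hB) ?_
    have hmi : C (m : ℚ) * C (m : ℚ)⁻¹ = 1 := by
      rw [← C_mul, mul_inv_cancel₀ (by exact_mod_cast hm0), C_1]
    have hL' : C (n : ℚ) * C (m : ℚ) * ℓ = 2 * L.map (algebraMap ℤ ℚ) := by
      rw [← hL, show (2 : ℚ[X]) = C 2 from rfl, ← mul_assoc, ← mul_assoc, ← C_mul, ← C_mul, ← C_mul]
      congr 2
      ring
    have hc4 : C (4 : ℚ) * C ((n : ℚ) ^ 2 * m ^ 2 * k * b ^ 2 / 4) =
        C (n : ℚ) ^ 2 * C (m : ℚ) ^ 2 * C k * C b ^ 2 := by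
      simp only [← C_mul, ← C_pow]
      congr 1
      ring
    have hUm : U.map (algebraMap ℤ ℚ) ≠ 0 := (Polynomial.map_ne_zero_iff hinj).2 hU0
    have hE := congrArg (map (algebraMap ℤ ℚ)) hZW
    have h_int : ∀ a : ℤ, algebraMap ℤ ℚ a = (a : ℚ) := fun a => by simp
    have h4 : C (4 : ℚ) * U.map (algebraMap ℤ ℚ) ≠ 0 := mul_ne_zero (by simp) hUm
    refine mul_left_cancel₀ h4 ?_
    simp only [sexticForm, Polynomial.map_add, Polynomial.map_sub, Polynomial.map_mul,
      Polynomial.map_pow, map_C, C_mul, C_pow, map_mul, map_pow, h_int, Polynomial.map_ofNat] at hE hrel ⊢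
    rw [show (C (4 : ℚ) * U.map (algebraMap ℤ ℚ)) * (C ((n : ℚ) ^ 2 * m ^ 2 * k * b ^ 2 / 4) *
      B.map (algebraMap ℤ ℚ) ^ 2) = (C (4 : ℚ) * C ((n : ℚ) ^ 2 * m ^ 2 * k * b ^ 2 / 4)) *
        U.map (algebraMap ℤ ℚ) * B.map (algebraMap ℤ ℚ) ^ 2 by ring, hc4]
    push_cast at hE hrel ⊢
    simp only [C_ofNat] at hE hrel ⊢
    linear_combination C (n : ℚ) ^ 2 * C (m : ℚ) ^ 2 * hrel - C (n : ℚ) ^ 2 *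
      (C (m : ℚ) * cubicForm.map (algebraMap ℤ ℚ) + 2 * Z.map (algebraMap ℤ ℚ)) *
      ((C (m : ℚ) * C (m : ℚ)⁻¹ + 1) *
        (C (m : ℚ) * cubicForm.map (algebraMap ℤ ℚ) + 2 * Z.map (algebraMap ℤ ℚ)) +
        2 * C (m : ℚ) * U.map (algebraMap ℤ ℚ) * ℓ) * hmi - 4 * C (n : ℚ) ^ 2 * hE -
      (2 * U.map (algebraMap ℤ ℚ) * C (n : ℚ) *
        (C (m : ℚ) * cubicForm.map (algebraMap ℤ ℚ) + 2 * Z.map (algebraMap ℤ ℚ)) +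
      U.map (algebraMap ℤ ℚ) ^ 2 * (C (n : ℚ) * C (m : ℚ) * ℓ + 2 * L.map (algebraMap ℤ ℚ))) * hL'
  have hLe : L = C (L.coeff 1) * X + C (L.coeff 0) := eq_X_add_C_of_natDegree_le_one hLd
  have hnodd : Odd (n : ℤ) := by
    by_contra hne
    rw [Int.not_odd_iff_even] at hne
    have hL2 := hLeven (by exact_mod_cast hne)
    obtain ⟨n', hn'⟩ := even_iff_two_dvd.1 hne
    have hνodd : Odd ν := by
      by_contra hν2
      rw [Int.not_odd_iff_even] at hν2
      obtain ⟨ν', rfl⟩ := even_iff_two_dvd.1 hν2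
      have h2 : C (2 : ℤ) ∣ U * L ^ 2 := by
        refine ⟨C ν' * B ^ 2 - C (2 * n' ^ 2) * W - C n' * (2 * Z + C m * cubicForm) * L, ?_⟩
        rw [hn'] at hν
        simp only [C_mul, C_pow, C_ofNat] at hν ⊢
        linear_combination hν
      have hp : Prime (C (2 : ℤ)) := prime_C_iff.2 Int.prime_two
      rcases hp.dvd_or_dvd h2 with h3 | h3
      · have := hU 2 h3
        norm_num [Int.isUnit_iff] at this
      · exact hL2 (hp.dvd_of_dvd_pow h3)
    have hW : W = C (W.coeff 0) + C (W.coeff 1) * X + C (W.coeff 2) * X ^ 2 +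
        C (W.coeff 3) * X ^ 3 + C (W.coeff 4) * X ^ 4 := by
      conv_lhs => rw [W.as_sum_range_C_mul_X_pow' (Nat.lt_succ_of_le hW4)]
      simp [Finset.sum_range_succ]
    rw [hW, coeff_relation hZ, eq_quadratic_of_natDegree_le hU2.le,
      eq_quadratic_of_natDegree_le hBd, hLe] at hν
    obtain ⟨⟨r, hr⟩, ⟨s, hs⟩⟩ :=
      even_and_even_of_quartic_eq hne (by exact_mod_cast hn) hνodd hm hν
    refine hL2 ⟨C s * X + C r, ?_⟩
    rw [hLe, hr, hs]
    simp only [C_add, C_ofNat]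
    ring
  have hfin : (C (n : ℤ) * Z + U * L) ^ 2 + C (n * m) * cubicForm * (C (n : ℤ) * Z + U * L) -
      C (c * (n * m) ^ 2) * cuspForm ^ 2 = C ν * U * B ^ 2 := by
    simp only [C_mul, C_pow] at hν hZW ⊢
    linear_combination U * hν + C (n : ℤ) ^ 2 * hZW
  have hZd : (C (n : ℤ) * Z + U * L).natDegree ≤ 3 := by
    refine (natDegree_add_le _ _).trans (max_le ((natDegree_C_mul_le _ _).trans hZ) ?_)
    exact natDegree_mul_le.trans (by omega)
  have hMo : Odd ((n : ℤ) * m) := hnodd.mul hm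
  refine ⟨B, _, n * m, ν, ⟨hB, ?_, n * m, _, C ν * U * B, hMo, hZd, ?_⟩, hMo, hZd, hfin⟩
  · exact natDegree_eq_of_le_of_coeff_ne_zero hBd (coeff_two_ne_zero hc hMo hZd hU2.le hBd hfin)
  · rw [hfin]; ring

/-- The relation `eZ² + mhZ - cm²q² = κUB²` between the coefficients of `U`, `B` and `Z`. -/
def SexticRel {R : Type*} [CommRing R] (e c m κ u0 u1 u2 b0 b1 b2 z0 z1 z2 z3 : R) : Prop :=
  e * z0 ^ 2 + m * z0 = κ * (u0 * b0 ^ 2) ∧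
  e * (2 * z0 * z1) + m * (z1 + 4 * z0) = κ * (u0 * (2 * b0 * b1) + u1 * b0 ^ 2) ∧
  e * (z1 ^ 2 + 2 * z0 * z2) + m * (z2 + 4 * z1 + 3 * z0) - c * m ^ 2 =
    κ * (u0 * (b1 ^ 2 + 2 * b0 * b2) + u1 * (2 * b0 * b1) + u2 * b0 ^ 2) ∧
  e * (2 * z0 * z3 + 2 * z1 * z2) + m * (z3 + 4 * z2 + 3 * z1 - z0) - 6 * c * m ^ 2 =
    κ * (u0 * (2 * b1 * b2) + u1 * (b1 ^ 2 + 2 * b0 * b2) + u2 * (2 * b0 * b1)) ∧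
  e * (z2 ^ 2 + 2 * z1 * z3) + m * (4 * z3 + 3 * z2 - z1) - 13 * c * m ^ 2 =
    κ * (u0 * b2 ^ 2 + u1 * (2 * b1 * b2) + u2 * (b1 ^ 2 + 2 * b0 * b2)) ∧
  e * (2 * z2 * z3) + m * (3 * z3 - z2) - 12 * c * m ^ 2 =
    κ * (u1 * b2 ^ 2 + u2 * (2 * b1 * b2)) ∧
  e * z3 ^ 2 - m * z3 - 4 * c * m ^ 2 = κ * (u2 * b2 ^ 2)

instance {R : Type*} [CommRing R] [DecidableEq R] (e c m κ u0 u1 u2 b0 b1 b2 z0 z1 z2 z3 : R) :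
    Decidable (SexticRel e c m κ u0 u1 u2 b0 b1 b2 z0 z1 z2 z3) := by
  unfold SexticRel; infer_instance

/-- The polynomial with coefficients `u0, u1, u2`. -/
noncomputable def quadPoly (u : ℤ × ℤ × ℤ) : ℤ[X] := C u.1 + C u.2.1 * X + C u.2.2 * X ^ 2

/-- The polynomial with coefficients `z0, z1, z2, z3`. -/
noncomputable def cubicPoly (z : ℤ × ℤ × ℤ × ℤ) : ℤ[X] :=
  C z.1 + C z.2.1 * X + C z.2.2.1 * X ^ 2 + C z.2.2.2 * X ^ 3

lemma eq_zero_of_sextic_eq_zero {R : Type*} [CommRing R] {a b c d e f g : R}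
    (h : C a + C b * X + C c * X ^ 2 + C d * X ^ 3 + C e * X ^ 4 + C f * X ^ 5 + C g * X ^ 6 =
      (0 : R[X])) :
    a = 0 ∧ b = 0 ∧ c = 0 ∧ d = 0 ∧ e = 0 ∧ f = 0 ∧ g = 0 := by
  have h' : ∀ i, _ := fun i => congrArg (fun p => coeff p i) h
  simp only [coeff_add, coeff_C_mul, coeff_X_pow, coeff_X, coeff_C, coeff_zero] at h'
  exact ⟨by simpa using h' 0, by simpa using h' 1, by simpa using h' 2, by simpa using h' 3,
    by simpa using h' 4, by simpa using h' 5, by simpa using h' 6⟩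

lemma sexticRel_iff (e c m κ : ℤ) (u b : ℤ × ℤ × ℤ) (z : ℤ × ℤ × ℤ × ℤ) :
    SexticRel e c m κ u.1 u.2.1 u.2.2 b.1 b.2.1 b.2.2 z.1 z.2.1 z.2.2.1 z.2.2.2 ↔
      C e * cubicPoly z ^ 2 + C m * cubicForm * cubicPoly z - C (c * m ^ 2) * cuspForm ^ 2 =
        C κ * quadPoly u * quadPoly b ^ 2 := by
  obtain ⟨u0, u1, u2⟩ := u
  obtain ⟨b0, b1, b2⟩ := b
  obtain ⟨z0, z1, z2, z3⟩ := z
  simp only [SexticRel, quadPoly, cubicPoly, cubicForm, cuspForm]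
  constructor
  · rintro ⟨e0, e1, e2, e3, e4, e5, e6⟩
    have E0 := congrArg (C : ℤ → ℤ[X]) e0
    have E1 := congrArg (C : ℤ → ℤ[X]) e1
    have E2 := congrArg (C : ℤ → ℤ[X]) e2
    have E3 := congrArg (C : ℤ → ℤ[X]) e3
    have E4 := congrArg (C : ℤ → ℤ[X]) e4
    have E5 := congrArg (C : ℤ → ℤ[X]) e5
    have E6 := congrArg (C : ℤ → ℤ[X]) e6
    simp only [C_add, C_sub, C_mul, C_pow, C_ofNat] at E0 E1 E2 E3 E4 E5 E6 ⊢
    linear_combination E0 + E1 * X + E2 * X ^ 2 + E3 * X ^ 3 + E4 * X ^ 4 + E5 * X ^ 5 + E6 * X ^ 6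
  · intro h
    have h' : C (e * z0 ^ 2 + m * z0 - κ * (u0 * b0 ^ 2)) +
      C (e * (2 * z0 * z1) + m * (z1 + 4 * z0) - κ * (u0 * (2 * b0 * b1) + u1 * b0 ^ 2)) * X +
      C (e * (z1 ^ 2 + 2 * z0 * z2) + m * (z2 + 4 * z1 + 3 * z0) - c * m ^ 2 -
        κ * (u0 * (b1 ^ 2 + 2 * b0 * b2) + u1 * (2 * b0 * b1) + u2 * b0 ^ 2)) * X ^ 2 +
      C (e * (2 * z0 * z3 + 2 * z1 * z2) + m * (z3 + 4 * z2 + 3 * z1 - z0) - 6 * c * m ^ 2 -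
        κ * (u0 * (2 * b1 * b2) + u1 * (b1 ^ 2 + 2 * b0 * b2) + u2 * (2 * b0 * b1))) * X ^ 3 +
      C (e * (z2 ^ 2 + 2 * z1 * z3) + m * (4 * z3 + 3 * z2 - z1) - 13 * c * m ^ 2 -
        κ * (u0 * b2 ^ 2 + u1 * (2 * b1 * b2) + u2 * (b1 ^ 2 + 2 * b0 * b2))) * X ^ 4 +
      C (e * (2 * z2 * z3) + m * (3 * z3 - z2) - 12 * c * m ^ 2 -
        κ * (u1 * b2 ^ 2 + u2 * (2 * b1 * b2))) * X ^ 5 +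
      C (e * z3 ^ 2 - m * z3 - 4 * c * m ^ 2 - κ * (u2 * b2 ^ 2)) * X ^ 6 = (0 : ℤ[X]) := by
      simp only [C_add, C_sub, C_mul, C_pow, C_ofNat] at h ⊢
      linear_combination h
    obtain ⟨e0, e1, e2, e3, e4, e5, e6⟩ := eq_zero_of_sextic_eq_zero h'
    exact ⟨sub_eq_zero.1 e0, sub_eq_zero.1 e1, sub_eq_zero.1 e2, sub_eq_zero.1 e3,
      sub_eq_zero.1 e4, sub_eq_zero.1 e5, sub_eq_zero.1 e6⟩

lemma SexticRel.intCast {R : Type*} [CommRing R] {e c m κ u0 u1 u2 b0 b1 b2 z0 z1 z2 z3 : ℤ}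
    (h : SexticRel e c m κ u0 u1 u2 b0 b1 b2 z0 z1 z2 z3) :
    SexticRel (e : R) c m κ u0 u1 u2 b0 b1 b2 z0 z1 z2 z3 := by
  obtain ⟨e0, e1, e2, e3, e4, e5, e6⟩ := h
  refine ⟨?_, ?_, ?_, ?_, ?_, ?_, ?_⟩
  · exact_mod_cast congrArg (Int.cast : ℤ → R) e0
  · exact_mod_cast congrArg (Int.cast : ℤ → R) e1
  · exact_mod_cast congrArg (Int.cast : ℤ → R) e2
  · exact_mod_cast congrArg (Int.cast : ℤ → R) e3
  · exact_mod_cast congrArg (Int.cast : ℤ → R) e4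
  · exact_mod_cast congrArg (Int.cast : ℤ → R) e5
  · exact_mod_cast congrArg (Int.cast : ℤ → R) e6

/-- The products of two of the three linear factors of the cusp form, up to sign. -/
def cusps : List (ℤ × ℤ × ℤ) :=
  [(0, 0, 1), (1, 2, 1), (1, 4, 4), (0, 1, 1), (0, 1, 2), (1, 3, 2)]

lemma eq_of_mem_cusps : ∀ p ∈ cusps, ∀ p' ∈ cusps, (2 ∣ p.1 - p'.1 ∧ 2 ∣ p.2.1 - p'.2.1 ∧
    2 ∣ p.2.2 - p'.2.2) → p = p' := by decide

/-- The solutions `(U, B, Z, κ)` of `eZ² + hZ - cq² = κUB²` supported at the cusps. -/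
def cuspRelations (e c : ℤ) : List ((ℤ × ℤ × ℤ) × (ℤ × ℤ × ℤ) × (ℤ × ℤ × ℤ × ℤ) × ℤ) :=
  if e = 2 then
    [((0, 0, 1), (1, 3, 2), (0, 0, 0, 0), -1), ((0, 1, 2), (0, 0, 1), (0, 0, 1, 2), 1),
     ((0, 1, 1), (1, 2, 1), (0, -1, -2, -1), -1), ((1, 4, 4), (0, 1, 1), (0, 0, 0, 0), -1),
     ((1, 2, 1), (0, 1, 2), (0, 0, 0, 0), -1), ((1, 3, 2), (1, 4, 4), (-1, -5, -8, -4), 1)]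
  else if c = 2 then
    [((0, 1, 2), (0, 1, 1), (0, 0, 2, 3), -1), ((0, 1, 2), (0, 1, 1), (-1, -4, -5, -2), -1),
     ((0, 1, 1), (1, 3, 2), (0, 1, 4, 4), 1), ((0, 1, 1), (1, 3, 2), (-1, -5, -7, -3), 1),
     ((1, 3, 2), (0, 1, 2), (0, 0, 1, 1), -1), ((1, 3, 2), (0, 1, 2), (-1, -4, -4, 0), -1)]
  else
    [((0, 0, 1), (1, 3, 2), (0, 0, 0, 0), -1), ((0, 0, 1), (1, 3, 2), (-1, -4, -3, 1), -1),
     ((0, 1, 2), (1, 2, 1), (0, -1, -2, -1), -1), ((0, 1, 2), (1, 2, 1), (-1, -3, -1, 2), -1),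
     ((0, 1, 2), (1, 3, 2), (0, 1, 4, 4), 1), ((0, 1, 2), (1, 3, 2), (-1, -5, -7, -3), 1),
     ((0, 1, 1), (0, 1, 2), (0, 0, 1, 1), -1), ((0, 1, 1), (0, 1, 2), (-1, -4, -4, 0), -1),
     ((0, 1, 1), (1, 4, 4), (0, 1, 5, 5), 1), ((0, 1, 1), (1, 4, 4), (-1, -5, -8, -4), 1),
     ((1, 4, 4), (0, 1, 1), (0, 0, 0, 0), -1), ((1, 4, 4), (0, 1, 1), (-1, -4, -3, 1), -1),
     ((1, 2, 1), (0, 1, 2), (0, 0, 0, 0), -1), ((1, 2, 1), (0, 1, 2), (-1, -4, -3, 1), -1),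
     ((1, 3, 2), (0, 0, 1), (0, 0, 1, 2), -1), ((1, 3, 2), (0, 0, 1), (-1, -4, -4, -1), -1),
     ((1, 3, 2), (0, 1, 1), (0, 0, 2, 3), 1), ((1, 3, 2), (0, 1, 1), (-1, -4, -5, -2), 1)]

lemma cuspRelations_spec : ∀ t ∈ [((1 : ℤ), (1 : ℤ)), (1, 2), (2, 1)], ∀ r ∈ cuspRelations t.1 t.2,
    r.1 ∈ cusps ∧ r.2.1 ∈ cusps ∧ SexticRel t.1 t.2 1 r.2.2.2 r.1.1 r.1.2.1 r.1.2.2 r.2.1.1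
      r.2.1.2.1 r.2.1.2.2 r.2.2.1.1 r.2.2.1.2.1 r.2.2.1.2.2.1 r.2.2.1.2.2.2 := by
  decide +kernel

/-- The reductions of `r` modulo 2 are the given polynomials. -/
def ReducesTo (r : (ℤ × ℤ × ℤ) × (ℤ × ℤ × ℤ) × (ℤ × ℤ × ℤ × ℤ) × ℤ)
    (u0 u1 u2 b0 b1 b2 z0 z1 z2 z3 : ZMod 2) : Prop :=
  ((r.1.1 : ZMod 2) = u0 ∧ (r.1.2.1 : ZMod 2) = u1 ∧ (r.1.2.2 : ZMod 2) = u2) ∧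
    ((r.2.1.1 : ZMod 2) = b0 ∧ (r.2.1.2.1 : ZMod 2) = b1 ∧ (r.2.1.2.2 : ZMod 2) = b2) ∧
    ((r.2.2.1.1 : ZMod 2) = z0 ∧ (r.2.2.1.2.1 : ZMod 2) = z1 ∧
      (r.2.2.1.2.2.1 : ZMod 2) = z2 ∧ (r.2.2.1.2.2.2 : ZMod 2) = z3)

instance (r : (ℤ × ℤ × ℤ) × (ℤ × ℤ × ℤ) × (ℤ × ℤ × ℤ × ℤ) × ℤ)
    (u0 u1 u2 b0 b1 b2 z0 z1 z2 z3 : ZMod 2) :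
    Decidable (ReducesTo r u0 u1 u2 b0 b1 b2 z0 z1 z2 z3) := by
  unfold ReducesTo; infer_instance

set_option synthInstance.maxHeartbeats 200000 in
set_option synthInstance.maxSize 1024 in
lemma exists_cuspRelation_mod_two : ∀ t ∈ [((1 : ℤ), (1 : ℤ)), (1, 2), (2, 1)],
    ∀ u0 u1 u2 b0 b1 b2 : ZMod 2, ¬ (u0 = 0 ∧ u1 = 0 ∧ u2 = 0) → ¬ (b0 = 0 ∧ b1 = 0 ∧ b2 = 0) →
    (t.1 = 1 ∨ ¬ (u0 = 1 ∧ u1 = 1 ∧ u2 = 1)) → ∀ z0 z1 z2 z3 : ZMod 2,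
    SexticRel (t.1 : ZMod 2) t.2 1 1 u0 u1 u2 b0 b1 b2 z0 z1 z2 z3 →
    ∃ r ∈ cuspRelations t.1 t.2, ReducesTo r u0 u1 u2 b0 b1 b2 z0 z1 z2 z3 := by
  decide +kernel

lemma not_sexticRel_one : ∀ u0 u1 u2 b0 b1 b2 z0 z1 z2 z3 : ZMod 2,
    ¬ SexticRel 1 1 1 0 u0 u1 u2 b0 b1 b2 z0 z1 z2 z3 := by
  decide +kernel

lemma not_sexticRel_zero : ∀ u0 u1 u2 b0 b1 b2 z0 z1 z2 z3 : ZMod 2,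
    ¬ SexticRel 0 1 1 0 u0 u1 u2 b0 b1 b2 z0 z1 z2 z3 := by
  decide +kernel

lemma sexticRel_two_mod_two : ∀ u0 u1 u2 b0 b1 b2 z0 z1 z2 z3 : ZMod 2,
    SexticRel 1 0 1 0 u0 u1 u2 b0 b1 b2 z0 z1 z2 z3 →
    (z0 = 0 ∧ z1 = 0 ∧ z2 = 0 ∧ z3 = 0) ∨ (z0 = 1 ∧ z1 = 0 ∧ z2 = 1 ∧ z3 = 1) := by
  decide +kernel

lemma C_two_dvd_iff {p : ℤ[X]} : C 2 ∣ p ↔ p.map (Int.castRingHom (ZMod 2)) = 0 := by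
  rw [C_dvd_iff_dvd_coeff, Polynomial.ext_iff]
  refine forall_congr' fun i => ?_
  rw [coeff_map, coeff_zero, eq_intCast, ZMod.intCast_zmod_eq_zero_iff_dvd]
  rfl

lemma intCast_zmod_two_of_odd {a : ℤ} (ha : Odd a) : (a : ZMod 2) = 1 := by
  obtain ⟨k, rfl⟩ := ha
  have h2 : (2 : ZMod 2) = 0 := rfl
  push_cast
  rw [h2, zero_mul, zero_add]

lemma intCast_zmod_two_of_even {a : ℤ} (ha : Even a) : (a : ZMod 2) = 0 :=
  (ZMod.intCast_zmod_eq_zero_iff_dvd a 2).2 ha.two_dvd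

lemma eq_quadPoly {U : ℤ[X]} (hU : U.natDegree ≤ 2) :
    U = quadPoly (U.coeff 0, U.coeff 1, U.coeff 2) := by
  conv_lhs => rw [eq_quadratic_of_natDegree_le hU]
  simp only [quadPoly]; ring

lemma eq_cubicPoly {Z : ℤ[X]} (hZ : Z.natDegree ≤ 3) :
    Z = cubicPoly (Z.coeff 0, Z.coeff 1, Z.coeff 2, Z.coeff 3) := by
  conv_lhs => rw [coeff_relation hZ]
  simp only [cubicPoly]

lemma sexticRel_of_eq {e c m κ : ℤ} {U B Z : ℤ[X]} (hU : U.natDegree ≤ 2) (hB : B.natDegree ≤ 2)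
    (hZ : Z.natDegree ≤ 3)
    (h : C e * Z ^ 2 + C m * cubicForm * Z - C (c * m ^ 2) * cuspForm ^ 2 = C κ * U * B ^ 2) :
    SexticRel e c m κ (U.coeff 0) (U.coeff 1) (U.coeff 2) (B.coeff 0) (B.coeff 1) (B.coeff 2)
      (Z.coeff 0) (Z.coeff 1) (Z.coeff 2) (Z.coeff 3) := by
  rw [eq_quadPoly hU, eq_quadPoly hB, eq_cubicPoly hZ] at h
  exact (sexticRel_iff e c m κ _ _ _).2 h

/-- A halving relation whose right-hand side has an odd constant factor. -/
def NormalHalf (c e c' : ℤ) (U : ℤ[X]) : Prop :=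
  ∃ (B Z : ℤ[X]) (m ν : ℤ), IsHalvable c B ∧ Odd m ∧ Odd ν ∧ Z.natDegree ≤ 3 ∧
    C e * Z ^ 2 + C m * cubicForm * Z - C (c' * m ^ 2) * cuspForm ^ 2 = C ν * U * B ^ 2

lemma normalHalf_two_of_even {B Z U : ℤ[X]} {m ν : ℤ} (hU : U.natDegree ≤ 2)
    (hB : IsHalvable 2 B) (hm : Odd m)
    (hν : Even ν) (hZ : Z.natDegree ≤ 3) (hZ2 : C 2 ∣ Z)
    (h : Z ^ 2 + C m * cubicForm * Z - C (2 * m ^ 2) * cuspForm ^ 2 = C ν * U * B ^ 2) :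
    NormalHalf 2 2 1 U := by
  obtain ⟨Z, rfl⟩ := hZ2
  obtain ⟨k, rfl⟩ := hν.two_dvd
  have hZ' : Z.natDegree ≤ 3 := by rwa [natDegree_C_mul (by norm_num)] at hZ
  have key : C 2 * Z ^ 2 + C m * cubicForm * Z - C (1 * m ^ 2) * cuspForm ^ 2 = C k * U * B ^ 2 := by
    have h2 : (C 2 : ℤ[X]) ≠ 0 := C_ne_zero.2 (by norm_num)
    apply mul_left_cancel₀ h2
    simp only [C_mul, C_pow, C_1] at h ⊢
    linear_combination h
  refine ⟨B, Z, m, k, hB, hm, ?_, hZ', key⟩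
  by_contra hk
  have := (sexticRel_of_eq hU hB.2.1.le hZ' key).intCast (R := ZMod 2)
  rw [intCast_zmod_two_of_odd hm, intCast_zmod_two_of_even (Int.not_odd_iff_even.1 hk), Int.cast_one,
    intCast_zmod_two_of_even (a := 2) even_two] at this
  exact not_sexticRel_zero _ _ _ _ _ _ _ _ _ _ this

lemma C_two_dvd_of_coeff {Z : ℤ[X]} (hZ : Z.natDegree ≤ 3) (h0 : 2 ∣ Z.coeff 0)
    (h1 : 2 ∣ Z.coeff 1) (h2 : 2 ∣ Z.coeff 2) (h3 : 2 ∣ Z.coeff 3) : C 2 ∣ Z := by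
  rw [C_dvd_iff_dvd_coeff]
  intro i
  rcases lt_or_ge 3 i with hi | hi
  · rw [coeff_eq_zero_of_natDegree_lt (hZ.trans_lt hi)]; exact dvd_zero _
  · interval_cases i <;> assumption

lemma two_dvd_sub_of_intCast_eq {a b : ℤ} (h : (a : ZMod 2) = b) : 2 ∣ b - a :=
  (ZMod.intCast_eq_intCast_iff_dvd_sub a b 2).1 h

lemma cubicForm_eq_cubicPoly : cubicForm = cubicPoly (1, 4, 3, -1) := by
  simp only [cubicForm, cubicPoly, C_1, C_neg, C_ofNat]; ring

lemma coeff_cubicPoly (z : ℤ × ℤ × ℤ × ℤ) : (cubicPoly z).coeff 0 = z.1 ∧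
    (cubicPoly z).coeff 1 = z.2.1 ∧ (cubicPoly z).coeff 2 = z.2.2.1 ∧
    (cubicPoly z).coeff 3 = z.2.2.2 := by
  simp only [cubicPoly, coeff_add, coeff_C_mul, coeff_X_pow, coeff_X, coeff_C]
  simp

lemma coeff_quadPoly (z : ℤ × ℤ × ℤ) : (quadPoly z).coeff 0 = z.1 ∧
    (quadPoly z).coeff 1 = z.2.1 ∧ (quadPoly z).coeff 2 = z.2.2 := by
  simp only [quadPoly, coeff_add, coeff_C_mul, coeff_X_pow, coeff_X, coeff_C]
  simp

lemma natDegree_cubicPoly_le (z : ℤ × ℤ × ℤ × ℤ) : (cubicPoly z).natDegree ≤ 3 := by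
  unfold cubicPoly; compute_degree

lemma natDegree_quadPoly_le (z : ℤ × ℤ × ℤ) : (quadPoly z).natDegree ≤ 2 := by
  unfold quadPoly; compute_degree

lemma IsHalvable.exists_normalHalf {c : ℤ} {U : ℤ[X]} (hc : c = 1 ∨ c = 2) (h : IsHalvable c U) :
    ∃ t ∈ [((1 : ℤ), (1 : ℤ)), (1, 2), (2, 1)], (c = 1 → t.1 = 1) ∧ NormalHalf c t.1 t.2 U := by
  obtain ⟨B, Z, m, ν, hB, hm, hZ, hrel⟩ := h.exists_half hc
  have hrel' : C 1 * Z ^ 2 + C m * cubicForm * Z - C (c * m ^ 2) * cuspForm ^ 2 =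
      C ν * U * B ^ 2 := by rw [C_1, one_mul]; exact hrel
  rcases Int.even_or_odd ν with hν | hν
  · have hs := (sexticRel_of_eq h.2.1.le hB.2.1.le hZ hrel').intCast (R := ZMod 2)
    rw [intCast_zmod_two_of_odd hm, intCast_zmod_two_of_even hν, Int.cast_one] at hs
    rcases hc with rfl | rfl
    · rw [Int.cast_one] at hs
      exact absurd hs (not_sexticRel_one _ _ _ _ _ _ _ _ _ _)
    · rw [intCast_zmod_two_of_even (a := 2) even_two] at hs
      refine ⟨(2, 1), by simp, by simp, ?_⟩
      rcases sexticRel_two_mod_two _ _ _ _ _ _ _ _ _ _ hs with ⟨h0, h1, h2, h3⟩ | ⟨h0, h1, h2, h3⟩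
      · simp only [ZMod.intCast_zmod_eq_zero_iff_dvd] at h0 h1 h2 h3
        exact normalHalf_two_of_even h.2.1.le hB hm hν hZ (C_two_dvd_of_coeff hZ h0 h1 h2 h3) hrel
      · have hZd : (-(C m * cubicForm) - Z).natDegree ≤ 3 := by
          refine (natDegree_sub_le _ _).trans (max_le ?_ hZ)
          rw [natDegree_neg]
          exact (natDegree_C_mul_le _ _).trans natDegree_cubicForm_le
        obtain ⟨c0, c1, c2, c3⟩ := coeff_cubicPoly (1, 4, 3, -1)
        rw [← cubicForm_eq_cubicPoly] at c0 c1 c2 c3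
        have hm2 := hm
        obtain ⟨k, rfl⟩ := hm2
        rw [← Int.cast_one] at h0 h2 h3
        rw [← Int.cast_zero] at h1
        have h0' := two_dvd_sub_of_intCast_eq h0
        have h1' := two_dvd_sub_of_intCast_eq h1
        have h2' := two_dvd_sub_of_intCast_eq h2
        have h3' := two_dvd_sub_of_intCast_eq h3
        refine normalHalf_two_of_even h.2.1.le hB hm hν hZd (C_two_dvd_of_coeff hZd ?_ ?_ ?_ ?_)
          (by rw [← hrel]; ring)
        all_goals
          simp only [coeff_sub, coeff_neg, coeff_C_mul, c0, c1, c2, c3]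
          omega
  · refine ⟨(1, c), ?_, fun _ => rfl, B, Z, m, ν, hB, hm, hν, hZ, hrel'⟩
    rcases hc with rfl | rfl <;> simp

lemma IsPrimitive.exists_coeff_ne_zero {U : ℤ[X]} (hU : U.IsPrimitive) (hd : U.natDegree ≤ 2) :
    ¬ ((U.coeff 0 : ZMod 2) = 0 ∧ (U.coeff 1 : ZMod 2) = 0 ∧ (U.coeff 2 : ZMod 2) = 0) := by
  rintro ⟨h0, h1, h2⟩
  simp only [ZMod.intCast_zmod_eq_zero_iff_dvd] at h0 h1 h2
  have : C 2 ∣ U := by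
    refine C_two_dvd_of_coeff (hd.trans (by norm_num)) h0 h1 h2 ?_
    rw [coeff_eq_zero_of_natDegree_lt (by omega)]
    exact dvd_zero _
  have := hU 2 this
  rw [Int.isUnit_iff] at this
  omega

lemma IsHalvable.exists_cuspRelation {c : ℤ} {U : ℤ[X]} (hc : c = 1 ∨ c = 2) (h : IsHalvable c U)
    (hU : c = 1 ∨ ¬ ((U.coeff 0 : ZMod 2) = 1 ∧ (U.coeff 1 : ZMod 2) = 1 ∧
      (U.coeff 2 : ZMod 2) = 1)) :
    ∃ (e c' m ν κ : ℤ) (B Z : ℤ[X]) (u b : ℤ × ℤ × ℤ) (z : ℤ × ℤ × ℤ × ℤ), IsHalvable c B ∧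
      Odd m ∧ Odd ν ∧ Z.natDegree ≤ 3 ∧ u ∈ cusps ∧ b ∈ cusps ∧
      C e * Z ^ 2 + C m * cubicForm * Z - C (c' * m ^ 2) * cuspForm ^ 2 = C ν * U * B ^ 2 ∧
      C e * cubicPoly z ^ 2 + cubicForm * cubicPoly z - C c' * cuspForm ^ 2 =
        C κ * quadPoly u * quadPoly b ^ 2 ∧
      C 2 ∣ U - quadPoly u ∧ C 2 ∣ B - quadPoly b ∧ C 2 ∣ Z - cubicPoly z := by
  obtain ⟨t, ht, ht1, B, Z, m, ν, hB, hm, hν, hZ, hrel⟩ := h.exists_normalHalf hc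
  have hs := (sexticRel_of_eq h.2.1.le hB.2.1.le hZ hrel).intCast (R := ZMod 2)
  rw [intCast_zmod_two_of_odd hm, intCast_zmod_two_of_odd hν] at hs
  obtain ⟨r, hr, ⟨hu0, hu1, hu2⟩, ⟨hb0, hb1, hb2⟩, hz0, hz1, hz2, hz3⟩ :=
    exists_cuspRelation_mod_two t ht _ _ _ _ _ _
    (IsPrimitive.exists_coeff_ne_zero h.1 h.2.1.le)
    (IsPrimitive.exists_coeff_ne_zero hB.1 hB.2.1.le) (hU.imp_left ht1) _ _ _ _ hs
  obtain ⟨hru, hrb, hr0⟩ := cuspRelations_spec t ht r hr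
  rw [sexticRel_iff] at hr0
  have quad : ∀ (P : ℤ[X]) (p : ℤ × ℤ × ℤ), P.natDegree ≤ 2 → (p.1 : ZMod 2) = P.coeff 0 →
      (p.2.1 : ZMod 2) = P.coeff 1 → (p.2.2 : ZMod 2) = P.coeff 2 → C 2 ∣ P - quadPoly p := by
    intro P p hP h0 h1 h2
    have hd : (P - quadPoly p).natDegree ≤ 2 :=
      (natDegree_sub_le _ _).trans (max_le hP (natDegree_quadPoly_le p))
    obtain ⟨c0, c1, c2⟩ := coeff_quadPoly p
    refine C_two_dvd_of_coeff (hd.trans (by norm_num)) ?_ ?_ ?_ ?_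
    · rw [coeff_sub, c0]; exact two_dvd_sub_of_intCast_eq h0
    · rw [coeff_sub, c1]; exact two_dvd_sub_of_intCast_eq h1
    · rw [coeff_sub, c2]; exact two_dvd_sub_of_intCast_eq h2
    · rw [coeff_eq_zero_of_natDegree_lt (by omega)]; exact dvd_zero _
  refine ⟨t.1, t.2, m, ν, r.2.2.2, B, Z, r.1, r.2.1, r.2.2.1, hB, hm, hν, hZ, hru, hrb, hrel, ?_,
    quad U r.1 h.2.1.le hu0 hu1 hu2, quad B r.2.1 hB.2.1.le hb0 hb1 hb2, ?_⟩
  · rw [← hr0, C_1, one_pow, one_mul, mul_one]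
  · obtain ⟨c0, c1, c2, c3⟩ := coeff_cubicPoly r.2.2.1
    refine C_two_dvd_of_coeff ((natDegree_sub_le _ _).trans
      (max_le hZ (natDegree_cubicPoly_le _))) ?_ ?_ ?_ ?_
    · rw [coeff_sub, c0]; exact two_dvd_sub_of_intCast_eq hz0
    · rw [coeff_sub, c1]; exact two_dvd_sub_of_intCast_eq hz1
    · rw [coeff_sub, c2]; exact two_dvd_sub_of_intCast_eq hz2
    · rw [coeff_sub, c3]; exact two_dvd_sub_of_intCast_eq hz3

lemma irreducible_cubicForm_mod_two : Irreducible (cubicForm.map (Int.castRingHom (ZMod 2))) := by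
  have h : cubicForm.map (Int.castRingHom (ZMod 2)) = X ^ 3 + X ^ 2 + 1 := by
    have two : (2 : (ZMod 2)[X]) = 0 := by
      rw [← C_ofNat, show (OfNat.ofNat 2 : ZMod 2) = 0 from rfl, C_0]
    simp only [cubicForm, Polynomial.map_add, Polynomial.map_sub, Polynomial.map_mul,
      Polynomial.map_pow, map_X, Polynomial.map_one, Polynomial.map_ofNat]
    linear_combination (2 * X + X ^ 2 - X ^ 3) * two
  rw [h]
  exact irreducible_cubic_zmod_two _ (by compute_degree!) (by simp) (by simp; decide)

lemma natDegree_cubicForm_mod_two : (cubicForm.map (Int.castRingHom (ZMod 2))).natDegree = 3 := by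
  rw [cubicForm_eq_cubicPoly]
  simp only [cubicPoly, Polynomial.map_add, Polynomial.map_mul, Polynomial.map_pow, map_X, map_C]
  have : ((Int.castRingHom (ZMod 2)) (-1 : ℤ)) ≠ 0 := by decide
  compute_degree!

lemma eq_zero_of_cubicForm_dvd {p : (ZMod 2)[X]} (hp : p.natDegree ≤ 2)
    (h : cubicForm.map (Int.castRingHom (ZMod 2)) ∣ p) : p = 0 := by
  by_contra h0
  have := natDegree_le_of_dvd h h0
  rw [natDegree_cubicForm_mod_two] at this
  omega

/-- If `zH = NP + 2ⁿT` with `H` irreducible modulo 2 and not dividing `P` modulo 2, then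
`2ⁿ` divides `N` and `z`. -/
lemma two_pow_dvd_of_mul_eq {H P : ℤ[X]} (hH : Irreducible (H.map (Int.castRingHom (ZMod 2))))
    (hP : ¬ H.map (Int.castRingHom (ZMod 2)) ∣ P.map (Int.castRingHom (ZMod 2))) (n : ℕ) :
    ∀ (N : ℤ) (z T : ℤ[X]), z * H = C N * P + C (2 ^ n) * T →
      ∃ (N' : ℤ) (z' : ℤ[X]), N = 2 ^ n * N' ∧ z = C (2 ^ n) * z' := by
  induction n with
  | zero => exact fun N z T _ => ⟨N, z, by simp, by simp⟩
  | succ n ih =>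
    intro N z T h
    obtain ⟨N', z', rfl, rfl⟩ := ih N z (C 2 * T) (by rw [h, pow_succ, C_mul]; ring)
    have h2 : (C (2 ^ n) : ℤ[X]) ≠ 0 := C_ne_zero.2 (by positivity)
    have h' : z' * H = C N' * P + C 2 * T := by
      apply mul_left_cancel₀ h2
      rw [pow_succ] at h
      simp only [C_mul] at h ⊢
      linear_combination h
    have hmod := congrArg (Polynomial.map (Int.castRingHom (ZMod 2))) h'
    have hT : (C 2 * T).map (Int.castRingHom (ZMod 2)) = 0 := C_two_dvd_iff.1 (dvd_mul_right _ _)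
    rw [Polynomial.map_add, hT, add_zero, Polynomial.map_mul, Polynomial.map_mul, map_C] at hmod
    have hN' : (Int.castRingHom (ZMod 2)) N' = 0 := by
      by_contra hN
      refine hP ?_
      have : H.map (Int.castRingHom (ZMod 2)) ∣
          C (Int.castRingHom (ZMod 2) N') * P.map (Int.castRingHom (ZMod 2)) := ⟨_, by rw [← hmod, mul_comm]⟩
      exact (hH.prime.dvd_or_dvd this).resolve_left fun hd =>
        hH.not_isUnit (isUnit_of_dvd_unit hd (isUnit_C.2 (Ne.isUnit hN)))
    have hz' : z'.map (Int.castRingHom (ZMod 2)) = 0 := by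
      rw [hN', C_0, zero_mul] at hmod
      exact (mul_eq_zero.1 hmod).resolve_right hH.ne_zero
    obtain ⟨z'', rfl⟩ := C_two_dvd_iff.2 hz'
    obtain ⟨N'', rfl⟩ := (ZMod.intCast_zmod_eq_zero_iff_dvd N' 2).1 hN'
    exact ⟨N'', z'', by rw [pow_succ]; push_cast; ring, by rw [pow_succ, C_mul]; ring⟩

/-- The 2-adic contraction step: halving improves the approximation by one binary digit. -/
lemma exists_two_pow_succ_dvd {e c m ν κ l k : ℤ} {U B Z U₀ B₀ Z₀ : ℤ[X]} {n : ℕ} (hn : 1 ≤ n)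
    (hm : Odd m) (hν : Odd ν) (hl : Odd l) (hk : Odd k)
    (hUd : U.natDegree ≤ 2) (hU₀d : U₀.natDegree ≤ 2) (hB₀d : B₀.natDegree ≤ 2)
    (hU₀ : ¬ C 2 ∣ U₀) (hB₀ : ¬ C 2 ∣ B₀)
    (h : C e * Z ^ 2 + C m * cubicForm * Z - C (c * m ^ 2) * cuspForm ^ 2 = C ν * U * B ^ 2)
    (h₀ : C e * Z₀ ^ 2 + cubicForm * Z₀ - C c * cuspForm ^ 2 = C κ * U₀ * B₀ ^ 2)
    (hZ : C 2 ∣ Z - Z₀) (hU : C (2 ^ n) ∣ U - C l * U₀) (hB : C (2 ^ n) ∣ B - C k * B₀) :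
    ∃ l', Odd l' ∧ C (2 ^ (n + 1)) ∣ U - C l' * U₀ := by
  set φ := Int.castRingHom (ZMod 2) with hφ
  obtain ⟨u, hu⟩ := hU
  obtain ⟨b, hb⟩ := hB
  obtain ⟨ζ, hζ⟩ := hZ
  obtain ⟨i, rfl⟩ := Nat.exists_eq_add_of_le hn
  have hpn : ((2 : ℤ) ^ (1 + i)) ≠ 0 := by positivity
  have hud : u.natDegree ≤ 2 := by
    rw [← natDegree_C_mul (p := u) hpn, ← hu]
    exact (natDegree_sub_le _ _).trans (max_le hUd ((natDegree_C_mul_le _ _).trans hU₀d))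
  have hB₀' : ¬ cubicForm.map φ ∣ B₀.map φ := fun hd =>
    hB₀ (C_two_dvd_iff.2 (eq_zero_of_cubicForm_dvd (natDegree_map_le.trans hB₀d) hd))
  have hU₀' : ¬ cubicForm.map φ ∣ U₀.map φ := fun hd =>
    hU₀ (C_two_dvd_iff.2 (eq_zero_of_cubicForm_dvd (natDegree_map_le.trans hU₀d) hd))
  have hirr := irreducible_cubicForm_mod_two
  have hP : ¬ cubicForm.map φ ∣ (U₀ * B₀ ^ 2).map φ := by
    rw [Polynomial.map_mul, Polynomial.map_pow]
    intro hd
    rcases hirr.prime.dvd_or_dvd hd with hd | hd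
    · exact hU₀' hd
    · exact hB₀' (hirr.prime.dvd_of_dvd_pow hd)
  set H : ℤ[X] := C m * cubicForm + C (2 * e * m) * Z₀ + C e * (Z - C m * Z₀) with hH
  have hHφ : H.map φ = cubicForm.map φ := by
    rw [← sub_eq_zero, ← Polynomial.map_sub]
    refine C_two_dvd_iff.1 ?_
    obtain ⟨m', rfl⟩ := hm
    refine ⟨C m' * cubicForm + C (e * (2 * m' + 1)) * Z₀ + C e * (ζ - C m' * Z₀), ?_⟩
    rw [hH]
    simp only [C_add, C_mul, C_1, C_ofNat] at hζ ⊢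
    linear_combination C e * hζ
  have hUe : U = C l * U₀ + C (2 ^ (1 + i)) * u := by rw [← hu]; ring
  have hBe : B = C k * B₀ + C (2 ^ (1 + i)) * b := by rw [← hb]; ring
  set R : ℤ[X] := C (ν * k) * U * B₀ * b + C (ν * 2 ^ i) * U * b ^ 2 with hR
  have key : (Z - C m * Z₀) * H = C (ν * l * k ^ 2 - m ^ 2 * κ) * (U₀ * B₀ ^ 2) +
      C (2 ^ (1 + i)) * (C (ν * k ^ 2) * u * B₀ ^ 2 + C 2 * R) := by
    have e1 : C ν * U * B ^ 2 = C ν * U * (C k * B₀ + C (2 ^ (1 + i)) * b) ^ 2 := by rw [← hBe]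
    have e2 : C ν * U * (C k * B₀) ^ 2 = C ν * (C l * U₀ + C (2 ^ (1 + i)) * u) * (C k * B₀) ^ 2 := by
      rw [← hUe]
    rw [hH, hR]
    simp only [C_add, C_mul, C_sub, C_pow, C_ofNat, pow_add, pow_one] at h h₀ e1 e2 ⊢
    linear_combination h - C m ^ 2 * h₀ + e1 + e2
  obtain ⟨N, z, hN, hz⟩ := two_pow_dvd_of_mul_eq (H := H) (P := U₀ * B₀ ^ 2)
    (by rw [hHφ]; exact hirr) (by rw [hHφ]; exact hP) (1 + i) _ _ _ key
  rw [hN, hz] at key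
  have key' : z * H = C N * (U₀ * B₀ ^ 2) + (C (ν * k ^ 2) * u * B₀ ^ 2 + C 2 * R) := by
    apply mul_left_cancel₀ (C_ne_zero.2 hpn)
    rw [C_mul] at key
    linear_combination key
  have hodd : φ (ν * k ^ 2) = 1 := intCast_zmod_two_of_odd (hν.mul hk.pow)
  have hmod := congrArg (Polynomial.map φ) key'
  have hT : (C 2 * R).map φ = 0 := C_two_dvd_iff.1 (dvd_mul_right _ _)
  simp only [Polynomial.map_add] at hmod
  rw [hT, add_zero] at hmod
  simp only [Polynomial.map_mul, Polynomial.map_pow, map_C, hodd, C_1, one_mul, hHφ] at hmod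
  have hdvd : cubicForm.map φ ∣ B₀.map φ ^ 2 * (C N * U₀ + u).map φ := by
    refine ⟨z.map φ, ?_⟩
    rw [Polynomial.map_add, Polynomial.map_mul, map_C]
    linear_combination -hmod
  have hzero : (C N * U₀ + u).map φ = 0 := by
    refine eq_zero_of_cubicForm_dvd (natDegree_map_le.trans ((natDegree_add_le _ _).trans
      (max_le ((natDegree_C_mul_le _ _).trans hU₀d) hud))) ?_
    exact (hirr.prime.dvd_or_dvd hdvd).resolve_left fun hd => hB₀' (hirr.prime.dvd_of_dvd_pow hd)
  obtain ⟨v, hv⟩ := C_two_dvd_iff.2 hzero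
  refine ⟨l - 2 ^ (1 + i) * N, ?_, v, ?_⟩
  · refine hl.sub_even ?_
    rw [pow_add, pow_one, mul_assoc]
    exact even_two_mul _
  · rw [hUe]
    simp only [C_sub, C_mul, pow_succ _ (1 + i)]
    linear_combination C (2 ^ (1 + i)) * hv

lemma cusps_mod_two : ∀ p ∈ cusps, ¬ (2 ∣ p.1 ∧ 2 ∣ p.2.1 ∧ 2 ∣ p.2.2) ∧
    ¬ (2 ∣ p.1 - 1 ∧ 2 ∣ p.2.1 - 1 ∧ 2 ∣ p.2.2 - 1) := by decide

lemma not_C_two_dvd_of_mem_cusps {p : ℤ × ℤ × ℤ} (hp : p ∈ cusps) : ¬ C 2 ∣ quadPoly p := by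
  intro h
  rw [C_dvd_iff_dvd_coeff] at h
  obtain ⟨c0, c1, c2⟩ := coeff_quadPoly p
  exact (cusps_mod_two p hp).1 ⟨c0 ▸ h 0, c1 ▸ h 1, c2 ▸ h 2⟩

/-- A halvable polynomial congruent to a cusp modulo 2 is proportional to it modulo `2ⁿ`. -/
lemma exists_two_pow_dvd {c : ℤ} (hc : c = 1 ∨ c = 2) (n : ℕ) : ∀ U : ℤ[X], IsHalvable c U →
    ∀ p ∈ cusps, C 2 ∣ U - quadPoly p → ∃ l, Odd l ∧ C (2 ^ (n + 1)) ∣ U - C l * quadPoly p := by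
  induction n with
  | zero => exact fun U _ p _ h => ⟨1, odd_one, by simpa using h⟩
  | succ n ih =>
    intro U hU p hp hUp
    have hU' : c = 1 ∨ ¬ ((U.coeff 0 : ZMod 2) = 1 ∧ (U.coeff 1 : ZMod 2) = 1 ∧
        (U.coeff 2 : ZMod 2) = 1) := by
      right
      rintro ⟨h0, h1, h2⟩
      rw [← Int.cast_one] at h0 h1 h2
      have h0' := two_dvd_sub_of_intCast_eq h0
      have h1' := two_dvd_sub_of_intCast_eq h1
      have h2' := two_dvd_sub_of_intCast_eq h2
      rw [C_dvd_iff_dvd_coeff] at hUp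
      obtain ⟨c0, c1, c2⟩ := coeff_quadPoly p
      have k0 := hUp 0
      have k1 := hUp 1
      have k2 := hUp 2
      rw [coeff_sub] at k0 k1 k2
      refine (cusps_mod_two p hp).2 ⟨?_, ?_, ?_⟩ <;> omega
    obtain ⟨e, c', m, ν, κ, B, Z, u, b, z, hB, hm, hν, hZ, hu, hb, h, h₀, hUu, hBb, hZz⟩ :=
      hU.exists_cuspRelation hc hU'
    obtain rfl : u = p := by
      have hsub : C 2 ∣ quadPoly u - quadPoly p := by
        have := dvd_sub hUp hUu
        rwa [sub_sub_sub_cancel_left] at this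
      rw [C_dvd_iff_dvd_coeff] at hsub
      obtain ⟨c0, c1, c2⟩ := coeff_quadPoly p
      obtain ⟨d0, d1, d2⟩ := coeff_quadPoly u
      have k0 := hsub 0
      have k1 := hsub 1
      have k2 := hsub 2
      rw [coeff_sub] at k0 k1 k2
      refine eq_of_mem_cusps u hu p hp ⟨?_, ?_, ?_⟩ <;> omega
    obtain ⟨l, hl, hUl⟩ := ih U hU u hp hUp
    obtain ⟨k, hk, hBk⟩ := ih B hB b hb hBb
    exact exists_two_pow_succ_dvd (by omega) hm hν hl hk hU.2.1.le (natDegree_quadPoly_le _)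
      (natDegree_quadPoly_le _) (not_C_two_dvd_of_mem_cusps hp) (not_C_two_dvd_of_mem_cusps hb)
      h h₀ hZz hUl hBk

lemma eq_zero_of_forall_two_pow_dvd {a : ℤ} (h : ∀ n : ℕ, (2 : ℤ) ^ (n + 1) ∣ a) : a = 0 := by
  by_contra ha
  have h1 := Int.le_of_dvd (abs_pos.2 ha) ((dvd_abs _ _).2 (h a.natAbs))
  have h2 : a.natAbs + 1 < 2 ^ (a.natAbs + 1) := Nat.lt_two_pow_self
  have h3 : ((a.natAbs + 1 : ℕ) : ℤ) < 2 ^ (a.natAbs + 1) := by exact_mod_cast h2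
  push_cast at h3
  omega

lemma cusps_ne_zero : ∀ p ∈ cusps, p.1 ≠ 0 ∨ p.2.1 ≠ 0 ∨ p.2.2 ≠ 0 := by decide

/-- Halvable polynomials are proportional to cusps. -/
theorem IsHalvable.exists_eq_cusp {c : ℤ} {U : ℤ[X]} (hc : c = 1 ∨ c = 2) (h : IsHalvable c U)
    (hU : c = 1 ∨ ¬ ((U.coeff 0 : ZMod 2) = 1 ∧ (U.coeff 1 : ZMod 2) = 1 ∧
      (U.coeff 2 : ZMod 2) = 1)) :
    ∃ p ∈ cusps, C 2 ∣ U - quadPoly p ∧ ∃ a b : ℤ, b ≠ 0 ∧ C b * U = C a * quadPoly p := by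
  obtain ⟨e, c', m, ν, κ, B, Z, p, b, z, hB, hm, hν, hZ, hp, hb, -, -, hUp, -, -⟩ :=
    h.exists_cuspRelation hc hU
  refine ⟨p, hp, hUp, ?_⟩
  have hprop : ∀ i j, U.coeff i * (quadPoly p).coeff j = U.coeff j * (quadPoly p).coeff i := by
    intro i j
    rw [← sub_eq_zero]
    refine eq_zero_of_forall_two_pow_dvd fun n => ?_
    obtain ⟨l, -, v, hv⟩ := exists_two_pow_dvd hc n U h p hp hUp
    have hi := congrArg (fun q => coeff q i) hv
    have hj := congrArg (fun q => coeff q j) hv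
    simp only [coeff_sub, coeff_C_mul] at hi hj
    exact ⟨v.coeff i * (quadPoly p).coeff j - v.coeff j * (quadPoly p).coeff i, by
      linear_combination (quadPoly p).coeff j * hi - (quadPoly p).coeff i * hj⟩
  have hex : ∃ j, (quadPoly p).coeff j ≠ 0 := by
    obtain ⟨c0, c1, c2⟩ := coeff_quadPoly p
    rcases cusps_ne_zero p hp with h0 | h0 | h0
    · exact ⟨0, by rwa [c0]⟩
    · exact ⟨1, by rwa [c1]⟩
    · exact ⟨2, by rwa [c2]⟩
  obtain ⟨j, hj⟩ := hex
  refine ⟨U.coeff j, (quadPoly p).coeff j, hj, Polynomial.ext fun i => ?_⟩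
  rw [coeff_C_mul, coeff_C_mul, mul_comm, hprop i j]

lemma exists_linear_factor_mod_two : ∀ u0 u2 z0 z1 z2 z3 w0 w1 w2 w3 w4 : ZMod 2,
    z0 ^ 2 = u0 * w0 → 0 = u0 * w1 + w0 → z1 ^ 2 = u0 * w2 + w1 + u2 * w0 →
    0 = u0 * w3 + w2 + u2 * w1 → z2 ^ 2 = u0 * w4 + w3 + u2 * w2 → 0 = w4 + u2 * w3 →
    z3 ^ 2 = u2 * w4 →
    ∃ l0 l1, z0 = u0 * l0 ∧ z1 = u0 * l1 + l0 ∧ z2 = l1 + u2 * l0 ∧ z3 = u2 * l1 := by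
  decide +kernel

lemma eq_linear_of_natDegree_le {R : Type*} [CommRing R] {P : R[X]} (h : P.natDegree ≤ 1) :
    P = C (P.coeff 0) + C (P.coeff 1) * X := by
  conv_lhs => rw [P.as_sum_range_C_mul_X_pow' (Nat.lt_succ_of_le h)]
  simp [Finset.sum_range_succ]

lemma eq_cubic_of_natDegree_le {R : Type*} [CommRing R] {P : R[X]} (h : P.natDegree ≤ 3) :
    P = C (P.coeff 0) + C (P.coeff 1) * X + C (P.coeff 2) * X ^ 2 + C (P.coeff 3) * X ^ 3 := by
  conv_lhs => rw [P.as_sum_range_C_mul_X_pow' (Nat.lt_succ_of_le h)]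
  simp [Finset.sum_range_succ]

lemma eq_quartic_of_natDegree_le {R : Type*} [CommRing R] {P : R[X]} (h : P.natDegree ≤ 4) :
    P = C (P.coeff 0) + C (P.coeff 1) * X + C (P.coeff 2) * X ^ 2 + C (P.coeff 3) * X ^ 3 +
      C (P.coeff 4) * X ^ 4 := by
  conv_lhs => rw [P.as_sum_range_C_mul_X_pow' (Nat.lt_succ_of_le h)]
  simp [Finset.sum_range_succ]

lemma two_eq_zero_zmod_two_poly : (2 : (ZMod 2)[X]) = 0 := by
  rw [← C_ofNat, show (OfNat.ofNat 2 : ZMod 2) = 0 from rfl, C_0]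

lemma exists_eq_mul_of_sq_eq {U Z W : (ZMod 2)[X]} (hU : U.natDegree ≤ 2) (hU1 : U.coeff 1 = 1)
    (hZ : Z.natDegree ≤ 3) (hW : W.natDegree ≤ 4) (h : Z ^ 2 = U * W) :
    ∃ l0 l1, Z = U * (C l0 + C l1 * X) := by
  have eU := eq_quadratic_of_natDegree_le hU
  have eZ := eq_cubic_of_natDegree_le hZ
  have eW := eq_quartic_of_natDegree_le hW
  rw [hU1] at eU
  generalize U.coeff 0 = u0 at *
  generalize U.coeff 2 = u2 at *
  generalize Z.coeff 0 = z0 at *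
  generalize Z.coeff 1 = z1 at *
  generalize Z.coeff 2 = z2 at *
  generalize Z.coeff 3 = z3 at *
  generalize W.coeff 0 = w0 at *
  generalize W.coeff 1 = w1 at *
  generalize W.coeff 2 = w2 at *
  generalize W.coeff 3 = w3 at *
  generalize W.coeff 4 = w4 at *
  subst eU eZ eW
  have key : C (z0 ^ 2 - u0 * w0) + C (0 - (u0 * w1 + w0)) * X +
      C (z1 ^ 2 - (u0 * w2 + w1 + u2 * w0)) * X ^ 2 + C (0 - (u0 * w3 + w2 + u2 * w1)) * X ^ 3 +
      C (z2 ^ 2 - (u0 * w4 + w3 + u2 * w2)) * X ^ 4 + C (0 - (w4 + u2 * w3)) * X ^ 5 +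
      C (z3 ^ 2 - u2 * w4) * X ^ 6 = (0 : (ZMod 2)[X]) := by
    simp only [C_add, C_sub, C_mul, C_pow, C_0, C_1] at h ⊢
    linear_combination h - (C z0 * C z1 * X + C z0 * C z2 * X ^ 2 + C z0 * C z3 * X ^ 3 +
      C z1 * C z2 * X ^ 3 + C z1 * C z3 * X ^ 4 + C z2 * C z3 * X ^ 5) * two_eq_zero_zmod_two_poly
  obtain ⟨e0, e1, e2, e3, e4, e5, e6⟩ := eq_zero_of_sextic_eq_zero key
  obtain ⟨l0, l1, h0, h1, h2, h3⟩ := exists_linear_factor_mod_two _ _ _ _ _ _ _ _ _ _ _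
    (sub_eq_zero.1 e0) (sub_eq_zero.1 e1) (sub_eq_zero.1 e2) (sub_eq_zero.1 e3)
    (sub_eq_zero.1 e4) (sub_eq_zero.1 e5) (sub_eq_zero.1 e6)
  refine ⟨l0, l1, ?_⟩
  rw [h0, h1, h2, h3]
  simp only [C_add, C_mul, C_1]
  ring

lemma natDegree_le_of_mul_eq {U W P : ℤ[X]} {k : ℕ} (hU : U.natDegree = 2) (h : P = U * W)
    (hP : P.natDegree ≤ k + 2) : W.natDegree ≤ k := by
  rcases eq_or_ne W 0 with rfl | hW
  · simp
  · have hU0 : U ≠ 0 := by rintro rfl; simp at hU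
    rw [h, natDegree_mul hU0 hW] at hP
    omega

/-- Two-power denominators can be removed when `U` is squarefree modulo 2. -/
lemma isHalvable_of_odd_coeff_one {U : ℤ[X]} (hU : U.IsPrimitive) (hd : U.natDegree = 2)
    (h1 : Odd (U.coeff 1)) (N : ℕ) : ∀ (n : ℤ) (Z : ℤ[X]), n.natAbs ≤ N → n ≠ 0 →
      Z.natDegree ≤ 3 → U ∣ Z ^ 2 + C n * cubicForm * Z - C (1 * n ^ 2) * cuspForm ^ 2 →
      IsHalvable 1 U := by
  induction N with
  | zero => intro n Z hn hn0; omega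
  | succ N ih =>
    rintro n Z hn hn0 hZ ⟨W, hW⟩
    rcases Int.even_or_odd n with he | ho
    swap
    · exact ⟨hU, hd, n, Z, W, ho, hZ, hW⟩
    obtain ⟨k, rfl⟩ := he.two_dvd
    have hWd : W.natDegree ≤ 4 := by
      refine natDegree_le_of_mul_eq hd hW ?_
      refine (natDegree_sub_le _ _).trans (max_le ((natDegree_add_le _ _).trans (max_le ?_ ?_)) ?_)
      · exact natDegree_pow_le.trans (by omega)
      · refine natDegree_mul_le.trans ?_
        have := natDegree_C_mul_le (2 * k) cubicForm
        have := natDegree_cubicForm_le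
        omega
      · refine (natDegree_C_mul_le _ _).trans (natDegree_pow_le.trans ?_)
        have := natDegree_cuspForm_le
        omega
    have hmod : Z.map (Int.castRingHom (ZMod 2)) ^ 2 =
        U.map (Int.castRingHom (ZMod 2)) * W.map (Int.castRingHom (ZMod 2)) := by
      rw [← sub_eq_zero, ← Polynomial.map_pow, ← Polynomial.map_mul, ← Polynomial.map_sub]
      refine C_two_dvd_iff.1 ⟨-(C k * cubicForm * Z) + C (2 * k ^ 2) * cuspForm ^ 2, ?_⟩
      simp only [C_mul, C_pow, C_1, C_ofNat] at hW ⊢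
      linear_combination hW
    obtain ⟨l0, l1, hl⟩ := exists_eq_mul_of_sq_eq (natDegree_map_le.trans hd.le)
      (by rw [coeff_map, eq_intCast, intCast_zmod_two_of_odd h1]) (natDegree_map_le.trans hZ)
      (natDegree_map_le.trans hWd) hmod
    obtain ⟨a, rfl⟩ := ZMod.intCast_surjective l0
    obtain ⟨b, rfl⟩ := ZMod.intCast_surjective l1
    have hdvd : C 2 ∣ Z - U * (C a + C b * X) := by
      rw [C_two_dvd_iff, Polynomial.map_sub, hl]
      simp
    obtain ⟨Z', hZ'⟩ := hdvd
    have hZd : Z'.natDegree ≤ 3 := by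
      rw [← natDegree_C_mul (p := Z') (a := 2) (by norm_num), ← hZ']
      refine (natDegree_sub_le _ _).trans (max_le hZ (natDegree_mul_le.trans ?_))
      have : (C a + C b * X : ℤ[X]).natDegree ≤ 1 := by compute_degree
      omega
    refine ih k Z' (by omega) (by omega) hZd ?_
    refine dvd_of_dvd_C_mul_of_isPrimitive hU (n := 4) (by norm_num) ?_
    have hZe : Z = U * (C a + C b * X) + C 2 * Z' := by rw [← hZ']; ring
    rw [hZe] at hW
    refine ⟨W - (C a + C b * X) * (U * (C a + C b * X) + C 4 * Z' + C (2 * k) * cubicForm), ?_⟩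
    simp only [C_mul, C_pow, C_1, C_ofNat] at hW ⊢
    linear_combination hW

lemma complement_mod_two : ∀ u0 u2 v0 v1 v2 l0 l1 : ZMod 2, u0 * v0 = 0 → u0 * v1 = l0 ^ 2 →
    u0 * v2 + u2 * v0 = l0 ^ 2 → u2 * v1 = l1 ^ 2 → u2 * v2 = l1 ^ 2 →
    ¬ (l0 = 0 ∧ l1 = 0) → v0 = 0 ∧ v1 = 1 ∧ v2 = 1 := by
  decide

lemma even_iff_intCast_zmod_two {a : ℤ} : (a : ZMod 2) = 0 ↔ Even a := by
  rw [ZMod.intCast_zmod_eq_zero_iff_dvd, even_iff_two_dvd]; rfl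

lemma odd_of_intCast_zmod_two {a : ℤ} (h : (a : ZMod 2) = 1) : Odd a := by
  rw [← Int.not_even_iff_odd, ← even_iff_intCast_zmod_two, h]
  decide

lemma complement_coeff_mod_two {U V L : ℤ[X]} {n : ℤ} (hU : U.natDegree ≤ 2)
    (hV : V.natDegree ≤ 2) (hL : L.natDegree ≤ 1) (hn : Even n) (hL2 : ¬ C 2 ∣ L)
    (hU1 : Even (U.coeff 1))
    (h : (X + X ^ 2) * L ^ 2 + C n * cubicForm * L - C (n ^ 2) * (X + X ^ 2) * (2 * X + 1) ^ 2 =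
      U * V) :
    (V.coeff 0 : ZMod 2) = 0 ∧ (V.coeff 1 : ZMod 2) = 1 ∧ (V.coeff 2 : ZMod 2) = 1 := by
  have eU := eq_quadratic_of_natDegree_le hU
  have eV := eq_quadratic_of_natDegree_le hV
  have eL := eq_linear_of_natDegree_le hL
  obtain ⟨k, rfl⟩ := hn.two_dvd
  obtain ⟨j, hj⟩ := hU1.two_dvd
  rw [hj] at eU
  generalize U.coeff 0 = u0 at *
  generalize U.coeff 2 = u2 at *
  generalize V.coeff 0 = v0 at *
  generalize V.coeff 1 = v1 at *
  generalize V.coeff 2 = v2 at *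
  generalize L.coeff 0 = l0 at *
  generalize L.coeff 1 = l1 at *
  have hL2' : ¬ ((l0 : ZMod 2) = 0 ∧ (l1 : ZMod 2) = 0) := by
    rintro ⟨h0, h1⟩
    obtain ⟨a, ha⟩ := (ZMod.intCast_zmod_eq_zero_iff_dvd _ 2).1 h0
    obtain ⟨b, hb⟩ := (ZMod.intCast_zmod_eq_zero_iff_dvd _ 2).1 h1
    refine hL2 ⟨C a + C b * X, ?_⟩
    rw [eL, ha, hb]
    simp only [C_mul, Nat.cast_ofNat]
    ring
  set φ := Int.castRingHom (ZMod 2)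
  have hT : (U * V - (X + X ^ 2) * L ^ 2).map φ = 0 := by
    rw [← C_two_dvd_iff]
    refine ⟨C k * cubicForm * L - C (2 * k ^ 2) * (X + X ^ 2) * (2 * X + 1) ^ 2, ?_⟩
    simp only [C_mul, C_pow, C_ofNat] at h ⊢
    linear_combination -h
  rw [eU, eV, eL] at hT
  simp only [Polynomial.map_add, Polynomial.map_sub, Polynomial.map_mul, Polynomial.map_pow, map_X,
    map_C, C_mul, eq_intCast, Int.cast_mul, Int.cast_ofNat, Polynomial.map_intCast,
    Polynomial.map_ofNat] at hT
  have key : C ((u0 : ZMod 2) * v0) + C ((u0 : ZMod 2) * v1 - (l0 : ZMod 2) ^ 2) * X +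
      C ((u0 : ZMod 2) * v2 + u2 * v0 - (l0 : ZMod 2) ^ 2) * X ^ 2 +
      C ((u2 : ZMod 2) * v1 - (l1 : ZMod 2) ^ 2) * X ^ 3 +
      C ((u2 : ZMod 2) * v2 - (l1 : ZMod 2) ^ 2) * X ^ 4 + C 0 * X ^ 5 + C 0 * X ^ 6 =
      (0 : (ZMod 2)[X]) := by
    simp only [C_add, C_sub, C_mul, C_pow, C_0, map_ofNat, map_intCast] at hT ⊢
    linear_combination hT + ((X + X ^ 2) * (l0 : (ZMod 2)[X]) * l1 * X -
      (j : (ZMod 2)[X]) * X * (v2 * X ^ 2 + v1 * X + v0)) * two_eq_zero_zmod_two_poly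
  obtain ⟨e0, e1, e2, e3, e4, -, -⟩ := eq_zero_of_sextic_eq_zero key
  exact complement_mod_two _ _ _ _ _ _ _ e0 (sub_eq_zero.1 e1) (sub_eq_zero.1 e2)
    (sub_eq_zero.1 e3) (sub_eq_zero.1 e4) hL2'

lemma eq_of_cusp_mod_two : ∀ p ∈ cusps, 2 ∣ p.1 → ¬ 2 ∣ p.2.1 → ¬ 2 ∣ p.2.2 → p = (0, 1, 1) := by
  decide

/-- A polynomial congruent to `X + X²` modulo 2 that is halvable up to powers of 2 is
proportional to `X + X²`. -/
lemma eval_eq_zero_of_mod_two {V Z : ℤ[X]} {n : ℤ} (hV : V.natDegree ≤ 2)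
    (h0 : (V.coeff 0 : ZMod 2) = 0) (h1 : (V.coeff 1 : ZMod 2) = 1) (h2 : (V.coeff 2 : ZMod 2) = 1)
    (hn : n ≠ 0) (hZ : Z.natDegree ≤ 3)
    (h : V ∣ Z ^ 2 + C n * cubicForm * Z - C (1 * n ^ 2) * cuspForm ^ 2) :
    V.eval 0 = 0 ∧ V.eval (-1) = 0 := by
  have hV0 : V ≠ 0 := by rintro rfl; simp at h1
  have hc := V.eq_C_content_mul_primPart
  have hc0 : V.content ≠ 0 := by rwa [Ne, content_eq_zero_iff]
  set V' := V.primPart with hV'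
  set k := V.content with hk
  have hcoeff : ∀ i, V.coeff i = k * V'.coeff i := fun i => by
    conv_lhs => rw [hc]
    rw [coeff_C_mul]
  have o1 := odd_of_intCast_zmod_two h1
  have o2 := odd_of_intCast_zmod_two h2
  have o0 := even_iff_intCast_zmod_two.1 h0
  rw [hcoeff, Int.odd_mul] at o1 o2
  rw [hcoeff, Int.even_mul] at o0
  have e0 : Even (V'.coeff 0) := o0.resolve_left (Int.not_even_iff_odd.2 o1.1)
  have hVd : V'.natDegree = 2 := by
    refine le_antisymm ?_ (le_natDegree_of_ne_zero ?_)
    · rwa [hc, natDegree_C_mul hc0] at hV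
    · intro hz
      have := o2.2
      rw [hz] at this
      exact absurd this (by decide)
  have hhalf : IsHalvable 1 V' := isHalvable_of_odd_coeff_one V.isPrimitive_primPart hVd o1.2
    n.natAbs n Z le_rfl hn hZ ((Dvd.intro_left _ hc.symm).trans h)
  obtain ⟨p, hp, ⟨w, hw⟩, a, b, hb, hab⟩ := hhalf.exists_eq_cusp (Or.inl rfl) (Or.inl rfl)
  obtain ⟨c0, c1, c2⟩ := coeff_quadPoly p
  have k0 := congrArg (fun q => coeff q 0) hw
  have k1 := congrArg (fun q => coeff q 1) hw
  have k2 := congrArg (fun q => coeff q 2) hw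
  simp only [coeff_sub, coeff_C_mul, c0, c1, c2] at k0 k1 k2
  obtain ⟨i0, hi0⟩ := e0
  obtain ⟨i1, hi1⟩ := o1.2
  obtain ⟨i2, hi2⟩ := o2.2
  obtain rfl := eq_of_cusp_mod_two p hp (by omega) (by omega) (by omega)
  have ev : ∀ y : ℤ, y + y ^ 2 = 0 → V.eval y = 0 := by
    intro y hy
    have := congrArg (eval y) hab
    simp only [quadPoly, eval_mul, eval_add, eval_C, eval_X, eval_pow] at this
    have hz : eval y V' = 0 := by
      apply (mul_eq_zero.1 _).resolve_left hb
      rw [this]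
      linear_combination a * hy
    rw [hc, eval_mul, hz, mul_zero]
  exact ⟨ev 0 (by norm_num), ev (-1) (by norm_num)⟩

lemma isHalvable_of_dvd {U L : ℤ[X]} {n : ℤ} (hU : U.IsPrimitive) (hd : U.natDegree = 2)
    (hL : L.natDegree ≤ 1) (hn0 : n ≠ 0) (hn : Even n → ¬ C 2 ∣ L)
    (h : U ∣ (X + X ^ 2) * L ^ 2 + C n * cubicForm * L -
      C (n ^ 2) * (X + X ^ 2) * (2 * X + 1) ^ 2) : IsHalvable 1 U := by
  obtain ⟨V, hV⟩ := h
  have hZd : ((X + X ^ 2) * L : ℤ[X]).natDegree ≤ 3 := by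
    refine natDegree_mul_le.trans ?_
    have : (X + X ^ 2 : ℤ[X]).natDegree ≤ 2 := by compute_degree
    omega
  have hZ : ((X + X ^ 2) * L) ^ 2 + C n * cubicForm * ((X + X ^ 2) * L) -
      C (1 * n ^ 2) * cuspForm ^ 2 = U * V * (X + X ^ 2) := by
    rw [← hV]
    simp only [C_mul, C_1, cuspForm]
    ring
  rcases Int.even_or_odd n with he | ho
  swap
  · exact ⟨hU, hd, n, _, V * (X + X ^ 2), ho, hZd, by rw [hZ]; ring⟩
  rcases Int.even_or_odd (U.coeff 1) with hU1 | hU1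
  swap
  · exact isHalvable_of_odd_coeff_one hU hd hU1 n.natAbs n _ le_rfl hn0 hZd
      ⟨V * (X + X ^ 2), by rw [hZ]; ring⟩
  exfalso
  have hVd : V.natDegree ≤ 2 := by
    refine natDegree_le_of_mul_eq hd hV ?_
    have q2 : (X + X ^ 2 : ℤ[X]).natDegree ≤ 2 := by compute_degree
    have q1 : (2 * X + 1 : ℤ[X]).natDegree ≤ 1 := by compute_degree
    refine (natDegree_sub_le _ _).trans (max_le ((natDegree_add_le _ _).trans (max_le ?_ ?_)) ?_)
    · refine natDegree_mul_le.trans ?_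
      have : (L ^ 2).natDegree ≤ 2 * L.natDegree := natDegree_pow_le
      omega
    · refine natDegree_mul_le.trans ?_
      have := natDegree_C_mul_le n cubicForm
      have := natDegree_cubicForm_le
      omega
    · refine natDegree_mul_le.trans ?_
      have := natDegree_C_mul_le (n ^ 2) (X + X ^ 2)
      have : ((2 * X + 1 : ℤ[X]) ^ 2).natDegree ≤ 2 * (2 * X + 1 : ℤ[X]).natDegree :=
        natDegree_pow_le
      omega
  obtain ⟨h0, h1, h2⟩ := complement_coeff_mod_two hd.le hVd hL he (hn he) hU1 hV
  obtain ⟨v0, v1⟩ := eval_eq_zero_of_mod_two hVd h0 h1 h2 hn0 hZd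
    ⟨U * (X + X ^ 2), by rw [hZ]; ring⟩
  have eL := eq_linear_of_natDegree_le hL
  have e0 := congrArg (eval 0) hV
  have e1 := congrArg (eval (-1)) hV
  simp only [eval_mul, v0, v1, mul_zero, eval_add, eval_sub, eval_pow, eval_X, eval_C, cubicForm,
    eval_one, eval_ofNat] at e0 e1
  have l0 : eval 0 L = 0 := (mul_eq_zero.1 (by linear_combination e0 : n * eval 0 L = 0)).resolve_left hn0
  have l1 : eval (-1) L = 0 :=
    (mul_eq_zero.1 (by linear_combination e1 : n * eval (-1) L = 0)).resolve_left hn0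
  rw [eL] at l0 l1
  simp only [eval_add, eval_mul, eval_C, eval_X, mul_zero, add_zero] at l0 l1
  rw [l0] at l1
  refine hn he ?_
  rw [eL, l0, show L.coeff 1 = 0 by omega]
  simp

lemma root_of_cusp {F : Type*} [Field F] [CharZero F] {p : ℤ × ℤ × ℤ} (hp : p ∈ cusps) {x : F}
    (h : aeval x (quadPoly p) = 0) : x = 0 ∨ x = -1 ∨ 2 * x + 1 = 0 := by
  simp only [cusps, List.mem_cons, List.not_mem_nil, or_false] at hp
  have : x * (x + 1) * (2 * x + 1) = 0 := by
    rcases hp with rfl | rfl | rfl | rfl | rfl | rfl <;>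
      simp only [quadPoly, map_add, map_mul, aeval_C, aeval_X, map_pow, map_zero, map_one, map_ofNat] at h
    · rw [show x = 0 by simpa using h]; ring
    · rw [show x + 1 = 0 from pow_eq_zero_iff two_ne_zero |>.1 (by linear_combination h)]; ring
    · rw [show 2 * x + 1 = 0 from pow_eq_zero_iff two_ne_zero |>.1 (by linear_combination h)]; ring
    · linear_combination (2 * x + 1) * h
    · linear_combination (x + 1) * h
    · linear_combination x * h
  rcases mul_eq_zero.1 this with h | h
  · rcases mul_eq_zero.1 h with h | h
    · exact Or.inl h
    · exact Or.inr (Or.inl (eq_neg_of_add_eq_zero_left h))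
  · exact Or.inr (Or.inr h)

/-- The roots of halvable polynomials are cusps. -/
theorem IsHalvable.root {F : Type*} [Field F] [CharZero F] {c : ℤ} {U : ℤ[X]} (hc : c = 1 ∨ c = 2)
    (h : IsHalvable c U) (hU : c = 1 ∨ ¬ ((U.coeff 0 : ZMod 2) = 1 ∧ (U.coeff 1 : ZMod 2) = 1 ∧
      (U.coeff 2 : ZMod 2) = 1)) {x : F} (hx : aeval x U = 0) :
    x = 0 ∨ x = -1 ∨ 2 * x + 1 = 0 := by
  obtain ⟨p, hp, -, a, b, hb, hab⟩ := h.exists_eq_cusp hc hU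
  refine root_of_cusp hp ?_
  have ha : a ≠ 0 := by
    rintro rfl
    rw [C_0, zero_mul] at hab
    exact mul_ne_zero (C_ne_zero.2 hb) h.1.ne_zero hab
  have := congrArg (aeval x) hab
  rw [map_mul, map_mul, hx, mul_zero, aeval_C, algebraMap_int_eq, eq_intCast] at this
  exact (mul_eq_zero.1 this.symm).resolve_left (by exact_mod_cast ha)

lemma isPrimitive_of_isCoprime_coeff {U : ℤ[X]} {i j : ℕ} (h : IsCoprime (U.coeff i) (U.coeff j)) :
    U.IsPrimitive := by
  intro r hr
  rw [C_dvd_iff_dvd_coeff] at hr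
  exact h.isUnit_of_dvd' (hr i) (hr j)

lemma isHalvable_of_odd_den {c a b e : ℤ} (hab : IsCoprime a b) (hne : a ≠ b) (hb : Odd b)
    (h : e ^ 2 + (a ^ 3 + a ^ 2 * b - 2 * a * b ^ 2 - b ^ 3) * e = c * (a * b * (a + b)) ^ 2) :
    IsHalvable c (quadPoly (0, b, b - a)) := by
  obtain ⟨c0, c1, c2⟩ := coeff_quadPoly (0, b, b - a)
  refine ⟨isPrimitive_of_isCoprime_coeff (i := 2) (j := 1) ?_, ?_, b ^ 3, C e * X ^ 3,
    (((C b * (X + 1)) ^ 2 + C b * (X + 1) * (C a * X) + (C a * X) ^ 2 +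
      C b * X * (C b * (X + 1) + C a * X) - 2 * (C b * X) ^ 2) * C e * X ^ 2 -
      2 * C c * C (a * b * (a + b)) * X ^ 3 * (C b * (C b * (X + 1) + C a * X) + C b ^ 2 * X) -
      C c * (C b * (X + 1) - C a * X) * X *
        (C b * (C b * (X + 1) + C a * X) + C b ^ 2 * X) ^ 2), hb.pow, by compute_degree, ?_⟩
  · rw [c1, c2]
    have := hab.neg_left.add_mul_left_left 1
    rwa [mul_one, neg_add_eq_sub] at this
  · refine le_antisymm (natDegree_quadPoly_le _) (le_natDegree_of_ne_zero ?_)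
    rw [c2]
    exact sub_ne_zero.2 hne.symm
  · have h' := congrArg (C : ℤ → ℤ[X]) h
    simp only [quadPoly, cubicForm, cuspForm, C_add, C_sub, C_mul, C_pow, C_0, C_ofNat] at h' ⊢
    linear_combination X ^ 6 * h'

lemma isHalvable_of_odd_num {c a b e : ℤ} (hab : IsCoprime a b) (hne : a ≠ b) (ha : Odd a)
    (h : e ^ 2 + (a ^ 3 + a ^ 2 * b - 2 * a * b ^ 2 - b ^ 3) * e = c * (a * b * (a + b)) ^ 2) :
    IsHalvable c (quadPoly (b, 2 * b - a, b - a)) := by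
  obtain ⟨c0, c1, c2⟩ := coeff_quadPoly (b, 2 * b - a, b - a)
  refine ⟨isPrimitive_of_isCoprime_coeff (i := 2) (j := 0) ?_, ?_, a ^ 3, C e * (X + 1) ^ 3,
    (-((C a * (X + 1)) ^ 2 - 2 * (C a * (X + 1)) * (C a * X + C b * (X + 1)) -
      ((C a * X) ^ 2 + C a * X * (C b * (X + 1)) + (C b * (X + 1)) ^ 2)) * C e * (X + 1) ^ 2 +
      2 * C c * C (a * b * (a + b)) * (X + 1) ^ 3 *
        (C a * (C a * (X + 1) + C a * X + C b * (X + 1))) -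
      C c * (C b * (X + 1) - C a * X) * (X + 1) *
        (C a * (C a * (X + 1) + C a * X + C b * (X + 1))) ^ 2), ha.pow, by compute_degree, ?_⟩
  · rw [c0, c2]
    have := hab.neg_left.add_mul_left_left 1
    rwa [mul_one, neg_add_eq_sub] at this
  · refine le_antisymm (natDegree_quadPoly_le _) (le_natDegree_of_ne_zero ?_)
    rw [c2]
    exact sub_ne_zero.2 hne.symm
  · have h' := congrArg (C : ℤ → ℤ[X]) h
    simp only [quadPoly, cubicForm, cuspForm, C_add, C_sub, C_mul, C_pow, C_ofNat] at h' ⊢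
    linear_combination (X + 1) ^ 6 * h'

lemma exists_intCast_eq_of_sq_eq {w : ℚ} {n : ℤ} (h : w ^ 2 = n) : ∃ m : ℤ, (m : ℚ) = w := by
  obtain ⟨m, hm⟩ := IsIntegrallyClosed.exists_algebraMap_eq_of_isIntegral_pow (R := ℤ) (x := w)
    two_pos (by rw [h]; exact isIntegral_algebraMap (x := n))
  exact ⟨m, by simpa using hm⟩

/-- Rational points on `w² = h(t)² + 4c q(t)²` for `c = 1, 2`. -/
theorem eq_zero_or_eq_neg_one_of_rat {c : ℤ} (hc : c = 1 ∨ c = 2) {t w : ℚ}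
    (h : w ^ 2 = (t ^ 3 + t ^ 2 - 2 * t - 1) ^ 2 + 4 * c * (t ^ 2 + t) ^ 2) : t = 0 ∨ t = -1 := by
  obtain ⟨a, b, hb0, hab, rfl⟩ : ∃ a b : ℤ, b ≠ 0 ∧ IsCoprime a b ∧ t = a / b :=
    ⟨t.num, t.den, by exact_mod_cast t.den_ne_zero, t.isCoprime_num_den, t.num_div_den.symm⟩
  have hbQ : (b : ℚ) ≠ 0 := by exact_mod_cast hb0
  have h_int : (w * b ^ 3) ^ 2 = (((a ^ 3 + a ^ 2 * b - 2 * a * b ^ 2 - b ^ 3) ^ 2 +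
      4 * c * (a * b * (a + b)) ^ 2 : ℤ) : ℚ) := by
    rw [mul_pow, h]
    push_cast
    field_simp
  obtain ⟨W, hW⟩ := exists_intCast_eq_of_sq_eq h_int
  rw [← hW] at h_int
  norm_cast at h_int
  have hpar : Even (W - (a ^ 3 + a ^ 2 * b - 2 * a * b ^ 2 - b ^ 3)) := by
    have : Even (W ^ 2 - (a ^ 3 + a ^ 2 * b - 2 * a * b ^ 2 - b ^ 3) ^ 2) := by
      rw [h_int, even_iff_two_dvd]
      exact ⟨2 * c * (a * b * (a + b)) ^ 2, by ring⟩
    rw [Int.even_sub] at this ⊢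
    simpa [Int.even_pow] using this
  obtain ⟨e, he⟩ := hpar.two_dvd
  have hrel : e ^ 2 + (a ^ 3 + a ^ 2 * b - 2 * a * b ^ 2 - b ^ 3) * e =
      c * (a * b * (a + b)) ^ 2 := by
    have : W = a ^ 3 + a ^ 2 * b - 2 * a * b ^ 2 - b ^ 3 + 2 * e := by linear_combination he
    rw [this] at h_int
    linarith
  have hne : a ≠ b := by
    rintro rfl
    have ha2 : a ^ 2 = 1 := by
      rcases Int.isUnit_iff.1 (isCoprime_self.1 hab) with rfl | rfl <;> rfl
    have h1 : W ^ 2 = (1 + 16 * c) * 1 ^ 2 := by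
      rw [h_int]
      linear_combination (1 + 16 * c) * (a ^ 4 + a ^ 2 + 1) * ha2
    exact sq_ne_mul_sq (by omega) one_ne_zero h1
  have hneQ : (a : ℚ) - b ≠ 0 := sub_ne_zero.2 (by exact_mod_cast hne)
  have hroot : (b / (a - b) : ℚ) = 0 ∨ (b / (a - b) : ℚ) = -1 ∨ 2 * (b / (a - b) : ℚ) + 1 = 0 := by
    rcases Int.even_or_odd b with hb | hb
    · have ha : Odd a := by
        by_contra ha
        have := hab.isUnit_of_dvd' (Int.not_odd_iff_even.1 ha).two_dvd hb.two_dvd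
        rw [Int.isUnit_iff] at this
        omega
      refine (isHalvable_of_odd_num hab hne ha hrel).root hc (Or.inr ?_) ?_
      · rw [(coeff_quadPoly _).1, intCast_zmod_two_of_even hb]
        rintro ⟨h0, -⟩
        exact absurd h0 (by decide)
      · simp only [quadPoly, map_add, map_mul, aeval_C, aeval_X, map_pow, algebraMap_int_eq,
          Int.coe_castRingHom]
        push_cast
        field_simp
        ring
    · refine (isHalvable_of_odd_den hab hne hb hrel).root hc (Or.inr ?_) ?_
      · rw [(coeff_quadPoly _).1]
        rintro ⟨h0, -⟩
        exact absurd h0 (by simp)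
      · simp only [quadPoly, map_add, map_mul, aeval_C, aeval_X, map_pow, algebraMap_int_eq,
          Int.coe_castRingHom]
        push_cast
        field_simp
        ring
  rcases hroot with h0 | h0 | h0
  · rw [div_eq_zero_iff] at h0
    exact absurd h0 (not_or.2 ⟨hbQ, hneQ⟩)
  · left
    rw [div_eq_iff hneQ] at h0
    rw [show (a : ℚ) = 0 by linear_combination h0, zero_div]
  · right
    field_simp at h0
    rw [div_eq_iff hbQ]
    linear_combination h0

lemma isCoprime_forms {a b : ℤ} (hab : IsCoprime a b) :
    IsCoprime (a * b * (a + b)) (a ^ 3 + a ^ 2 * b - 2 * a * b ^ 2 - b ^ 3) := by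
  refine IsCoprime.mul_left (IsCoprime.mul_left ?_ ?_) ?_
  · have := ((hab.pow_right (n := 3)).neg_right).add_mul_left_right (a ^ 2 + a * b - 2 * b ^ 2)
    refine cast (congrArg₂ IsCoprime ?_ ?_) this <;> ring
  · have := ((hab.symm.pow_right (n := 3))).add_mul_left_right (a ^ 2 - 2 * a * b - b ^ 2)
    refine cast (congrArg₂ IsCoprime ?_ ?_) this <;> ring
  · have h1 : IsCoprime (a + b) a := by
      have := hab.symm.add_mul_left_left 1
      rwa [mul_one, add_comm] at this
    have := (h1.pow_right (n := 3)).neg_right.add_mul_left_right (2 * a ^ 2 - a * b - b ^ 2)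
    refine cast (congrArg₂ IsCoprime ?_ ?_) this <;> ring

lemma isCoprime_sextic_values {a b : ℤ} (hab : IsCoprime a b) :
    IsCoprime ((a ^ 3 + a ^ 2 * b - 2 * a * b ^ 2 - b ^ 3) ^ 2 + 4 * (a * b * (a + b)) ^ 2)
      ((a ^ 3 + a ^ 2 * b - 2 * a * b ^ 2 - b ^ 3) ^ 2 + 8 * (a * b * (a + b)) ^ 2) := by
  have hco := isCoprime_forms hab
  have hodd : Odd (a ^ 3 + a ^ 2 * b - 2 * a * b ^ 2 - b ^ 3) := by
    rw [← Int.not_even_iff_odd]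
    intro he
    have h2 : ¬ (Even a ∧ Even b) := fun ⟨h1, h2⟩ => by
      have := hab.isUnit_of_dvd' h1.two_dvd h2.two_dvd
      rw [Int.isUnit_iff] at this
      omega
    simp only [Int.even_sub, Int.even_add, Int.even_mul, Int.even_pow] at he
    simp at he
    tauto
  set H := a ^ 3 + a ^ 2 * b - 2 * a * b ^ 2 - b ^ 3
  set Q := a * b * (a + b)
  have h1 : IsCoprime (H ^ 2 + 4 * Q ^ 2) (Q ^ 2) := by
    have := (hco.symm.pow (m := 2) (n := 2)).add_mul_left_left 4
    refine cast (congrArg₂ IsCoprime ?_ ?_) this <;> ring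
  have h2 : IsCoprime (H ^ 2 + 4 * Q ^ 2) 4 := by
    have h3 : IsCoprime H 2 := by
      obtain ⟨k, hk⟩ := hodd
      exact ⟨1, -k, by rw [hk]; ring⟩
    have h4 : IsCoprime (H ^ 2) (2 ^ 2) := h3.pow
    have := h4.add_mul_left_left (Q ^ 2)
    refine cast (congrArg₂ IsCoprime ?_ ?_) this <;> ring
  have := (h2.mul_right h1).add_mul_left_right 1
  refine cast (congrArg₂ IsCoprime ?_ ?_) this <;> ring

lemma exists_eq_add_mul {K : Type*} [Field K] [NumberField K] (hdeg : Module.finrank ℚ K ≤ 2)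
    {x : K} (hx : ∀ r : ℚ, x ≠ algebraMap ℚ K r) (w : K) :
    ∃ α β : ℚ, w = algebraMap ℚ K α + algebraMap ℚ K β * x := by
  have hli : LinearIndependent ℚ ![(1 : K), x] := by
    rw [LinearIndependent.pair_iff]
    intro s r h
    rw [Algebra.smul_def, Algebra.smul_def, mul_one] at h
    have hr : r = 0 := by
      by_contra hr
      refine hx (-s / r) ?_
      have : algebraMap ℚ K r ≠ 0 := by simpa using hr
      rw [map_div₀, map_neg, eq_div_iff this]
      linear_combination h
    rw [hr, map_zero, zero_mul, add_zero] at h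
    exact ⟨by simpa using h, hr⟩
  have hcard := hli.fintype_card_le_finrank
  simp only [Fintype.card_fin] at hcard
  have hspan := hli.span_eq_top_of_card_eq_finrank (by simp; omega)
  have hw : w ∈ Submodule.span ℚ (Set.range ![(1 : K), x]) := by rw [hspan]; trivial
  rw [Matrix.range_cons, Matrix.range_cons, Matrix.range_empty, Set.union_empty,
    Set.singleton_union, Submodule.mem_span_pair] at hw
  obtain ⟨α, β, h⟩ := hw
  exact ⟨α, β, by rw [← h, Algebra.smul_def, Algebra.smul_def, mul_one]⟩

lemma eq_zero_or_eq_neg_one_of_algebraMap {K : Type*} [Field K] [NumberField K]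
    (hdeg : Module.finrank ℚ K ≤ 2) {t : ℚ} {y z : K}
    (hy : y ^ 2 = algebraMap ℚ K ((t ^ 3 + t ^ 2 - 2 * t - 1) ^ 2 + 8 * (t ^ 2 + t) ^ 2))
    (hz : z ^ 2 = algebraMap ℚ K ((t ^ 3 + t ^ 2 - 2 * t - 1) ^ 2 + 4 * (t ^ 2 + t) ^ 2)) :
    t = 0 ∨ t = -1 := by
  have inj := (algebraMap ℚ K).injective
  have hzQ : (∃ r : ℚ, z = algebraMap ℚ K r) → t = 0 ∨ t = -1 := by
    rintro ⟨r, rfl⟩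
    refine eq_zero_or_eq_neg_one_of_rat (c := 1) (Or.inl rfl) (w := r) (inj ?_)
    rw [map_pow, hz]
    norm_num
  by_cases hyQ : ∃ r : ℚ, y = algebraMap ℚ K r
  · obtain ⟨r, rfl⟩ := hyQ
    refine eq_zero_or_eq_neg_one_of_rat (c := 2) (Or.inr rfl) (w := r) (inj ?_)
    rw [map_pow, hy]
    norm_num
  push Not at hyQ
  obtain ⟨α, β, hzy⟩ := exists_eq_add_mul hdeg hyQ z
  refine hzQ ?_
  obtain ⟨a, b, hb0, hab, rfl⟩ : ∃ a b : ℤ, b ≠ 0 ∧ IsCoprime a b ∧ t = a / b :=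
    ⟨t.num, t.den, by exact_mod_cast t.den_ne_zero, t.isCoprime_num_den, t.num_div_den.symm⟩
  have hbQ : (b : ℚ) ≠ 0 := by exact_mod_cast hb0
  set g₁ : ℚ := ((a / b : ℚ) ^ 3 + (a / b : ℚ) ^ 2 - 2 * (a / b : ℚ) - 1) ^ 2 +
    4 * ((a / b : ℚ) ^ 2 + (a / b : ℚ)) ^ 2 with hg₁
  set g₂ : ℚ := ((a / b : ℚ) ^ 3 + (a / b : ℚ) ^ 2 - 2 * (a / b : ℚ) - 1) ^ 2 +
    8 * ((a / b : ℚ) ^ 2 + (a / b : ℚ)) ^ 2 with hg₂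
  have hαβ : α * β = 0 := by
    by_contra hne
    refine hyQ ((g₁ - α ^ 2 - β ^ 2 * g₂) / (2 * (α * β))) ?_
    have h2 : algebraMap ℚ K (2 * (α * β)) ≠ 0 := by simpa using hne
    rw [map_div₀, eq_div_iff h2]
    rw [hzy] at hz
    simp only [map_sub, map_mul, map_pow, map_ofNat]
    linear_combination hz - algebraMap ℚ K β ^ 2 * hy
  rcases mul_eq_zero.1 hαβ with rfl | rfl
  swap
  · exact ⟨α, by rw [hzy]; simp⟩
  have hg : g₁ = β ^ 2 * g₂ := by
    apply inj
    rw [← hz, map_mul, ← hy, hzy]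
    simp only [map_zero, map_pow]
    ring
  have e₁ : g₁ * b ^ 6 = (((a ^ 3 + a ^ 2 * b - 2 * a * b ^ 2 - b ^ 3) ^ 2 +
      4 * (a * b * (a + b)) ^ 2 : ℤ) : ℚ) := by
    rw [hg₁]; push_cast; field_simp
  have e₂ : g₂ * b ^ 6 = (((a ^ 3 + a ^ 2 * b - 2 * a * b ^ 2 - b ^ 3) ^ 2 +
      8 * (a * b * (a + b)) ^ 2 : ℤ) : ℚ) := by
    rw [hg₂]; push_cast; field_simp
  have hco := isCoprime_sextic_values hab
  have hpos : 0 ≤ (a ^ 3 + a ^ 2 * b - 2 * a * b ^ 2 - b ^ 3) ^ 2 + 4 * (a * b * (a + b)) ^ 2 := by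
    positivity
  generalize (a ^ 3 + a ^ 2 * b - 2 * a * b ^ 2 - b ^ 3) ^ 2 + 4 * (a * b * (a + b)) ^ 2 = G₁ at *
  generalize (a ^ 3 + a ^ 2 * b - 2 * a * b ^ 2 - b ^ 3) ^ 2 + 8 * (a * b * (a + b)) ^ 2 = G₂ at *
  obtain ⟨S, hS⟩ := exists_intCast_eq_of_sq_eq (w := β * g₂ * b ^ 6) (n := G₁ * G₂) (by
    rw [Int.cast_mul, ← e₁, ← e₂, hg]; ring)
  have hS2 : G₁ * G₂ = S ^ 2 := by
    have : ((G₁ * G₂ : ℤ) : ℚ) = ((S ^ 2 : ℤ) : ℚ) := by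
      rw [Int.cast_mul, ← e₁, ← e₂, Int.cast_pow, hS, hg]; ring
    exact_mod_cast this
  obtain ⟨s, hs⟩ : ∃ s : ℤ, G₁ = s ^ 2 := by
    obtain ⟨s, hs | hs⟩ := Int.sq_of_isCoprime hco hS2
    · exact ⟨s, hs⟩
    · exact ⟨0, by nlinarith [sq_nonneg s]⟩
  have hz2 : z ^ 2 = algebraMap ℚ K (s / b ^ 3) ^ 2 := by
    rw [hz, ← map_pow]
    congr 1
    rw [div_pow, eq_div_iff (by positivity), ← pow_mul]
    rw [hs] at e₁
    push_cast at e₁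
    exact e₁
  rcases sq_eq_sq_iff_eq_or_eq_neg.1 hz2 with h | h
  · exact ⟨_, h⟩
  · exact ⟨-(s / b ^ 3), by rw [h, map_neg]⟩

lemma exists_isPrimitive_natDegree_two {K : Type*} [Field K] [NumberField K]
    (hdeg : Module.finrank ℚ K ≤ 2) {x : K} (hx : ∀ r : ℚ, x ≠ algebraMap ℚ K r) :
    ∃ U : ℤ[X], U.IsPrimitive ∧ U.natDegree = 2 ∧ aeval x U = 0 ∧
      ∀ P : ℤ[X], aeval x P = 0 → U ∣ P := by
  have h_int : IsIntegral ℚ x := Algebra.IsIntegral.isIntegral x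
  have hnd : (minpoly ℚ x).natDegree = 2 := by
    refine le_antisymm ((minpoly.natDegree_le x).trans hdeg) ?_
    rw [minpoly.two_le_natDegree_iff h_int]
    rintro ⟨r, hr⟩
    exact hx r hr.symm
  obtain ⟨b, U, hb, hU, hbU⟩ := exists_isPrimitive_eq_C_mul_map (minpoly ℚ x) (minpoly.ne_zero h_int)
  have haev : ∀ P : ℤ[X], aeval x (P.map (algebraMap ℤ ℚ)) = aeval x P := fun P =>
    aeval_map_algebraMap ℚ x P
  refine ⟨U, hU, ?_, ?_, fun P hP => ?_⟩
  · rw [hbU, natDegree_C_mul hb,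
      natDegree_map_eq_of_injective (algebraMap ℤ ℚ).injective_int] at hnd
    exact hnd
  · have h0 := minpoly.aeval ℚ x
    rw [hbU, map_mul, aeval_C, haev] at h0
    exact (mul_eq_zero.1 h0).resolve_left (by simpa using hb)
  · rw [IsPrimitive.Int.dvd_iff_map_cast_dvd_map_cast _ _ hU]
    have hd : minpoly ℚ x ∣ P.map (algebraMap ℤ ℚ) := minpoly.dvd ℚ x (by rw [haev, hP])
    exact (Dvd.intro_left _ hbU.symm).trans hd

lemma eq_zero_or_eq_neg_one_of_irrational {K : Type*} [Field K] [NumberField K]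
    (hdeg : Module.finrank ℚ K ≤ 2) {t z : K} (ht : ∀ r : ℚ, t ≠ algebraMap ℚ K r)
    (hz : z ^ 2 = (t ^ 3 + t ^ 2 - 2 * t - 1) ^ 2 + 4 * (t ^ 2 + t) ^ 2) : t = 0 ∨ t = -1 := by
  have ht1 : t - 1 ≠ 0 := sub_ne_zero.2 (by simpa using ht 1)
  obtain ⟨x, hx⟩ : ∃ x : K, x = 1 / (t - 1) := ⟨_, rfl⟩
  have hx0 : x ≠ 0 := by rw [hx]; exact one_div_ne_zero ht1
  have htx : t * x = x + 1 := by rw [hx]; field_simp; ring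
  have hxQ : ∀ r : ℚ, x ≠ algebraMap ℚ K r := by
    rintro r rfl
    refine ht ((r + 1) / r) ?_
    rw [map_div₀, eq_div_iff hx0, htx]
    simp
  have hx1 : x + 1 ≠ 0 := fun h => hxQ (-1) (by
    rw [map_neg, map_one]; linear_combination h)
  obtain ⟨w, hw⟩ : ∃ w : K, w = z * x ^ 3 := ⟨_, rfl⟩
  have hw2 : w ^ 2 = (1 + 4 * x + 3 * x ^ 2 - x ^ 3) ^ 2 + 4 * (x + 3 * x ^ 2 + 2 * x ^ 3) ^ 2 := by
    have e1 : (t ^ 3 + t ^ 2 - 2 * t - 1) * x ^ 3 = 1 + 4 * x + 3 * x ^ 2 - x ^ 3 := by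
      have : (t ^ 3 + t ^ 2 - 2 * t - 1) * x ^ 3 =
        (t * x) ^ 3 + (t * x) ^ 2 * x - 2 * (t * x) * x ^ 2 - x ^ 3 := by ring
      rw [this, htx]; ring
    have e2 : (t ^ 2 + t) * x ^ 3 = x + 3 * x ^ 2 + 2 * x ^ 3 := by
      have : (t ^ 2 + t) * x ^ 3 = (t * x) ^ 2 * x + (t * x) * x ^ 2 := by ring
      rw [this, htx]; ring
    rw [← e1, ← e2, hw, mul_pow, hz]; ring
  obtain ⟨f, hf⟩ : ∃ f : K, 2 * (x + x ^ 2) * f = w - (1 + 4 * x + 3 * x ^ 2 - x ^ 3) := by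
    refine ⟨(w - (1 + 4 * x + 3 * x ^ 2 - x ^ 3)) / (2 * (x + x ^ 2)), mul_div_cancel₀ _ ?_⟩
    rw [show x + x ^ 2 = x * (x + 1) by ring]
    exact mul_ne_zero two_ne_zero (mul_ne_zero hx0 hx1)
  have hfrel : (x + x ^ 2) * f ^ 2 + (1 + 4 * x + 3 * x ^ 2 - x ^ 3) * f -
      (x + x ^ 2) * (2 * x + 1) ^ 2 = 0 := by
    have h4 : (4 * (x * (x + 1))) ≠ 0 := mul_ne_zero (by norm_num) (mul_ne_zero hx0 hx1)
    apply (mul_eq_zero.1 _).resolve_left h4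
    have : w = 2 * (x + x ^ 2) * f + (1 + 4 * x + 3 * x ^ 2 - x ^ 3) := by rw [hf]; ring
    rw [this] at hw2
    linear_combination hw2
  obtain ⟨α, β, hαβ⟩ := exists_eq_add_mul hdeg hxQ f
  obtain ⟨n, L, hn, hnL, heven⟩ := exists_C_mul_eq_map_of_even (C α + C β * X)
  have hLx : aeval x L = n * f := by
    have := congrArg (aeval x) hnL
    rw [aeval_map_algebraMap] at this
    rw [← this, hαβ]
    simp
  have hLd : L.natDegree ≤ 1 := by
    rw [← natDegree_map_eq_of_injective (algebraMap ℤ ℚ).injective_int, ← hnL]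
    compute_degree
  obtain ⟨U, hU, hUd, hUx, hUdvd⟩ := exists_isPrimitive_natDegree_two hdeg hxQ
  have hhalf : IsHalvable 1 U := by
    refine isHalvable_of_dvd (n := n) hU hUd hLd (by exact_mod_cast hn)
      (fun h => heven (by exact_mod_cast h)) (hUdvd _ ?_)
    simp only [map_add, map_sub, map_mul, map_pow, aeval_X, hLx, cubicForm, map_one, map_ofNat,
      map_natCast]
    linear_combination (n : K) ^ 2 * hfrel
  rcases hhalf.root (Or.inl rfl) (Or.inl rfl) hUx with h | h | h
  · exact absurd h hx0
  · exact absurd h fun h => hx1 (by rw [h]; ring)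
  · right
    have h2 : (t + 1) * x = 0 := by linear_combination htx + h
    exact eq_neg_of_add_eq_zero_left ((mul_eq_zero.1 h2).resolve_right hx0)

theorem points_1and2and3_curve {K : Type*} [Field K] [NumberField K]
    (hdeg : Module.finrank ℚ K ≤ 2) (t y z : K) :
    (y ^ 2 = t ^ 6 + 2 * t ^ 5 + 5 * t ^ 4 + 10 * t ^ 3 + 10 * t ^ 2 + 4 * t + 1 ∧
        z ^ 2 = t ^ 6 + 2 * t ^ 5 + t ^ 4 + 2 * t ^ 3 + 6 * t ^ 2 + 4 * t + 1) ↔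
      ((t = 0 ∨ t = -1) ∧ (y = 1 ∨ y = -1) ∧ (z = 1 ∨ z = -1)) := by
  constructor
  · rintro ⟨hy, hz⟩
    have ht : t = 0 ∨ t = -1 := by
      by_cases htQ : ∃ r : ℚ, t = algebraMap ℚ K r
      · obtain ⟨r, rfl⟩ := htQ
        have := eq_zero_or_eq_neg_one_of_algebraMap hdeg (t := r) (y := y) (z := z)
          (by rw [hy]; simp only [map_add, map_sub, map_mul, map_pow, map_ofNat, map_one]; ring)
          (by rw [hz]; simp only [map_add, map_sub, map_mul, map_pow, map_ofNat, map_one]; ring)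
        exact this.imp (fun h => by rw [h, map_zero]) (fun h => by rw [h, map_neg, map_one])
      · push Not at htQ
        exact eq_zero_or_eq_neg_one_of_irrational hdeg htQ (by rw [hz]; ring)
    refine ⟨ht, sq_eq_one_iff.1 ?_, sq_eq_one_iff.1 ?_⟩
    · rw [hy]; rcases ht with rfl | rfl <;> ring
    · rw [hz]; rcases ht with rfl | rfl <;> ring
  · rintro ⟨rfl | rfl, rfl | rfl, rfl | rfl⟩ <;> constructor <;> ring
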